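/- Let G be a cyclically 5-edge-connected cubic graph of order n. For every edge e of G, the graph G − e (obtained from G by deleting the edge e and keeping its end-vertices) has at least n/2 − 1 perfect matchings. -/

import Mathlib

open scoped Classical

noncomputable section

/-- A finite multigraph: finitely many vertices and edges, each edge has an
unordered pair of endpoints (parallel edges and loops are allowed). -/
structure Multigraph where
  V : Type
  E : Type
  fintypeV : Fintype V := by infer_instance
  fintypeE : Fintype E := by infer_instance
  ends : E → Sym2 V

namespace Multigraph

instance (G : Multigraph) : Fintype G.V := G.fintypeV
instance (G : Multigraph) : Fintype G.E := G.fintypeE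

/-- The number of endpoints of the edge `e` that are equal to `v`
(a loop at `v` counts twice). -/
def inc (G : Multigraph) (v : G.V) (e : G.E) : ℕ :=
  if G.ends e = Sym2.diag v then 2 else if v ∈ G.ends e then 1 else 0

/-- The degree of a vertex: the number of edge-ends at it (loops count twice). -/
def degree (G : Multigraph) (v : G.V) : ℕ := ∑ e : G.E, G.inc v e

/-- A graph is cubic if every vertex has degree three. -/
def IsCubic (G : Multigraph) : Prop := ∀ v : G.V, G.degree v = 3

/-- A perfect matching: a set of (non-loop) edges such that every vertex is
incident with exactly one edge of the set. -/
def IsPerfectMatching (G : Multigraph) (M : Finset G.E) : Prop :=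
  (∀ e ∈ M, ¬ (G.ends e).IsDiag) ∧
  ∀ v : G.V, ∃! e, e ∈ M ∧ v ∈ G.ends e

/-- The number of perfect matchings of `G`. -/
def pmCount (G : Multigraph) : ℕ :=
  Nat.card {M : Finset G.E // G.IsPerfectMatching M}

/-- Every edge lies in some perfect matching. -/
def MatchingCovered (G : Multigraph) : Prop :=
  ∀ e : G.E, ∃ M, G.IsPerfectMatching M ∧ e ∈ M

/-- Every edge lies in at least two perfect matchings. -/
def MatchingDoubleCovered (G : Multigraph) : Prop :=
  ∀ e : G.E, 2 ≤ Nat.card {M : Finset G.E // G.IsPerfectMatching M ∧ e ∈ M}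

/-- Adjacency via some edge. -/
def Adj (G : Multigraph) (u v : G.V) : Prop := ∃ e : G.E, G.ends e = s(u, v)

/-- The graph is connected. -/
def Connected (G : Multigraph) : Prop :=
  Nonempty G.V ∧ ∀ u v : G.V, Relation.ReflTransGen G.Adj u v

/-- The edge-cut `E(A, Aᶜ)`: edges with one end in `A` and the other outside. -/
def cutEdges (G : Multigraph) (A : Set G.V) : Set G.E :=
  {e | ∃ u v, G.ends e = s(u, v) ∧ u ∈ A ∧ v ∉ A}

/-- `G` is `k`-edge-connected: no edge-cut has fewer than `k` edges. -/
def EdgeConnected (G : Multigraph) (k : ℕ) : Prop :=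
  ∀ A : Set G.V, A.Nonempty → A ≠ Set.univ → k ≤ (G.cutEdges A).ncard

/-- Bridgeless = 2-edge-connected: connected with no edge-cut of size `< 2`. -/
def Bridgeless (G : Multigraph) : Prop := G.Connected ∧ G.EdgeConnected 2

/-- The subgraph induced on `A` contains a cycle (two parallel edges count as a
cycle of length two): there is a nonempty set of edges inside `A` in which every
vertex is incident with zero or at least two edge-ends. -/
def HasCycleWithin (G : Multigraph) (A : Set G.V) : Prop :=
  ∃ F : Finset G.E, F.Nonempty ∧ (∀ e ∈ F, ∀ v ∈ G.ends e, v ∈ A) ∧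
    ∀ v : G.V, (∑ e ∈ F, G.inc v e) ≠ 1

/-- The edge-cut `E(A, Aᶜ)` is cyclic: both sides contain a cycle. -/
def IsCyclicCut (G : Multigraph) (A : Set G.V) : Prop :=
  G.HasCycleWithin A ∧ G.HasCycleWithin Aᶜ

/-- `G` is cyclically `k`-edge-connected: no cyclic edge-cut has fewer than `k` edges. -/
def CyclicallyEdgeConnected (G : Multigraph) (k : ℕ) : Prop :=
  ∀ A : Set G.V, G.IsCyclicCut A → k ≤ (G.cutEdges A).ncard

/-- A cut is tight: every perfect matching contains exactly one of its edges. -/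
def IsTightCut (G : Multigraph) (A : Set G.V) : Prop :=
  ∀ M : Finset G.E, G.IsPerfectMatching M →
    (M.filter (fun e => e ∈ G.cutEdges A)).card = 1

/-- Adjacency within a set `A` of vertices. -/
def AdjOn (G : Multigraph) (A : Set G.V) (u v : G.V) : Prop :=
  u ∈ A ∧ v ∈ A ∧ G.Adj u v

/-- The subgraph induced on `A` is connected (any two of its vertices are joined
by a walk inside `A`). -/
def ConnectedOn (G : Multigraph) (A : Set G.V) : Prop :=
  ∀ u ∈ A, ∀ v ∈ A, Relation.ReflTransGen (G.AdjOn A) u v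

/-- `G` is `k`-vertex-connected: it has at least `k+1` vertices and removing any
set of at most `k-1` vertices leaves it connected. -/
def VertexConnected (G : Multigraph) (k : ℕ) : Prop :=
  k + 1 ≤ Fintype.card G.V ∧
  ∀ T : Set G.V, T.ncard ≤ k - 1 → G.ConnectedOn Tᶜ

/-- `{x, y}` is a 2-vertex-cut: removing both vertices disconnects the graph. -/
def IsVertexCutPair (G : Multigraph) (x y : G.V) : Prop :=
  x ≠ y ∧ ¬ G.ConnectedOn ({x, y}ᶜ)

/-- `G` is bipartite: the vertices split into two classes so that each edge
joins the two classes. -/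
def Bipartite (G : Multigraph) : Prop :=
  ∃ X : Set G.V, ∀ e : G.E, ∃ u v, G.ends e = s(u, v) ∧ u ∈ X ∧ v ∉ X

/-- Delete a set of edges (keeping all vertices). -/
def deleteEdges (G : Multigraph) (F : Set G.E) : Multigraph where
  V := G.V
  E := {e : G.E // e ∉ F}
  ends e := G.ends e.1

/-- Contract the vertex set `A` to a single vertex (`none`), deleting the arising
loops and keeping parallel edges. -/
def contract (G : Multigraph) (A : Set G.V) : Multigraph where
  V := Option {x : G.V // x ∉ A}
  E := {e : G.E // ¬ ∀ v ∈ G.ends e, v ∈ A}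
  ends e := (G.ends e.1).map fun x => if h : x ∈ A then none else some ⟨x, h⟩

/-- Isomorphism of multigraphs. -/
def Iso (G₁ G₂ : Multigraph) : Prop :=
  ∃ (f : G₁.V ≃ G₂.V) (g : G₁.E ≃ G₂.E), ∀ e, G₂.ends (g e) = (G₁.ends e).map f

/-- The complete graph on four vertices. -/
def K4 : Multigraph where
  V := Fin 4
  E := {p : Fin 4 × Fin 4 // p.1 < p.2}
  ends p := s(p.1.1, p.1.2)

/-- The result of simultaneously replacing every vertex of `S` by a triangle;
`σ e v` records to which of the three triangle vertices at `v` the edge `e`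
(formerly ending at `v`) is attached. -/
def expandTriangles (H : Multigraph) (S : Set H.V) (σ : H.E → H.V → Fin 3) :
    Multigraph where
  V := {x : H.V // x ∉ S} ⊕ (S × Fin 3)
  E := H.E ⊕ (S × Fin 3)
  ends e :=
    match e with
    | Sum.inl e => (H.ends e).map fun x =>
        if h : x ∈ S then Sum.inr (⟨x, h⟩, σ e x) else Sum.inl ⟨x, h⟩
    | Sum.inr (w, i) => s(Sum.inr (w, i + 1), Sum.inr (w, i + 2))

/-- `G` is obtained from `H` by replacing each vertex of `S` with a triangle:
the three edges formerly incident with a vertex of `S` get attached to the three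
distinct new triangle vertices. -/
def IsTriangleExpansion (H : Multigraph) (S : Set H.V) (G : Multigraph) : Prop :=
  ∃ σ : H.E → H.V → Fin 3,
    (∀ v ∈ S, ∀ e : H.E, H.ends e ≠ Sym2.diag v) ∧
    (∀ v ∈ S, Set.InjOn (fun e => σ e v) {e : H.E | v ∈ H.ends e}) ∧
    Iso (expandTriangles H S σ) G

/-- Klee-graphs: `K₄` together with everything obtainable by repeatedly replacing
a vertex with a triangle. -/
inductive IsKlee : Multigraph → Prop
  | k4 (G : Multigraph) : Iso K4 G → IsKlee G
  | expand (G : Multigraph) (v : G.V) (H : Multigraph) :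
      IsKlee G → IsTriangleExpansion G {v} H → IsKlee H

/-- A nice 3-edge-cut (of a cubic graph). -/
def IsNiceCut (G : Multigraph) (A : Set G.V) : Prop :=
  A.Nonempty ∧ A ≠ Set.univ ∧ (G.cutEdges A).ncard = 3 ∧
  ¬ IsKlee (G.contract A) ∧
  (¬ IsKlee (G.contract Aᶜ) ∨
   9 ≤ A.ncard ∨
   (5 ≤ A.ncard ∧ ¬ G.IsTightCut A) ∨
   (A.ncard = 3 ∧
     2 ≤ Nat.card {M : Finset G.E // G.IsPerfectMatching M ∧
       ∀ e ∈ G.cutEdges A, e ∈ M}))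

/-- A brace: a bipartite matching covered graph without nontrivial tight edge-cuts. -/
def IsBrace (H : Multigraph) : Prop :=
  H.Bipartite ∧ H.MatchingCovered ∧
  ∀ A : Set H.V, 2 ≤ A.ncard → 2 ≤ Aᶜ.ncard → ¬ H.IsTightCut A

/-- Data describing a simultaneous gluing of graphs `K w` (through their vertices
`z w`) onto the vertices `w ∈ W` of `H`: the edge `e` of `H` incident with `w`
is identified with the edge `ε w e` of `K w` incident with `z w`, whose other
end is `y w e`. -/
structure GlueData (H : Multigraph) (W : Set H.V) where
  K : W → Multigraph
  z : (w : W) → (K w).V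
  d : (w : W) → {x : (K w).V // x ≠ z w}
  ε : (w : W) → H.E → (K w).E
  y : (w : W) → H.E → {x : (K w).V // x ≠ z w}
  noloop : ∀ (w : W) (e : H.E), H.ends e ≠ Sym2.diag (w : H.V)
  noloopK : ∀ (w : W) (k : (K w).E), (K w).ends k ≠ Sym2.diag (z w)
  ends_eq : ∀ (w : W) (e : H.E), (w : H.V) ∈ H.ends e →
      (K w).ends (ε w e) = s(z w, (y w e : (K w).V))
  inj : ∀ w : W, Set.InjOn (ε w) {e : H.E | (w : H.V) ∈ H.ends e}
  surj : ∀ (w : W) (k : (K w).E), z w ∈ (K w).ends k →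
      ∃ e : H.E, (w : H.V) ∈ H.ends e ∧ ε w e = k

/-- The graph obtained by gluing each `D.K w` through `D.z w` onto the vertex
`w ∈ W` of `H`. -/
def glue (H : Multigraph) (W : Set H.V) (D : GlueData H W) : Multigraph where
  V := {x : H.V // x ∉ W} ⊕ (Σ w : W, {x : (D.K w).V // x ≠ D.z w})
  E := H.E ⊕ (Σ w : W, {k : (D.K w).E // D.z w ∉ (D.K w).ends k})
  ends e :=
    match e with
    | Sum.inl e => (H.ends e).map fun x =>
        if h : x ∈ W then Sum.inr ⟨⟨x, h⟩, D.y ⟨x, h⟩ e⟩ else Sum.inl ⟨x, h⟩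
    | Sum.inr ⟨w, k⟩ => ((D.K w).ends k.1).map fun x =>
        if h : x = D.z w then Sum.inr ⟨w, D.d w⟩ else Sum.inr ⟨w, ⟨x, h⟩⟩

/-- The multiset of vertex degrees different from three. -/
def nonCubicDegrees (G : Multigraph) : Multiset ℕ :=
  ((Finset.univ : Finset G.V).val.map G.degree).filter (· ≠ 3)

/-- `H` is an odd minor of `G`: it is obtained by contracting pairwise disjoint
connected subgraphs, each with an odd number of vertices (deleting arising loops
and keeping parallel edges). -/
def IsOddMinor (G H : Multigraph) : Prop :=
  ∃ π : G.V → H.V, Function.Surjective π ∧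
    (∀ w : H.V, G.ConnectedOn (π ⁻¹' {w}) ∧ Odd (π ⁻¹' {w}).ncard) ∧
    ∃ g : {e : G.E // ∃ u v, G.ends e = s(u, v) ∧ π u ≠ π v} ≃ H.E,
      ∀ e, H.ends (g e) = (G.ends e.1).map π

/-- The 6-vertex graph consisting of two nonadjacent vertices `x = 0`, `y = 1`
and four vertices `a = 2`, `b = 3`, `c = 4`, `d = 5`, with edges `ab`, `cd` and
an edge from each of `a`, `b`, `c`, `d` to each of `x` and `y`. -/
def specialGraph : Multigraph where
  V := Fin 6
  E := Fin 10
  ends := ![s(2, 3), s(4, 5), s(2, 0), s(2, 1), s(3, 0), s(3, 1),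
            s(4, 0), s(4, 1), s(5, 0), s(5, 1)]

/-- The perfect matching polytope: the convex hull of the characteristic vectors
of the perfect matchings. -/
def pmPolytope (G : Multigraph) : Set (G.E → ℝ) :=
  convexHull ℝ {w | ∃ M : Finset G.E, G.IsPerfectMatching M ∧
    w = fun e => if e ∈ M then (1 : ℝ) else 0}

end Multigraph

open Multigraph

set_option linter.unusedSectionVars false

namespace ArcGraph

open Finset

variable {V E : Type} [Fintype V] [Fintype E]

/-- The edges of the graph with edge ends `a f`, `b f` that leave the vertex set `S`. -/
def cut (a b : E → V) (S : Finset V) : Finset E :=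
  univ.filter fun f => ¬(a f ∈ S ↔ b f ∈ S)

/-- A perfect matching: a set of non-loop edges meeting every star exactly once. -/
def IsPM (a b : E → V) (M : Finset E) : Prop :=
  (∀ f ∈ M, a f ≠ b f) ∧ ∀ v, (M ∩ cut a b {v}).card = 1

theorem mem_cut {a b : E → V} {S : Finset V} {f : E} :
    f ∈ cut a b S ↔ ¬(a f ∈ S ↔ b f ∈ S) := by
  simp [cut]

theorem mem_cut_singleton {a b : E → V} {v : V} {f : E} :
    f ∈ cut a b {v} ↔ ¬(a f = v ↔ b f = v) := by
  simp [mem_cut]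

theorem cut_compl (a b : E → V) (S : Finset V) : cut a b Sᶜ = cut a b S := by
  ext f; simp only [mem_cut, mem_compl]; tauto

/-- Double counting of edge ends, weighted by `p` on vertices and `x` on edges. -/
theorem sum_mul_star {R : Type*} [CommRing R] (a b : E → V) (x : E → R) (p : V → R)
    (hx : ∀ f, a f = b f → x f = 0) :
    ∑ v, p v * ∑ f ∈ cut a b {v}, x f = ∑ f, x f * (p (a f) + p (b f)) := by
  have h1 : ∀ v, p v * ∑ f ∈ cut a b {v}, x f =
      ∑ f, x f * ((if a f = v then p v else 0) + (if b f = v then p v else 0)) := by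
    intro v
    rw [cut, Finset.sum_filter, Finset.mul_sum]
    refine Finset.sum_congr rfl fun f _ => ?_
    by_cases h : a f = b f
    · simp [hx f h]
    · by_cases h1 : a f = v
      · have h2 : b f ≠ v := fun h2 => h (h1.trans h2.symm)
        simp [h1, h2, mul_comm]
      · by_cases h2 : b f = v <;> simp [h1, h2, mul_comm]
  simp_rw [h1]
  rw [Finset.sum_comm]
  refine Finset.sum_congr rfl fun f _ => ?_
  rw [← Finset.mul_sum, Finset.sum_add_distrib]
  simp

theorem sum_cut_eq {R : Type*} [AddCommMonoid R] (a b : E → V) (S : Finset V) (x : E → R) :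
    ∑ f ∈ cut a b S, x f = ∑ f, if ¬(a f ∈ S ↔ b f ∈ S) then x f else 0 := by
  rw [cut, Finset.sum_filter]

/-- Tutte's theorem for the subgraph spanned by the allowed edges inside a vertex set `U`. -/
theorem exists_matching_or_tutte_set (a b : E → V) (U : Finset V) (ok : E → Prop) :
    (∃ M : Finset E, (∀ f ∈ M, ok f ∧ a f ≠ b f ∧ a f ∈ U ∧ b f ∈ U) ∧
      ∀ v ∈ U, (M ∩ cut a b {v}).card = 1) ∨
    ∃ (B : Finset V) (Ks : Finset (Finset V)), B ⊆ U ∧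
      (∀ K ∈ Ks, Odd K.card ∧ K ⊆ U \ B) ∧
      (Ks : Set (Finset V)).PairwiseDisjoint id ∧
      (∀ K ∈ Ks, ∀ f, ok f → a f ∈ U → b f ∈ U →
        (a f ∈ K → b f ∈ K ∪ B) ∧ (b f ∈ K → a f ∈ K ∪ B)) ∧
      B.card < Ks.card ∧ (Odd Ks.card ↔ Odd (U.card + B.card)) := by
  let G : SimpleGraph U := SimpleGraph.fromRel fun x y => ∃ f, ok f ∧ a f = x ∧ b f = y
  by_cases hM : ∃ M : G.Subgraph, M.IsPerfectMatching
  · left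
    obtain ⟨M, hM⟩ := hM
    rw [SimpleGraph.Subgraph.isPerfectMatching_iff] at hM
    have hch : ∀ p : Sym2 U, p ∈ M.edgeSet →
        ∃ f, ok f ∧ s(a f, b f) = p.map Subtype.val ∧ a f ≠ b f := by
      intro p
      induction p using Sym2.ind with
      | _ x y =>
        intro h
        have h1 : G.Adj x y := M.adj_sub h
        obtain ⟨hne, ⟨f, hf, h2, h3⟩ | ⟨f, hf, h2, h3⟩⟩ := h1
        · refine ⟨f, hf, by simp [h2, h3], ?_⟩
          rw [h2, h3]; exact fun h => hne (Subtype.ext h)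
        · refine ⟨f, hf, by simp [h2, h3, Sym2.eq_swap], ?_⟩
          rw [h2, h3]; exact fun h => hne (Subtype.ext h.symm)
    choose c hc1 hc2 hc3 using hch
    refine ⟨univ.filter fun f => ∃ (p : Sym2 U) (hp : p ∈ M.edgeSet), f = c p hp, ?_, ?_⟩
    · intro f hf
      obtain ⟨p, hp, rfl⟩ := (mem_filter.1 hf).2
      have h := hc2 p hp
      have ha : a (c p hp) ∈ p.map Subtype.val := by rw [← h]; simp
      have hb : b (c p hp) ∈ p.map Subtype.val := by rw [← h]; simp
      rw [Sym2.mem_map] at ha hb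
      obtain ⟨x, -, hx⟩ := ha
      obtain ⟨y, -, hy⟩ := hb
      exact ⟨hc1 p hp, hc3 p hp, hx ▸ x.2, hy ▸ y.2⟩
    · intro v hv
      obtain ⟨w, hw, hw'⟩ := hM ⟨v, hv⟩
      rw [Finset.card_eq_one]
      refine ⟨c s(⟨v, hv⟩, w) hw, ?_⟩
      ext f
      simp only [mem_inter, mem_filter, mem_univ, true_and, mem_singleton, mem_cut_singleton]
      constructor
      · rintro ⟨⟨p, hp, rfl⟩, h⟩
        have h2 := hc2 p hp
        have hv' : v ∈ p.map Subtype.val := by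
          rw [← h2, Sym2.mem_iff]
          by_contra hcon
          push Not at hcon
          exact h (by simp [hcon.1.symm, hcon.2.symm])
        rw [Sym2.mem_map] at hv'
        obtain ⟨x, hx, hxv⟩ := hv'
        obtain ⟨y, rfl⟩ := Sym2.mem_iff_exists.1 hx
        have hx2 : x = ⟨v, hv⟩ := Subtype.ext hxv
        subst hx2
        obtain rfl := hw' y hp
        rfl
      · rintro rfl
        have hp : s(⟨v, hv⟩, w) ∈ M.edgeSet := hw
        refine ⟨⟨_, hp, rfl⟩, ?_⟩
        have h2 := hc2 _ hp
        have h3 := hc3 _ hp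
        rw [Sym2.map_mk, Sym2.eq_iff] at h2
        rcases h2 with ⟨h4, h5⟩ | ⟨h4, h5⟩
        · intro h; exact h3 (h4.trans (h.1 h4).symm)
        · intro h; exact h3 ((h.2 h5).trans h5.symm)
  · right
    rw [SimpleGraph.tutte] at hM
    push Not at hM
    obtain ⟨u, hu⟩ := hM
    set H := ((⊤ : G.Subgraph).deleteVerts u) with hH
    have hverts : H.verts = uᶜ := by
      rw [hH, SimpleGraph.Subgraph.deleteVerts_verts]; ext; simp
    have hmem : ∀ z : H.verts, (z : U) ∉ u := fun z hz => by
      have := z.2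
      simp [hH, hz] at this
    let φ : H.coe.ConnectedComponent → Finset V := fun c =>
      univ.filter fun v => ∃ x : H.verts, x ∈ c.supp ∧ ((x : U) : V) = v
    let B : Finset V := univ.filter fun v => ∃ x ∈ u, (x : V) = v
    have hφcard : ∀ c, (φ c).card = c.supp.ncard := by
      intro c
      have : (φ c : Set V) = (fun x : H.verts => ((x : U) : V)) '' c.supp := by
        ext v; simp only [φ, coe_filter, mem_univ, true_and, Set.mem_ofPred_eq, Set.mem_image]
      rw [← Set.ncard_coe_finset, this, Set.ncard_image_of_injective]
      exact fun x y h => Subtype.ext (Subtype.ext h)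
    have hφinj : Set.InjOn φ H.coe.oddComponents := by
      intro c hc c' hc' h
      have h1 : Odd c.supp.ncard := hc
      have h0 : c.supp.Nonempty := by
        apply Set.nonempty_of_ncard_ne_zero; intro h2; simp [h2] at h1
      obtain ⟨x, hx⟩ := h0
      have : ((x : U) : V) ∈ φ c' := by
        rw [← h]; simp only [φ, mem_filter, mem_univ, true_and]; exact ⟨x, hx, rfl⟩
      simp only [φ, mem_filter, mem_univ, true_and] at this
      obtain ⟨y, hy, hxy⟩ := this
      have : y = x := Subtype.ext (Subtype.ext hxy)
      subst this
      exact hx.symm.trans hy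
    have hBcard : B.card = u.ncard := by
      have : (B : Set V) = (fun x : U => (x : V)) '' u := by
        ext v; simp only [B, coe_filter, mem_univ, true_and, Set.mem_ofPred_eq, Set.mem_image]
      rw [← Set.ncard_coe_finset, this, Set.ncard_image_of_injective]
      exact fun x y h => Subtype.ext h
    have hKcard : (H.coe.oddComponents.toFinset.image φ).card = H.coe.oddComponents.ncard := by
      rw [Finset.card_image_of_injOn (by simpa using hφinj), Set.ncard_eq_toFinset_card']
    refine ⟨B, H.coe.oddComponents.toFinset.image φ, ?_, ?_, ?_, ?_, ?_, ?_⟩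
    · intro v hv
      obtain ⟨x, -, rfl⟩ := (mem_filter.1 hv).2
      exact x.2
    · intro K hK
      obtain ⟨c, hc, rfl⟩ := Finset.mem_image.1 hK
      rw [Set.mem_toFinset] at hc
      refine ⟨by rw [hφcard]; exact hc, ?_⟩
      intro v hv
      obtain ⟨x, hx, rfl⟩ := (mem_filter.1 hv).2
      refine mem_sdiff.2 ⟨x.1.2, ?_⟩
      intro h
      obtain ⟨y, hy, hxy⟩ := (mem_filter.1 h).2
      have : y = x.1 := Subtype.ext hxy
      subst this
      exact hmem x hy
    · intro K hK K' hK' hne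
      obtain ⟨c, hc, rfl⟩ := Finset.mem_image.1 (Finset.mem_coe.1 hK)
      obtain ⟨c', hc', rfl⟩ := Finset.mem_image.1 (Finset.mem_coe.1 hK')
      rw [Function.onFun, id, id, Finset.disjoint_left]
      intro v hv hv'
      obtain ⟨x, hx, rfl⟩ := (mem_filter.1 hv).2
      obtain ⟨y, hy, hxy⟩ := (mem_filter.1 hv').2
      have : y = x := Subtype.ext (Subtype.ext hxy)
      subst this
      exact hne (by rw [← (hx : _ = c), ← (hy : _ = c')])
    · intro K hK f hf ha hb
      obtain ⟨c, hc, rfl⟩ := Finset.mem_image.1 hK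
      have key : ∀ x y : U, (G.Adj x y ∨ x = y) → (x : V) ∈ φ c → (y : V) ∈ φ c ∪ B := by
        intro x y hxy hx
        by_cases hy : y ∈ u
        · exact mem_union_right _ (mem_filter.2 ⟨mem_univ _, y, hy, rfl⟩)
        · obtain ⟨z, hz, hzx⟩ := (mem_filter.1 hx).2
          have hzx' : (z : U) = x := Subtype.ext hzx
          subst hzx'
          refine mem_union_left _
            (mem_filter.2 ⟨mem_univ _, ⟨y, by rw [hverts]; exact hy⟩, ?_, rfl⟩)
          rcases hxy with hxy | rfl
          · rw [SimpleGraph.ConnectedComponent.mem_supp_iff] at hz ⊢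
            rw [← hz, SimpleGraph.ConnectedComponent.eq]
            refine (SimpleGraph.Adj.reachable ?_).symm
            have hz2 : (z : U) ∉ u := hmem z
            simp [hH, hz2, hy, hxy]
          · exact hz
      have hadj : (∃ g, ok g ∧ a g = a f ∧ b g = b f) := ⟨f, hf, rfl, rfl⟩
      constructor
      · refine key ⟨a f, ha⟩ ⟨b f, hb⟩ ?_
        by_cases h : a f = b f
        · right; exact Subtype.ext h
        · left; exact ⟨fun h' => h (congrArg Subtype.val h'), Or.inl hadj⟩
      · refine key ⟨b f, hb⟩ ⟨a f, ha⟩ ?_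
        by_cases h : a f = b f
        · right; exact Subtype.ext h.symm
        · left; exact ⟨fun h' => h (congrArg Subtype.val h').symm, Or.inr hadj⟩
    · rw [hKcard, hBcard]; exact hu
    · rw [hKcard, SimpleGraph.odd_ncard_oddComponents, hBcard]
      have h1 : Nat.card H.verts = H.verts.ncard := rfl
      have h2 : u.ncard + uᶜ.ncard = U.card := by
        rw [Set.ncard_add_ncard_compl]; simp
      rw [h1, hverts, ← h2]
      simp only [Nat.odd_iff]
      omega

/-- Edmonds' description of the perfect matching polytope. -/
structure Feasible (a b : E → V) (x : E → ℝ) : Prop where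
  nonneg : ∀ f, 0 ≤ x f
  loop : ∀ f, a f = b f → x f = 0
  star : ∀ v, ∑ f ∈ cut a b {v}, x f = 1
  odd : ∀ S : Finset V, Odd S.card → 1 ≤ ∑ f ∈ cut a b S, x f

theorem Feasible.even_card {a b : E → V} {x : E → ℝ} (hx : Feasible a b x) :
    Even (Fintype.card V) := by
  by_contra h
  have := hx.odd univ (by simpa using h)
  have h2 : cut a b univ = ∅ := by ext f; simp [mem_cut]
  rw [h2] at this
  simp at this
  linarith

/-- The vertices of the graph in which `S` is contracted to the single vertex `pt`. -/
inductive Contracted (S : Finset V) : Type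
  | pt : Contracted S
  | keep (v : {v // v ∉ S}) : Contracted S

/-- Contracted vertices as an option type. -/
def contractedEquiv (S : Finset V) : Option {v // v ∉ S} ≃ Contracted S where
  toFun o := o.elim .pt .keep
  invFun
    | .pt => none
    | .keep v => some v
  left_inv o := by cases o <;> rfl
  right_inv o := by cases o <;> rfl

instance (S : Finset V) : Fintype (Contracted S) :=
  Fintype.ofEquiv _ (contractedEquiv S)

/-- The projection onto the contracted vertex set. -/
def contractMap (S : Finset V) (v : V) : Contracted S :=
  if h : v ∈ S then .pt else .keep ⟨v, h⟩

theorem contractMap_eq_pt {S : Finset V} {v : V} :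
    contractMap S v = .pt ↔ v ∈ S := by
  unfold contractMap; split_ifs with h <;> simp [h]

theorem contractMap_eq_keep {S : Finset V} {v : V} {w : {v // v ∉ S}} :
    contractMap S v = .keep w ↔ v = w := by
  unfold contractMap; split_ifs with h
  · simp only [false_iff]; rintro rfl; exact w.2 h
  · rw [Contracted.keep.injEq, Subtype.ext_iff]

theorem contractMap_eq {S : Finset V} {v w : V} (h : contractMap S v = contractMap S w) :
    v = w ∨ v ∈ S ∧ w ∈ S := by
  by_cases hv : v ∈ S
  · exact Or.inr ⟨hv, contractMap_eq_pt.1 (h ▸ contractMap_eq_pt.2 hv)⟩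
  · left
    have h1 : contractMap S v = .keep ⟨v, hv⟩ := contractMap_eq_keep.2 rfl
    rw [h1] at h
    exact (contractMap_eq_keep.1 h.symm).symm

theorem card_contracted (S : Finset V) : Fintype.card (Contracted S) = Sᶜ.card + 1 := by
  rw [← Fintype.card_congr (contractedEquiv S), Fintype.card_option, Fintype.card_subtype]
  congr 2; ext v; simp

theorem cut_contractMap (a b : E → V) (S : Finset V) (T : Finset (Contracted S)) :
    cut (contractMap S ∘ a) (contractMap S ∘ b) T =
      cut a b (univ.filter fun v => contractMap S v ∈ T) := by
  ext f; simp [mem_cut]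

theorem odd_card_preimage_contractMap {S : Finset V} (hS : Odd S.card)
    (T : Finset (Contracted S)) :
    Odd (univ.filter fun v => contractMap S v ∈ T).card ↔ Odd T.card := by
  have h1 : (univ.filter fun v => contractMap S v ∈ T).card =
      ∑ w ∈ T, (univ.filter fun v => contractMap S v = w).card := by
    rw [Finset.card_eq_sum_card_fiberwise (f := contractMap S) (t := T)]
    · refine Finset.sum_congr rfl fun w hw => ?_
      congr 1; ext v; simp only [mem_filter, mem_univ, true_and]
      constructor
      · exact fun h => h.2
      · exact fun h => ⟨h ▸ hw, h⟩
    · intro v hv; exact (mem_filter.1 hv).2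
  have h2 : ∀ w : Contracted S, Odd (univ.filter fun v => contractMap S v = w).card := by
    intro w
    rcases w with _ | w
    · convert hS using 2; ext v; simp only [mem_filter, mem_univ, true_and]
      exact contractMap_eq_pt
    · have : (univ.filter fun v => contractMap S v = .keep w) = {(w : V)} := by
        ext v; simp only [mem_filter, mem_univ, true_and, mem_singleton]
        exact contractMap_eq_keep
      rw [this]; simp
  rw [h1, Finset.odd_sum_iff_odd_card_odd]
  congr! 2
  ext w; simp [h2 w]

/-- The duality form of Edmonds' theorem for a feasible point `x`. -/
def Dual (a b : E → V) (x : E → ℝ) : Prop :=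
  ∀ w : E → ℝ, (∀ M, IsPM a b M → (∀ f ∈ M, x f ≠ 0) → ∑ f ∈ M, w f = 0) →
    ∑ f, w f * x f = 0

/-- Perfect matchings of the graph in which `S` is contracted, described in the original graph. -/
structure SidePM (a b : E → V) (S : Finset V) (M : Finset E) : Prop where
  outside : ∀ f ∈ M, ¬(a f ∈ S ∧ b f ∈ S)
  noloop : ∀ f ∈ M, a f ≠ b f
  cut : (M ∩ cut a b S).card = 1
  star : ∀ v ∉ S, (M ∩ ArcGraph.cut a b {v}).card = 1

theorem SidePM.of_isPM {a b : E → V} {S : Finset V} {M : Finset E}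
    (h : IsPM (contractMap S ∘ a) (contractMap S ∘ b) M) : SidePM a b S M := by
  refine ⟨fun f hf hS => ?_, fun f hf h1 => ?_, ?_, fun v hv => ?_⟩
  · apply h.1 f hf
    simp only [Function.comp]
    rw [contractMap_eq_pt.2 hS.1, contractMap_eq_pt.2 hS.2]
  · exact h.1 f hf (by simp [h1])
  · rw [← h.2 .pt, cut_contractMap]
    congr 3; ext v; simp only [mem_filter, mem_univ, true_and, mem_singleton]
    exact contractMap_eq_pt.symm
  · rw [← h.2 (.keep ⟨v, hv⟩), cut_contractMap]
    congr 3; ext u; simp only [mem_filter, mem_univ, true_and, mem_singleton]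
    exact (contractMap_eq_keep (w := ⟨v, hv⟩)).symm

theorem Feasible.contract {a b : E → V} {x : E → ℝ} (hx : Feasible a b x) {S : Finset V}
    (hS : Odd S.card) (ht : ∑ f ∈ ArcGraph.cut a b S, x f = 1) :
    Feasible (contractMap S ∘ a) (contractMap S ∘ b)
      (fun f => if a f ∈ S ∧ b f ∈ S then 0 else x f) := by
  have key : ∀ T : Finset (Contracted S),
      ∑ f ∈ cut (contractMap S ∘ a) (contractMap S ∘ b) T,
        (if a f ∈ S ∧ b f ∈ S then 0 else x f) =
      ∑ f ∈ cut a b (univ.filter fun v => contractMap S v ∈ T), x f := by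
    intro T
    rw [← cut_contractMap]
    refine Finset.sum_congr rfl fun f hf => ?_
    rw [if_neg]
    intro h
    rw [mem_cut] at hf
    simp [contractMap_eq_pt.2 h.1, contractMap_eq_pt.2 h.2] at hf
  refine ⟨fun f => ?_, fun f hf => ?_, fun v => ?_, fun T hT => ?_⟩
  · split_ifs
    · exact le_rfl
    · exact hx.nonneg f
  · split_ifs with h
    · rfl
    · exact hx.loop f ((contractMap_eq hf).resolve_right h)
  · rw [key]
    rcases v with _ | v
    · convert ht using 3; ext v; simp only [mem_filter, mem_univ, true_and, mem_singleton]
      exact contractMap_eq_pt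
    · convert hx.star v using 3
      ext u; simp only [mem_filter, mem_univ, true_and, mem_singleton]
      exact contractMap_eq_keep
  · rw [key]
    exact hx.odd _ ((odd_card_preimage_contractMap hS T).2 hT)

theorem SidePM.glue {a b : E → V} {S : Finset V} {M N : Finset E} (hM : SidePM a b S M)
    (hN : SidePM a b Sᶜ N) {f : E} (hfM : f ∈ M) (hfN : f ∈ N) (hf : f ∈ ArcGraph.cut a b S) :
    IsPM a b (M ∪ N) ∧ M ∩ N = {f} := by
  have hM1 : ∀ g, g ∈ M ∧ g ∈ ArcGraph.cut a b S → g = f := by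
    intro g hg
    obtain ⟨k, hk⟩ := Finset.card_eq_one.1 hM.cut
    have h1 : g ∈ M ∩ ArcGraph.cut a b S := mem_inter.2 hg
    have h2 : f ∈ M ∩ ArcGraph.cut a b S := mem_inter.2 ⟨hfM, hf⟩
    rw [hk, mem_singleton] at h1 h2
    rw [h1, h2]
  have hN1 : ∀ g, g ∈ N ∧ g ∈ ArcGraph.cut a b S → g = f := by
    intro g hg
    obtain ⟨k, hk⟩ := Finset.card_eq_one.1 hN.cut
    rw [cut_compl] at hk
    have h1 : g ∈ N ∩ ArcGraph.cut a b S := mem_inter.2 hg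
    have h2 : f ∈ N ∩ ArcGraph.cut a b S := mem_inter.2 ⟨hfN, hf⟩
    rw [hk, mem_singleton] at h1 h2
    rw [h1, h2]
  have hMo := hM.outside
  have hNo := hN.outside
  refine ⟨⟨fun g hg => ?_, fun v => ?_⟩, ?_⟩
  · rcases mem_union.1 hg with h | h
    · exact hM.noloop g h
    · exact hN.noloop g h
  · by_cases hv : v ∈ S
    · rw [← hN.star v (by simpa using hv)]
      congr 1
      ext g
      simp only [mem_inter, mem_union]
      constructor
      · rintro ⟨h1 | h1, h2⟩
        · refine ⟨?_, h2⟩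
          have : g ∈ ArcGraph.cut a b S := by
            have := hMo g h1
            rw [mem_cut_singleton] at h2
            rw [mem_cut]
            by_cases h3 : a g = v
            · subst h3; tauto
            · have h4 : b g = v := by tauto
              subst h4; tauto
          rw [hM1 g ⟨h1, this⟩]; exact hfN
        · exact ⟨h1, h2⟩
      · rintro ⟨h1, h2⟩; exact ⟨Or.inr h1, h2⟩
    · rw [← hM.star v hv]
      congr 1
      ext g
      simp only [mem_inter, mem_union]
      constructor
      · rintro ⟨h1 | h1, h2⟩
        · exact ⟨h1, h2⟩
        · refine ⟨?_, h2⟩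
          have : g ∈ ArcGraph.cut a b S := by
            have := hNo g h1
            simp only [mem_compl] at this
            rw [mem_cut_singleton] at h2
            rw [mem_cut]
            by_cases h3 : a g = v
            · subst h3; tauto
            · have h4 : b g = v := by tauto
              subst h4; tauto
          rw [hN1 g ⟨h1, this⟩]; exact hfM
      · rintro ⟨h1, h2⟩; exact ⟨Or.inl h1, h2⟩
  · ext g
    simp only [mem_inter, mem_singleton]
    constructor
    · rintro ⟨h1, h2⟩
      apply hM1 g ⟨h1, ?_⟩
      have h3 := hMo g h1
      have h4 := hNo g h2
      simp only [mem_compl] at h4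
      rw [mem_cut]; tauto
    · rintro rfl; exact ⟨hfM, hfN⟩

theorem dual_of_sides {a b : E → V} {x : E → ℝ} {S : Finset V}
    (h1 : ∀ w : E → ℝ, (∀ M, SidePM a b S M → (∀ f ∈ M, x f ≠ 0) → ∑ f ∈ M, w f = 0) →
      ∑ f, w f * (if a f ∈ S ∧ b f ∈ S then 0 else x f) = 0)
    (h2 : ∀ w : E → ℝ, (∀ M, SidePM a b Sᶜ M → (∀ f ∈ M, x f ≠ 0) → ∑ f ∈ M, w f = 0) →
      ∑ f, w f * (if a f ∈ Sᶜ ∧ b f ∈ Sᶜ then 0 else x f) = 0) : Dual a b x := by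
  intro w hw
  have ex1 : ∀ f ∈ cut a b S, x f ≠ 0 →
      ∃ M, SidePM a b S M ∧ (∀ f ∈ M, x f ≠ 0) ∧ f ∈ M := by
    intro f hf hxf
    by_contra hcon
    push Not at hcon
    have := h1 (fun g => if g = f then 1 else 0) (fun M hM hM2 => by
      simp [hcon M hM hM2])
    have h3 : ¬ (a f ∈ S ∧ b f ∈ S) := by rw [mem_cut] at hf; tauto
    rw [Finset.sum_eq_single f (fun g _ hg => by simp [hg]) (by simp)] at this
    simp [h3, hxf] at this
  have ex2 : ∀ f ∈ cut a b S, x f ≠ 0 →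
      ∃ M, SidePM a b Sᶜ M ∧ (∀ f ∈ M, x f ≠ 0) ∧ f ∈ M := by
    intro f hf hxf
    by_contra hcon
    push Not at hcon
    have := h2 (fun g => if g = f then 1 else 0) (fun M hM hM2 => by
      simp [hcon M hM hM2])
    have h3 : ¬ (a f ∈ Sᶜ ∧ b f ∈ Sᶜ) := by rw [mem_cut] at hf; simp only [mem_compl]; tauto
    rw [Finset.sum_eq_single f (fun g _ hg => by simp [hg]) (by simp)] at this
    simp [-mem_compl, h3, hxf] at this
  have hglue : ∀ f ∈ cut a b S, ∀ M N, SidePM a b S M → (∀ f ∈ M, x f ≠ 0) → f ∈ M →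
      SidePM a b Sᶜ N → (∀ f ∈ N, x f ≠ 0) → f ∈ N →
      ∑ g ∈ M, w g + ∑ g ∈ N, w g = w f := by
    intro f hf M N hM hM2 hfM hN hN2 hfN
    obtain ⟨h3, h4⟩ := hM.glue hN hfM hfN hf
    have h5 := hw (M ∪ N) h3 (fun g hg => (mem_union.1 hg).elim (hM2 g) (hN2 g))
    have h6 := Finset.sum_union_inter (s₁ := M) (s₂ := N) (f := w)
    rw [h5, h4] at h6
    simp at h6
    linarith
  choose! N hN1 hN2 hN3 using ex2
  let α : E → ℝ := fun f => w f - ∑ g ∈ N f, w g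
  have e1 := h1 (fun f => w f - if f ∈ cut a b S then α f else 0) (by
    intro M hM hM2
    obtain ⟨f, hf⟩ := Finset.card_eq_one.1 hM.cut
    have hfm : f ∈ M ∩ cut a b S := by rw [hf]; simp
    obtain ⟨hfM, hfS⟩ := mem_inter.1 hfm
    rw [Finset.sum_sub_distrib, ← Finset.sum_filter, Finset.filter_mem_eq_inter, hf,
      Finset.sum_singleton]
    have := hglue f hfS M (N f) hM hM2 hfM (hN1 f hfS (hM2 f hfM)) (hN2 f hfS (hM2 f hfM))
      (hN3 f hfS (hM2 f hfM))
    simp only [α]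
    linarith)
  have e2 := h2 (fun f => w f - if f ∈ cut a b S then w f - α f else 0) (by
    intro K hK hK2
    obtain ⟨f, hf⟩ := Finset.card_eq_one.1 hK.cut
    rw [cut_compl] at hf
    have hfm : f ∈ K ∩ cut a b S := by rw [hf]; simp
    obtain ⟨hfK, hfS⟩ := mem_inter.1 hfm
    obtain ⟨M, hM, hM2, hfM⟩ := ex1 f hfS (hK2 f hfK)
    rw [Finset.sum_sub_distrib, ← Finset.sum_filter, Finset.filter_mem_eq_inter, hf,
      Finset.sum_singleton]
    have h3 := hglue f hfS M (N f) hM hM2 hfM (hN1 f hfS (hM2 f hfM)) (hN2 f hfS (hM2 f hfM))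
      (hN3 f hfS (hM2 f hfM))
    have h4 := hglue f hfS M K hM hM2 hfM hK hK2 hfK
    simp only [α]
    linarith)
  have e3 := congrArg₂ (· + ·) e1 e2
  simp only [← Finset.sum_add_distrib, add_zero] at e3
  rw [← e3]
  refine Finset.sum_congr rfl fun f _ => ?_
  by_cases ha : a f ∈ S <;> by_cases hb : b f ∈ S <;> simp [mem_cut, ha, hb] <;> ring

/-- Every feasible ray leaves a finite system of constraints at some constraint. -/
theorem exists_maximal_step {ι : Type*} [Fintype ι] (c d : ι → ℝ) (hd : ∀ i, 0 ≤ d i)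
    (hcd : ∀ i, d i = 0 → c i ≤ 0) (hc : ∃ i, 0 < c i) :
    ∃ t : ℝ, 0 < t ∧ (∀ i, c i * t ≤ d i) ∧ ∃ i, 0 < c i ∧ c i * t = d i := by
  obtain ⟨i₀, hi₀⟩ := hc
  obtain ⟨i, hi, hmin⟩ := Finset.exists_min_image (univ.filter fun i => 0 < c i)
    (fun i => d i / c i) ⟨i₀, by simpa using hi₀⟩
  have hci : 0 < c i := (mem_filter.1 hi).2
  have hdi : 0 < d i := lt_of_le_of_ne (hd i) fun h => absurd (hcd i h.symm) (not_le.2 hci)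
  refine ⟨d i / c i, div_pos hdi hci, fun j => ?_, i, hci, by field_simp⟩
  by_cases hj : 0 < c j
  · have := hmin j (by simpa using hj)
    rw [le_div_iff₀ hj] at this
    linarith
  · have h1 : c j * (d i / c i) ≤ 0 :=
      mul_nonpos_of_nonpos_of_nonneg (not_lt.1 hj) (div_pos hdi hci).le
    linarith [hd j]

theorem Feasible.dual_of_tight {a b : E → V} {x : E → ℝ} (hx : Feasible a b x)
    (ih : ∀ (W : Type) [Fintype W] (a' b' : E → W) (x' : E → ℝ),
      Fintype.card W < Fintype.card V → Feasible a' b' x' → Dual a' b' x')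
    {S : Finset V} (hS : Odd S.card) (hS1 : S.card ≠ 1) (hS2 : Sᶜ.card ≠ 1)
    (ht : ∑ f ∈ cut a b S, x f = 1) : Dual a b x := by
  have hodd : Odd Sᶜ.card := by
    have h1 := hx.even_card
    have h2 := Finset.card_add_card_compl S
    rw [← h2] at h1
    rw [Nat.odd_iff] at hS ⊢
    rw [Nat.even_iff] at h1
    omega
  have side : ∀ T : Finset V, Odd T.card → T.card ≠ 1 → ∑ f ∈ cut a b T, x f = 1 →
      ∀ w : E → ℝ, (∀ M, SidePM a b T M → (∀ f ∈ M, x f ≠ 0) → ∑ f ∈ M, w f = 0) →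
      ∑ f, w f * (if a f ∈ T ∧ b f ∈ T then 0 else x f) = 0 := by
    intro T hT hT1 hTt w hw
    refine ih (Contracted T) _ _ _ ?_ (hx.contract hT hTt) w fun M hM hM2 => ?_
    · rw [card_contracted]
      have := Finset.card_add_card_compl T
      rw [Nat.odd_iff] at hT
      omega
    · refine hw M (SidePM.of_isPM hM) fun f hf h0 => hM2 f hf ?_
      simp [h0]
  exact dual_of_sides (side S hS hS1 ht) (side Sᶜ hodd hS2 (by rw [cut_compl]; exact ht))

theorem Feasible.exists_isPM {a b : E → V} {x : E → ℝ} (hx : Feasible a b x) :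
    ∃ M, IsPM a b M ∧ ∀ f ∈ M, x f ≠ 0 := by
  rcases exists_matching_or_tutte_set a b univ (fun f => x f ≠ 0) with
    ⟨M, hM1, hM2⟩ | ⟨B, Ks, -, hK, hdisj, hcl, hlt, -⟩
  · exact ⟨M, ⟨fun f hf => (hM1 f hf).2.1, fun v => hM2 v (mem_univ v)⟩, fun f hf => (hM1 f hf).1⟩
  · exfalso
    have h1 : (Ks.card : ℝ) ≤ ∑ K ∈ Ks, ∑ f ∈ cut a b K, x f := by
      have := Finset.card_nsmul_le_sum Ks (fun K => ∑ f ∈ cut a b K, x f) 1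
        (fun K hK' => hx.odd K (hK K hK').1)
      simpa using this
    have h2 : ∑ K ∈ Ks, ∑ f ∈ cut a b K, x f ≤ ∑ v ∈ B, ∑ f ∈ cut a b {v}, x f := by
      have h3 : ∑ v ∈ B, ∑ f ∈ cut a b {v}, x f =
          ∑ v, (if v ∈ B then (1 : ℝ) else 0) * ∑ f ∈ cut a b {v}, x f := by
        simp
      rw [h3, sum_mul_star a b x _ hx.loop]
      simp only [sum_cut_eq]
      rw [Finset.sum_comm]
      refine Finset.sum_le_sum fun f _ => ?_
      by_cases hf : x f = 0
      · simp [hf]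
      have h4 : ∀ K ∈ Ks, ¬(a f ∈ K ↔ b f ∈ K) → a f ∈ K ∧ b f ∈ B ∨ b f ∈ K ∧ a f ∈ B := by
        intro K hK' hne
        have h5 := hcl K hK' f hf (mem_univ _) (mem_univ _)
        simp only [mem_union] at h5
        tauto
      have h6 : ∀ K ∈ Ks, ∀ v ∈ K, v ∉ B := fun K hK' v hv =>
        (mem_sdiff.1 ((hK K hK').2 hv)).2
      have huniq : ∀ v, ∑ K ∈ Ks, (if v ∈ K then x f else 0) ≤ if v ∈ B then 0 else x f := by
        intro v
        by_cases hv : ∃ K ∈ Ks, v ∈ K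
        · obtain ⟨K, hK', hvK⟩ := hv
          rw [Finset.sum_eq_single K, if_pos hvK, if_neg (h6 K hK' v hvK)]
          · intro L hL hne
            rw [if_neg]
            intro hvL
            exact Finset.disjoint_left.1 (hdisj hL hK' hne) hvL hvK
          · exact fun h => absurd hK' h
        · push Not at hv
          rw [Finset.sum_eq_zero fun K hK' => if_neg (hv K hK')]
          split_ifs
          · exact le_rfl
          · exact hx.nonneg f
      have h7 : ∀ K ∈ Ks, (if ¬(a f ∈ K ↔ b f ∈ K) then x f else 0) ≤
          (if b f ∈ B then if a f ∈ K then x f else 0 else 0) +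
          (if a f ∈ B then if b f ∈ K then x f else 0 else 0) := by
        intro K hK'
        have hn := hx.nonneg f
        have h5 := h4 K hK'
        by_cases h8 : (a f ∈ K ↔ b f ∈ K)
        · rw [if_neg (by simpa using h8)]
          positivity
        · rw [if_pos h8]
          rcases h5 h8 with ⟨h9, h10⟩ | ⟨h9, h10⟩
          · rw [if_pos h10, if_pos h9]
            split_ifs <;> linarith
          · rw [if_pos h10, if_pos h9]
            split_ifs <;> linarith
      refine (Finset.sum_le_sum h7).trans ?_
      rw [Finset.sum_add_distrib]
      have ha := huniq (a f)
      have hb := huniq (b f)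
      have hn := hx.nonneg f
      by_cases haB : a f ∈ B <;> by_cases hbB : b f ∈ B <;> simp [haB, hbB] at ha hb ⊢ <;> linarith
    have h3 : ∑ v ∈ B, ∑ f ∈ cut a b {v}, x f = B.card := by
      simp [hx.star]
    have h4 : (B.card : ℝ) < Ks.card := by exact_mod_cast hlt
    linarith

theorem card_inter_cut_eq_one {a b : E → V} {M : Finset E} (hM : IsPM a b M) {S : Finset V}
    (h : S.card = 1 ∨ Sᶜ.card = 1) : (M ∩ cut a b S).card = 1 := by
  rcases h with h | h
  · obtain ⟨v, rfl⟩ := Finset.card_eq_one.1 h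
    exact hM.2 v
  · obtain ⟨v, hv⟩ := Finset.card_eq_one.1 h
    rw [← cut_compl, hv]
    exact hM.2 v

theorem exists_mem_star {a b : E → V} {f : E} (h : a f ≠ b f) : f ∈ cut a b {a f} := by
  rw [mem_cut_singleton]; simp [h.symm]

theorem dual_of_card (n : ℕ) : ∀ (V : Type) [Fintype V] (a b : E → V) (x : E → ℝ),
    Fintype.card V = n → Feasible a b x → Dual a b x := by
  induction n using Nat.strong_induction_on with
  | _ n ihn =>
  intro V _ a b x hV hx
  have ih : ∀ (W : Type) [Fintype W] (a' b' : E → W) (x' : E → ℝ),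
      Fintype.card W < Fintype.card V → Feasible a' b' x' → Dual a' b' x' :=
    fun W _ a' b' x' hlt => ihn _ (hV ▸ hlt) W a' b' x' rfl
  clear ihn hV
  induction hm : (univ.filter fun f => x f ≠ 0).card using Nat.strong_induction_on
    generalizing x with
  | _ m ihm =>
  by_cases hnt : ∃ S : Finset V, Odd S.card ∧ S.card ≠ 1 ∧ Sᶜ.card ≠ 1 ∧
      ∑ f ∈ cut a b S, x f = 1
  · obtain ⟨S, h1, h2, h3, h4⟩ := hnt
    exact hx.dual_of_tight ih h1 h2 h3 h4
  push Not at hnt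
  obtain ⟨M, hM, hMx⟩ := hx.exists_isPM
  let c : Option (E ⊕ Finset V) → ℝ := fun i => match i with
    | none => 1
    | some (.inl f) => if f ∈ M then 1 else 0
    | some (.inr S) => if Odd S.card then ((M ∩ cut a b S).card : ℝ) - 1 else 0
  let d : Option (E ⊕ Finset V) → ℝ := fun i => match i with
    | none => 1
    | some (.inl f) => x f
    | some (.inr S) => if Odd S.card then ∑ f ∈ cut a b S, x f - 1 else 0
  have htriv : ∀ S : Finset V, Odd S.card → ∑ f ∈ cut a b S, x f = 1 →
      (M ∩ cut a b S).card = 1 := by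
    intro S hS ht
    by_contra hne
    apply hne
    apply card_inter_cut_eq_one hM
    by_contra hcon
    push Not at hcon
    exact hnt S hS hcon.1 hcon.2 ht
  obtain ⟨t, ht0, hle, i, hci, hi⟩ := exists_maximal_step c d
    (by
      rintro (_ | f | S)
      · simp [d]
      · exact hx.nonneg f
      · simp only [d]; split_ifs with h
        · linarith [hx.odd S h]
        · exact le_rfl)
    (by
      rintro (_ | f | S)
      · simp [d]
      · intro h
        have h' : x f = 0 := h
        simp only [c]
        rw [if_neg fun hf => hMx f hf h']
      · simp only [c, d]; split_ifs with h
        · intro h0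
          have := htriv S h (by linarith)
          rw [this]; simp
        · exact fun _ => le_rfl)
    ⟨none, by simp [c]⟩
  have ht1 : t ≤ 1 := by have := hle none; simpa [c, d] using this
  have hleE : ∀ f, (if f ∈ M then t else 0) ≤ x f := by
    intro f
    have := hle (some (.inl f))
    simp only [c, d] at this
    split_ifs at this ⊢ <;> linarith
  intro w hw
  have hwM : ∑ f ∈ M, w f = 0 := hw M hM hMx
  have hMsum : ∀ (T : Finset E), ∑ f ∈ T, (if f ∈ M then t else 0) = t * (M ∩ T).card := by
    intro T
    rw [← Finset.sum_filter, Finset.sum_const, Finset.filter_mem_eq_inter, Finset.inter_comm]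
    simp [mul_comm]
  rcases ht1.eq_or_lt with h1 | h1
  · have hxM : ∀ f, x f = if f ∈ M then t else 0 := by
      intro f
      by_cases hab : a f = b f
      · rw [hx.loop f hab, if_neg fun hf => hM.1 f hf hab]
      · have h2 := hx.star (a f)
        have h3 := hMsum (cut a b {a f})
        rw [hM.2, h1] at h3
        have h4 : ∑ g ∈ cut a b {a f}, (x g - if g ∈ M then t else 0) = 0 := by
          rw [Finset.sum_sub_distrib, h2, h1, h3]; simp
        rw [Finset.sum_eq_zero_iff_of_nonneg fun g _ => sub_nonneg.2 (hleE g)] at h4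
        linarith [h4 f (exists_mem_star hab)]
    have : ∀ f, w f * x f = if f ∈ M then w f else 0 := by
      intro f; rw [hxM f, h1]; simp
    simp_rw [this]
    rw [← Finset.sum_filter, Finset.filter_mem_eq_inter, Finset.univ_inter]
    exact hwM
  · have hs : 0 < 1 - t := by linarith
    set x' : E → ℝ := fun f => (x f - if f ∈ M then t else 0) / (1 - t) with hx'
    have hsum : ∀ T : Finset E, ∑ f ∈ T, x' f = (∑ f ∈ T, x f - t * (M ∩ T).card) / (1 - t) := by
      intro T
      rw [← hMsum T, ← Finset.sum_sub_distrib, Finset.sum_div]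
    have hfx' : Feasible a b x' := by
      refine ⟨fun f => div_nonneg (sub_nonneg.2 (hleE f)) hs.le, fun f hf => ?_, fun v => ?_,
        fun S hS => ?_⟩
      · simp only [hx']
        rw [hx.loop f hf, if_neg fun hf' => hM.1 f hf' hf]; simp
      · rw [hsum, hx.star, hM.2]; field_simp; simp
      · rw [hsum, le_div_iff₀ hs]
        have := hle (some (.inr S))
        simp only [c, d, if_pos hS] at this
        linarith
    have hsupp : ∀ f, x' f ≠ 0 → x f ≠ 0 := by
      intro f h h0
      apply h
      simp only [hx']
      rw [h0, if_neg fun hf => hMx f hf h0]; simp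
    have hd' : Dual a b x' := by
      rcases i with _ | f | S
      · simp only [c, d] at hi; linarith
      · simp only [c] at hci
        have hfM : f ∈ M := by by_contra h; simp [h] at hci
        have hxf : x f = t := by
          have : (if f ∈ M then (1 : ℝ) else 0) * t = x f := hi
          rw [if_pos hfM] at this; linarith
        refine ihm _ ?_ x' hfx' rfl
        rw [← hm]
        apply Finset.card_lt_card
        rw [Finset.ssubset_iff_of_subset]
        · refine ⟨f, ?_, ?_⟩
          · simp [hxf, ht0.ne']
          · simp [hx', hxf, hfM]
        · intro g hg
          simp only [mem_filter, mem_univ, true_and] at hg ⊢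
          exact hsupp g hg
      · simp only [c, d] at hci hi
        have hS : Odd S.card := by by_contra h; simp [h] at hci
        simp only [if_pos hS] at hci hi
        have hne : ¬(S.card = 1 ∨ Sᶜ.card = 1) := by
          intro h
          rw [card_inter_cut_eq_one hM h] at hci
          simp at hci
        push Not at hne
        refine hfx'.dual_of_tight ih hS hne.1 hne.2 ?_
        rw [hsum, div_eq_one_iff_eq hs.ne']
        linarith
    have h2 := hd' w fun N hN hN2 => hw N hN fun f hf => hsupp f (hN2 f hf)
    have h3 : ∀ f, w f * x f = (1 - t) * (w f * x' f) + t * (if f ∈ M then w f else 0) := by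
      intro f
      simp only [hx']
      split_ifs <;> field_simp <;> ring
    simp_rw [h3]
    rw [Finset.sum_add_distrib, ← Finset.mul_sum, ← Finset.mul_sum, h2, ← Finset.sum_filter,
      Finset.filter_mem_eq_inter, Finset.univ_inter, hwM]
    simp

/-- Edmonds' perfect matching polytope theorem, in dual form. -/
theorem Feasible.dual {a b : E → V} {x : E → ℝ} (hx : Feasible a b x) : Dual a b x :=
  dual_of_card _ V a b x rfl hx

theorem odd_card_inter_cut {a b : E → V} {T : Finset E} (hT : ∀ f ∈ T, a f ≠ b f)
    (hodd : ∀ v, Odd (T ∩ cut a b {v}).card) (S : Finset V) :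
    Odd (T ∩ cut a b S).card ↔ Odd S.card := by
  have h := sum_mul_star (R := ZMod 2) a b (fun f => if f ∈ T then 1 else 0)
    (fun v => if v ∈ S then 1 else 0) (fun f hf => if_neg fun hf' => hT f hf' hf)
  have h1 : ∀ D : Finset E, ∑ f ∈ D, (if f ∈ T then (1 : ZMod 2) else 0) = (T ∩ D).card := by
    intro D
    rw [← Finset.sum_filter, Finset.filter_mem_eq_inter, Finset.inter_comm]; simp
  have h2 : ∀ v, ((T ∩ cut a b {v}).card : ZMod 2) = 1 := fun v =>
    (ZMod.natCast_eq_one_iff_odd).2 (hodd v)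
  simp only [h1, h2, mul_one] at h
  have h3 : ∑ f, (if f ∈ T then (1 : ZMod 2) else 0) *
      ((if a f ∈ S then 1 else 0) + if b f ∈ S then 1 else 0) = (T ∩ cut a b S).card := by
    rw [← h1, sum_cut_eq]
    refine Finset.sum_congr rfl fun f _ => ?_
    have h11 : (1 : ZMod 2) + 1 = 0 := by decide
    by_cases ha : a f ∈ S <;> by_cases hb : b f ∈ S <;> simp [ha, hb, h11]
  rw [h3] at h
  have h4 : ∑ v, (if v ∈ S then (1 : ZMod 2) else 0) = S.card := by simp
  rw [h4] at h
  rw [← ZMod.natCast_eq_one_iff_odd, ← ZMod.natCast_eq_one_iff_odd, h]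

theorem IsPM.odd_inter_cut {a b : E → V} {M : Finset E} (hM : IsPM a b M) {S : Finset V}
    (hS : Odd S.card) : Odd (M ∩ cut a b S).card :=
  (odd_card_inter_cut hM.1 (fun v => by rw [hM.2]; exact odd_one) S).2 hS

theorem odd_card_cut {a b : E → V} (hab : ∀ f, a f ≠ b f)
    (hcub : ∀ v, (cut a b {v}).card = 3) (S : Finset V) :
    Odd (cut a b S).card ↔ Odd S.card := by
  have := odd_card_inter_cut (T := univ) (fun f _ => hab f)
    (fun v => by rw [univ_inter, hcub]; decide) S
  rwa [univ_inter] at this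

theorem two_mul_card_edges {a b : E → V} (hab : ∀ f, a f ≠ b f)
    (hcub : ∀ v, (cut a b {v}).card = 3) : 2 * Fintype.card E = 3 * Fintype.card V := by
  have h := sum_mul_star (R := ℤ) a b (fun _ => 1) (fun _ => 1) (fun f hf => absurd hf (hab f))
  simp [hcub] at h
  zify
  linarith

theorem sum_cut_ite_mem {a b : E → V} (M : Finset E) (S : Finset V) :
    ∑ f ∈ cut a b S, (if f ∈ M then (1 : ℝ) else 0) = (M ∩ cut a b S).card := by
  rw [← Finset.sum_filter, Finset.filter_mem_eq_inter, Finset.inter_comm]; simp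

/-- Dimension count: if the only obstruction to moving inside the affine hull of the perfect
matchings avoiding `e` is a single linear condition, then there are many such matchings. -/
theorem card_le_of_rigid {a b : E → V} (hab : ∀ f, a f ≠ b f)
    (hcub : ∀ v, (cut a b {v}).card = 3) (e : E) {x₀ : E → ℝ} (hx₀ : Feasible a b x₀)
    (he : x₀ e = 0) (H : Finset E)
    (hrig : ∀ y : E → ℝ, y e = 0 → (∀ v, ∑ f ∈ cut a b {v}, y f = 0) → ∑ f ∈ H, y f = 0 →
      (∀ f, x₀ f = 0 → y f = 0) ∧
      ∀ S : Finset V, Odd S.card → ∑ f ∈ cut a b S, x₀ f = 1 →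
        (∀ M, IsPM a b M → e ∉ M → (M ∩ cut a b S).card = 1) → ∑ f ∈ cut a b S, y f = 0) :
    Fintype.card V ≤ 2 * (univ.filter fun M => IsPM a b M ∧ e ∉ M).card + 2 := by
  set P := univ.filter fun M => IsPM a b M ∧ e ∉ M with hP
  have hPM : ∀ M ∈ P, IsPM a b M := fun M hM => (mem_filter.1 hM).2.1
  have hPe : ∀ M ∈ P, e ∉ M := fun M hM => (mem_filter.1 hM).2.2
  by_contra hlt
  push Not at hlt
  set m := P.card
  have hm : (0 : ℝ) < m + 1 := by positivity
  let x : E → ℝ := fun f => (x₀ f + ∑ M ∈ P, if f ∈ M then 1 else 0) / (m + 1)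
  have hxe : x e = 0 := by
    simp only [x]
    rw [he, Finset.sum_eq_zero fun M hM => if_neg (hPe M hM)]; simp
  have hxcut : ∀ S, ∑ f ∈ cut a b S, x f =
      (∑ f ∈ cut a b S, x₀ f + ∑ M ∈ P, ((M ∩ cut a b S).card : ℝ)) / (m + 1) := by
    intro S
    simp only [x]
    rw [← Finset.sum_div, Finset.sum_add_distrib, Finset.sum_comm]
    simp only [sum_cut_ite_mem]
  have hone : ∀ S : Finset V, Odd S.card → ∀ M ∈ P, (1 : ℝ) ≤ (M ∩ cut a b S).card := by
    intro S hS M hM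
    have := (hPM M hM).odd_inter_cut hS
    exact_mod_cast this.pos
  have hxF : Feasible a b x := by
    refine ⟨fun f => ?_, fun f hf => absurd hf (hab f), fun v => ?_, fun S hS => ?_⟩
    · have := hx₀.nonneg f
      simp only [x]
      positivity
    · rw [hxcut, hx₀.star, Finset.sum_congr rfl fun M hM => by rw [(hPM M hM).2]]
      simp only [Nat.cast_one, sum_const, nsmul_eq_mul, mul_one]
      rw [div_eq_one_iff_eq hm.ne', add_comm]
    · rw [hxcut, le_div_iff₀ hm]
      have h1 := hx₀.odd S hS
      have h2 := Finset.sum_le_sum (hone S hS)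
      simp at h2
      linarith
  let L : ((E → ℝ) × ℝ) →ₗ[ℝ] (ℝ × (V → ℝ) × ℝ × (P → ℝ)) :=
    { toFun := fun yc => (yc.1 e, fun v => ∑ f ∈ cut a b {v}, yc.1 f - yc.2,
        ∑ f ∈ H, yc.1 f - yc.2 * ∑ f ∈ H, x f, fun M => ∑ f ∈ M.1, yc.1 f)
      map_add' := by
        rintro ⟨y, c⟩ ⟨y', c'⟩
        ext <;> simp [Finset.sum_add_distrib] <;> ring
      map_smul' := by
        rintro r ⟨y, c⟩
        ext <;> simp [← Finset.mul_sum] <;> ring }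
  have hE := two_mul_card_edges hab hcub
  have hker : LinearMap.ker L ≠ ⊥ := by
    apply LinearMap.ker_ne_bot_of_finrank_lt
    simp only [Module.finrank_prod, Module.finrank_self, Module.finrank_fintype_fun_eq_card,
      Fintype.card_coe]
    omega
  obtain ⟨⟨y, c⟩, hyc, hne⟩ := Submodule.exists_mem_ne_zero_of_ne_bot hker
  rw [LinearMap.mem_ker] at hyc
  have hye : y e = 0 := congrArg Prod.fst hyc
  have hys : ∀ v, ∑ f ∈ cut a b {v}, y f = c := fun v =>
    sub_eq_zero.1 (congrFun (congrArg (fun z => z.2.1) hyc) v)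
  have hyH : ∑ f ∈ H, y f = c * ∑ f ∈ H, x f :=
    sub_eq_zero.1 (congrArg (fun z => z.2.2.1) hyc)
  have hyM : ∀ M ∈ P, ∑ f ∈ M, y f = 0 := fun M hM =>
    congrFun (congrArg (fun z => z.2.2.2) hyc) ⟨M, hM⟩
  let y' : E → ℝ := fun f => y f - c * x f
  have hy'e : y' e = 0 := by simp [y', hye, hxe]
  have hy'sum : ∀ T : Finset E, ∑ f ∈ T, y' f = ∑ f ∈ T, y f - c * ∑ f ∈ T, x f := by
    intro T; simp only [y']; rw [Finset.sum_sub_distrib, Finset.mul_sum]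
  have hy's : ∀ v, ∑ f ∈ cut a b {v}, y' f = 0 := by
    intro v; rw [hy'sum, hys, hxF.star]; ring
  obtain ⟨hr1, hr2⟩ := hrig y' hy'e hy's (by rw [hy'sum, hyH]; ring)
  let C : Option (E ⊕ Finset V) → ℝ := fun i => match i with
    | none => 1
    | some (.inl f) => - y' f
    | some (.inr S) => if Odd S.card then - ∑ f ∈ cut a b S, y' f else 0
  let D : Option (E ⊕ Finset V) → ℝ := fun i => match i with
    | none => 1
    | some (.inl f) => x f
    | some (.inr S) => if Odd S.card then ∑ f ∈ cut a b S, x f - 1 else 0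
  obtain ⟨t, ht0, hle, -⟩ := exists_maximal_step C D
    (by
      rintro (_ | f | S)
      · simp [D]
      · exact hxF.nonneg f
      · simp only [D]; split_ifs with h
        · linarith [hxF.odd S h]
        · exact le_rfl)
    (by
      rintro (_ | f | S)
      · simp [D]
      · intro h
        have h' : x f = 0 := h
        simp only [x] at h'
        rw [div_eq_zero_iff, or_iff_left hm.ne'] at h'
        have h1 := hx₀.nonneg f
        have h2 : (0 : ℝ) ≤ ∑ M ∈ P, if f ∈ M then 1 else 0 := by positivity
        simp only [C]
        rw [hr1 f (by linarith)]; simp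
      · simp only [C, D]; split_ifs with hS
        · intro h0
          rw [hxcut, sub_eq_zero, div_eq_one_iff_eq hm.ne'] at h0
          have h1 := hx₀.odd S hS
          have h2 := Finset.sum_le_sum (hone S hS)
          simp at h2
          have h3 : ∑ M ∈ P, (((M ∩ cut a b S).card : ℝ) - 1) = 0 := by
            rw [Finset.sum_sub_distrib]; simp; linarith
          rw [Finset.sum_eq_zero_iff_of_nonneg fun M hM => sub_nonneg.2 (hone S hS M hM)] at h3
          have h4 := hr2 S hS (by linarith) (fun M hM heM => by
            have := h3 M (by simp [hP, hM, heM])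
            have : ((M ∩ cut a b S).card : ℝ) = 1 := by linarith
            exact_mod_cast this)
          rw [h4]; simp
        · exact fun _ => le_rfl)
    ⟨none, by simp [C]⟩
  have hxt : Feasible a b (fun f => x f + t * y' f) := by
    refine ⟨fun f => ?_, fun f hf => absurd hf (hab f), fun v => ?_, fun S hS => ?_⟩
    · have := hle (some (.inl f))
      simp only [C, D] at this
      linarith
    · rw [Finset.sum_add_distrib, ← Finset.mul_sum, hy's, hxF.star]; simp
    · have := hle (some (.inr S))
      simp only [C, D, if_pos hS] at this
      rw [Finset.sum_add_distrib, ← Finset.mul_sum]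
      linarith
  have d1 := hxF.dual y (fun M hM hM2 => hyM M (by
    simp only [hP, mem_filter, mem_univ, true_and]
    exact ⟨hM, fun h => hM2 e h hxe⟩))
  have d2 := hxt.dual y (fun M hM hM2 => hyM M (by
    simp only [hP, mem_filter, mem_univ, true_and]
    exact ⟨hM, fun h => hM2 e h (by simp [hxe, hy'e])⟩))
  have d3 : ∑ f, y f * (x f + t * y' f) =
      ∑ f, y f * x f + t * (∑ f, y f * y f - c * ∑ f, y f * x f) := by
    rw [Finset.mul_sum, ← Finset.sum_sub_distrib, Finset.mul_sum, ← Finset.sum_add_distrib]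
    refine Finset.sum_congr rfl fun f _ => ?_
    simp only [y']; ring
  rw [d3, d1] at d2
  have d4 : ∑ f, y f * y f = 0 := by
    simp only [mul_zero, sub_zero, zero_add, mul_eq_zero] at d2
    exact d2.resolve_left ht0.ne'
  rw [Finset.sum_eq_zero_iff_of_nonneg fun f _ => mul_self_nonneg _] at d4
  have hy0 : y = 0 := by
    ext f; exact mul_self_eq_zero.1 (d4 f (mem_univ f))
  have hc0 : c = 0 := by
    rw [← hys (a e), hy0]; simp
  exact hne (by rw [hy0, hc0]; rfl)

/-- Every edge other than `e` with an end in `A` has its other end in `N`. -/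
def NbhdIn (a b : E → V) (e : E) (A N : Finset V) : Prop :=
  ∀ f, f ≠ e → (a f ∈ A → b f ∈ N) ∧ (b f ∈ A → a f ∈ N)

/-- The difference of the indicator functions of `N` and `A`. -/
def signed (A N : Finset V) (v : V) : ℤ :=
  (if v ∈ N then 1 else 0) - (if v ∈ A then 1 else 0)

theorem sum_signed_mul {R : Type*} [CommRing R] (A N : Finset V) (g : V → R) :
    ∑ v, (signed A N v : R) * g v = ∑ v ∈ N, g v - ∑ v ∈ A, g v := by
  simp [signed, sub_mul, Finset.sum_sub_distrib]

/-- Fractional perfect matchings with prescribed lower bounds, by Hall's theorem. -/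
theorem exists_weights_of_hall {a b : E → V} (hab : ∀ f, a f ≠ b f) (e : E) (w : E → ℕ)
    (hwe : w e = 0) (hw : ∀ v, ∑ f ∈ cut a b {v}, w f ≤ 20)
    (hall : ∀ A N : Finset V, Disjoint A N → NbhdIn a b e A N →
      ∑ f, (w f : ℤ) * (signed A N (a f) + signed A N (b f)) ≤ 20 * (N.card - A.card)) :
    ∃ x : E → ℝ, x e = 0 ∧ (∀ f, f ≠ e → (w f : ℝ) / 20 ≤ x f) ∧
      ∀ v, ∑ f ∈ cut a b {v}, x f = 1 := by
  let β : V → ℕ := fun v => 20 - ∑ f ∈ cut a b {v}, w f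
  have hβ : ∀ v, (β v : ℤ) = 20 - ∑ f ∈ cut a b {v}, (w f : ℤ) := by
    intro v; simp only [β]; rw [Nat.cast_sub (hw v)]; push_cast; rfl
  let adj : V → V → Prop := fun v v' => ∃ f, f ≠ e ∧ (a f = v ∧ b f = v' ∨ a f = v' ∧ b f = v)
  let t : (Σ v, Fin (β v)) → Finset (Σ v, Fin (β v)) := fun l => univ.filter fun l' => adj l.1 l'.1
  have hfib : ∀ S : Finset V, (univ.filter fun l : Σ v, Fin (β v) => l.1 ∈ S).card =
      ∑ v ∈ S, β v := by
    intro S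
    have : (univ.filter fun l : Σ v, Fin (β v) => l.1 ∈ S) = S.sigma fun _ => univ := by
      ext l; simp
    rw [this, Finset.card_sigma]; simp
  have hcond : ∀ s : Finset (Σ v, Fin (β v)), s.card ≤ (s.biUnion t).card := by
    intro s
    set A' := s.image Sigma.fst with hA'
    set N' := univ.filter fun v' => ∃ v ∈ A', adj v v' with hN'
    have h1 : s.biUnion t = univ.filter fun l : Σ v, Fin (β v) => l.1 ∈ N' := by
      ext l
      simp only [mem_biUnion, t, mem_filter, mem_univ, true_and, hN', hA', mem_image]
      constructor
      · rintro ⟨l', h, h'⟩; exact ⟨_, ⟨l', h, rfl⟩, h'⟩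
      · rintro ⟨_, ⟨l', h, rfl⟩, h'⟩; exact ⟨l', h, h'⟩
    have h2 : s ⊆ univ.filter fun l : Σ v, Fin (β v) => l.1 ∈ A' := by
      intro l hl
      simp only [mem_filter, mem_univ, true_and]
      exact mem_image_of_mem _ hl
    refine (Finset.card_le_card h2).trans ?_
    rw [h1, hfib, hfib]
    have hnb : NbhdIn a b e (A' \ N') (N' \ A') := by
      intro f hf
      have h3 : a f ∈ A' → b f ∈ N' := fun h =>
        mem_filter.2 ⟨mem_univ _, a f, h, f, hf, Or.inl ⟨rfl, rfl⟩⟩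
      have h4 : b f ∈ A' → a f ∈ N' := fun h =>
        mem_filter.2 ⟨mem_univ _, b f, h, f, hf, Or.inr ⟨rfl, rfl⟩⟩
      simp only [mem_sdiff]
      tauto
    have h3 := hall _ _ (by
      rw [Finset.disjoint_left]; intro v h h'
      exact (mem_sdiff.1 h').2 (mem_sdiff.1 h).1) hnb
    have h4 := sum_mul_star (R := ℤ) a b (fun f => (w f : ℤ)) (signed (A' \ N') (N' \ A'))
      (fun f hf => absurd hf (hab f))
    rw [← h4] at h3
    have h5 : ∑ v, signed (A' \ N') (N' \ A') v * (β v : ℤ) ≥ 0 := by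
      simp only [hβ, mul_sub, Finset.sum_sub_distrib]
      have := sum_signed_mul (R := ℤ) (A' \ N') (N' \ A') (fun _ => 20)
      simp only [Int.cast_id] at this
      rw [this]
      simp only [sum_const, nsmul_eq_mul]
      linarith
    have h6 := sum_signed_mul (R := ℤ) (A' \ N') (N' \ A') (fun v => (β v : ℤ))
    simp only [Int.cast_id] at h6
    rw [h6] at h5
    have h7 := Finset.sum_sdiff_sub_sum_sdiff (s₁ := A') (s₂ := N') (f := fun v => (β v : ℤ))
    rw [h7] at h5
    zify
    linarith
  obtain ⟨σ, hσ, hσt⟩ := (Finset.all_card_le_biUnion_card_iff_exists_injective t).1 hcond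
  have hσb : Function.Bijective σ := Finite.injective_iff_bijective.1 hσ
  have hφ : ∀ l, ∃ f, f ≠ e ∧ (a f = l.1 ∧ b f = (σ l).1 ∨ a f = (σ l).1 ∧ b f = l.1) := by
    intro l
    have := hσt l
    exact (mem_filter.1 this).2
  choose φ hφe hφ using hφ
  let z : E → ℝ := fun f => (univ.filter fun l => φ l = f).card / 2
  have hz : ∀ v, ∑ f ∈ cut a b {v}, z f = β v := by
    intro v
    have h1 : ∑ f ∈ cut a b {v}, z f = ((univ.filter fun l => φ l ∈ cut a b {v}).card : ℝ) / 2 := by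
      simp only [z]
      rw [← Finset.sum_div, ← Nat.cast_sum]
      congr 2
      rw [Finset.card_eq_sum_card_fiberwise (f := φ) (t := cut a b {v})]
      · refine Finset.sum_congr rfl fun f hf => ?_
        congr 1; ext l; simp only [mem_filter, mem_univ, true_and]
        exact ⟨fun h => ⟨h ▸ hf, h⟩, fun h => h.2⟩
      · intro l hl; exact (mem_filter.1 hl).2
    have hne : ∀ l : Σ v, Fin (β v), l.1 ≠ (σ l).1 := by
      intro l h
      rcases hφ l with h' | h'
      · exact hab (φ l) (by rw [h'.1, h'.2, h])
      · exact hab (φ l) (by rw [h'.1, h'.2, h])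
    have h2 : (univ.filter fun l => φ l ∈ cut a b {v}) =
        (univ.filter fun l : Σ v, Fin (β v) => l.1 = v) ∪
        (univ.filter fun l : Σ v, Fin (β v) => (σ l).1 = v) := by
      ext l
      simp only [mem_filter, mem_univ, true_and, mem_union, mem_cut_singleton]
      have h3 := hne l
      rcases hφ l with h' | h' <;> rw [h'.1, h'.2]
      · constructor
        · intro h; by_contra hcon; tauto
        · rintro (h | h) h4
          · exact h3 (h.trans (h4.1 h).symm)
          · exact h3 ((h4.2 h).trans h.symm)
      · constructor
        · intro h; by_contra hcon; tauto
        · rintro (h | h) h4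
          · exact h3 (h.trans (h4.2 h).symm)
          · exact h3 ((h4.1 h).trans h.symm)
    have h3 : (univ.filter fun l : Σ v, Fin (β v) => l.1 = v).card = β v := by
      have := hfib {v}
      simpa using this
    have h4 : (univ.filter fun l : Σ v, Fin (β v) => (σ l).1 = v).card = β v := by
      rw [← h3]
      apply Finset.card_bij (fun l _ => σ l)
      · intro l hl; simpa using hl
      · intro l _ l' _ h; exact hσ h
      · intro l hl
        obtain ⟨l', rfl⟩ := hσb.2 l
        exact ⟨l', by simpa using hl, rfl⟩
    rw [h1, h2, Finset.card_union_of_disjoint, h3, h4]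
    · push_cast; ring
    · rw [Finset.disjoint_left]
      intro l h5 h6
      exact hne l ((mem_filter.1 h5).2.trans (mem_filter.1 h6).2.symm)
  refine ⟨fun f => (w f + z f) / 20, ?_, fun f hf => ?_, fun v => ?_⟩
  · simp [z, hwe, hφe]
  · have : 0 ≤ z f := by positivity
    dsimp only
    linarith
  · rw [← Finset.sum_div, Finset.sum_add_distrib, hz]
    have := hβ v
    have h2 : (β v : ℝ) = 20 - ∑ f ∈ cut a b {v}, (w f : ℝ) := by exact_mod_cast this
    rw [h2]; norm_num

/-- A loopless cubic graph, of order at least four, whose small cuts split off small forests. -/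
structure CyclicFive (a b : E → V) : Prop where
  ne : ∀ f, a f ≠ b f
  cubic : ∀ v, (cut a b {v}).card = 3
  four_le : 4 ≤ Fintype.card V
  cut_le : ∀ S : Finset V, S.Nonempty → Sᶜ.Nonempty →
    S.card + 2 ≤ (cut a b S).card ∨ Sᶜ.card + 2 ≤ (cut a b S).card ∨ 5 ≤ (cut a b S).card

theorem card_cut_eq_sum (a b : E → V) (S : Finset V) :
    ((cut a b S).card : ℤ) = ∑ f, if ¬(a f ∈ S ↔ b f ∈ S) then 1 else 0 := by
  rw [← sum_cut_eq]; simp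

namespace CyclicFive

variable {a b : E → V} (G : CyclicFive a b)
include G

theorem even_card : Even (Fintype.card V) := by
  have h := two_mul_card_edges G.ne G.cubic
  rw [Nat.even_iff]; omega

theorem three_le_cut {S : Finset V} (h1 : S.Nonempty) (h2 : S ≠ univ) :
    3 ≤ (cut a b S).card := by
  have h3 : Sᶜ.Nonempty := by rwa [Finset.nonempty_iff_ne_empty, Ne, Finset.compl_eq_empty_iff]
  have h4 := h1.card_pos
  have h5 := h3.card_pos
  have := G.cut_le S h1 h3
  omega

theorem odd_cut {S : Finset V} : Odd (cut a b S).card ↔ Odd S.card := odd_card_cut G.ne G.cubic S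

theorem odd_compl {S : Finset V} : Odd Sᶜ.card ↔ Odd S.card := by
  rw [← G.odd_cut, cut_compl, G.odd_cut]

theorem odd_ne {S : Finset V} (hS : Odd S.card) : S.Nonempty ∧ S ≠ univ := by
  constructor
  · rw [← Finset.card_pos]; exact hS.pos
  · rintro rfl
    rw [Finset.card_univ] at hS
    exact (Nat.not_odd_iff_even.2 G.even_card) hS

/-- An odd set is a vertex, the complement of a vertex, or has at least five edges leaving it. -/
theorem odd_cases {S : Finset V} (hS : Odd S.card) :
    S.card = 1 ∨ Sᶜ.card = 1 ∨ 5 ≤ (cut a b S).card := by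
  obtain ⟨h1, h2⟩ := G.odd_ne hS
  have h3 : Sᶜ.Nonempty := by rwa [Finset.nonempty_iff_ne_empty, Ne, Finset.compl_eq_empty_iff]
  have h4 := G.cut_le S h1 h3
  have h5 := h1.card_pos
  have h6 := h3.card_pos
  have h7 := G.odd_cut.2 hS
  rw [Nat.odd_iff] at h7
  omega

/-- Subsets of a set with large complement. -/
theorem subset_cut {D S : Finset V} (hDS : D ⊆ S) (hS : 3 ≤ Sᶜ.card) (hD : D.Nonempty) :
    D.card + 2 ≤ (cut a b D).card ∨ 5 ≤ (cut a b D).card := by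
  have h1 : Sᶜ.card ≤ Dᶜ.card := Finset.card_le_card (Finset.compl_subset_compl.2 hDS)
  have h2 : Dᶜ.Nonempty := by rw [← Finset.card_pos]; omega
  have h3 := G.cut_le D hD h2
  omega

theorem sum_ends (p : V → ℤ) : ∑ f, (p (a f) + p (b f)) = 3 * ∑ v, p v := by
  have h := sum_mul_star (R := ℤ) a b (fun _ => 1) p (fun f hf => absurd hf (G.ne f))
  simp only [one_mul] at h
  rw [← h, Finset.mul_sum]
  refine Finset.sum_congr rfl fun v _ => ?_
  simp [G.cubic]; ring

theorem sum_signed (A N : Finset V) :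
    ∑ f, (signed A N (a f) + signed A N (b f)) = 3 * (N.card - A.card) := by
  rw [G.sum_ends]
  have := sum_signed_mul (R := ℤ) A N (fun _ => 1)
  simp at this
  rw [this]

end CyclicFive

theorem signed_cases {A N : Finset V} (hd : Disjoint A N) (v : V) :
    v ∈ A ∧ v ∉ N ∧ signed A N v = -1 ∨ v ∉ A ∧ v ∈ N ∧ signed A N v = 1 ∨
      v ∉ A ∧ v ∉ N ∧ signed A N v = 0 := by
  have h : v ∈ A → v ∉ N := fun hv => Finset.disjoint_left.1 hd hv
  by_cases hA : v ∈ A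
  · simp [signed, hA, h hA]
  · by_cases hN : v ∈ N <;> simp [signed, hA, hN]

theorem NbhdIn.signed_nonneg {a b : E → V} {e : E} {A N : Finset V} (h : NbhdIn a b e A N)
    (hd : Disjoint A N) {f : E} (hf : f ≠ e) : 0 ≤ signed A N (a f) + signed A N (b f) := by
  obtain ⟨h1, h2⟩ := h f hf
  rcases signed_cases hd (a f) with ⟨h3, h4, h5⟩ | ⟨h3, h4, h5⟩ | ⟨h3, h4, h5⟩ <;>
    rcases signed_cases hd (b f) with ⟨h6, h7, h8⟩ | ⟨h6, h7, h8⟩ | ⟨h6, h7, h8⟩ <;>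
    rw [h5, h8] <;> first | exact absurd (h1 h3) h7 | exact absurd (h2 h6) h4 | norm_num

namespace CyclicFive

variable {a b : E → V} (G : CyclicFive a b)
include G

theorem nbhd_excess {e : E} {A N : Finset V} (hd : Disjoint A N) (h : NbhdIn a b e A N) :
    (-(signed A N (a e) + signed A N (b e)) ≤ (N.card : ℤ) - A.card) ∨
    a e ∈ A ∧ b e ∈ A ∧ (N.card = A.card + 1 ∨ N.card = A.card ∧ N = Aᶜ) := by
  have h0 : ∀ v, v ∈ A → v ∉ N := fun v hv => Finset.disjoint_left.1 hd hv
  have hs := G.sum_signed A N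
  have hsub : ∑ f, (signed A N (a f) + signed A N (b f)) =
      (signed A N (a e) + signed A N (b e)) +
      ∑ f ∈ univ.erase e, (signed A N (a f) + signed A N (b f)) :=
    (Finset.add_sum_erase univ _ (mem_univ e)).symm
  have hnn : 0 ≤ ∑ f ∈ univ.erase e, (signed A N (a f) + signed A N (b f)) :=
    Finset.sum_nonneg fun f hf => h.signed_nonneg hd (ne_of_mem_erase hf)
  have hcut : ((cut a b (A ∪ N)).card : ℤ) ≤ (if ¬(a e ∈ A ∪ N ↔ b e ∈ A ∪ N) then 1 else 0) +
      ∑ f ∈ univ.erase e, (signed A N (a f) + signed A N (b f)) := by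
    rw [card_cut_eq_sum, ← Finset.add_sum_erase univ _ (mem_univ e)]
    refine add_le_add le_rfl (Finset.sum_le_sum fun f hf => ?_)
    have h1 := h f (ne_of_mem_erase hf)
    have h2 := h0 (a f)
    have h3 := h0 (b f)
    simp only [signed, mem_union]
    by_cases haA : a f ∈ A <;> by_cases hbA : b f ∈ A <;> by_cases haN : a f ∈ N <;>
      by_cases hbN : b f ∈ N <;> simp [haA, hbA, haN, hbN] at h1 h2 h3 ⊢
  rcases signed_cases hd (a e) with ⟨hA, hAN, hp⟩ | ⟨hA, hAN, hp⟩ | ⟨hA, hAN, hp⟩ <;>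
    rcases signed_cases hd (b e) with ⟨hB, hBN, hq⟩ | ⟨hB, hBN, hq⟩ | ⟨hB, hBN, hq⟩ <;>
    rw [hp, hq] at hsub ⊢
  · simp [hA, hB] at hcut
    by_cases h2 : (2 : ℤ) ≤ (N.card : ℤ) - A.card
    · left; linarith
    right
    refine ⟨hA, hB, ?_⟩
    by_cases hu : A ∪ N = univ
    · have hN : N = Aᶜ := by
        ext v
        have : v ∈ A ∪ N := hu ▸ mem_univ v
        rw [mem_union] at this
        have := h0 v
        rw [mem_compl]; tauto
      have h3 : N.card = A.card ∨ N.card = A.card + 1 := by omega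
      exact h3.elim (fun h3 => Or.inr ⟨h3, hN⟩) Or.inl
    · have := G.three_le_cut ⟨a e, mem_union_left N hA⟩ hu
      left; omega
  · left; omega
  · left
    simp [hA, hB, hBN] at hcut
    have := G.three_le_cut ⟨a e, mem_union_left N hA⟩ (fun hu => by
      have : b e ∈ A ∪ N := hu ▸ mem_univ _
      simp [hB, hBN] at this)
    omega
  · left; omega
  · left; omega
  · left; omega
  · left
    simp [hA, hB, hAN] at hcut
    have := G.three_le_cut ⟨b e, mem_union_left N hB⟩ (fun hu => by
      have : a e ∈ A ∪ N := hu ▸ mem_univ _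
      simp [hA, hAN] at this)
    omega
  · left; omega
  · left; omega

theorem sum_weight_le {e : E} {A N : Finset V} (hd : Disjoint A N) (h : NbhdIn a b e A N)
    (w : E → ℕ) (hwe : w e = 0) (c : ℕ) (hw : ∀ f, w f ≤ c) :
    ∑ f, (w f : ℤ) * (signed A N (a f) + signed A N (b f)) ≤
      c * (3 * (N.card - A.card) - (signed A N (a e) + signed A N (b e))) := by
  rw [← G.sum_signed, ← Finset.add_sum_erase univ _ (mem_univ e),
    ← Finset.add_sum_erase univ (fun f => signed A N (a f) + signed A N (b f)) (mem_univ e), hwe]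
  simp only [Nat.cast_zero, zero_mul, zero_add, add_sub_cancel_left]
  rw [Finset.mul_sum]
  refine Finset.sum_le_sum fun f hf => ?_
  refine mul_le_mul_of_nonneg_right (by exact_mod_cast hw f) (h.signed_nonneg hd ?_)
  exact ne_of_mem_erase hf

theorem sum_star_le (w : E → ℕ) (hw : ∀ f, w f ≤ 5) (v : V) :
    ∑ f ∈ cut a b {v}, w f ≤ 20 := by
  have := Finset.sum_le_card_nsmul (cut a b {v}) w 5 (fun f _ => hw f)
  rw [G.cubic] at this
  exact this.trans (by norm_num)

end CyclicFive

/-- A bisection such that apart from `e` no edge lies inside the side `A`, which contains `e`. -/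
structure IsBip (a b : E → V) (e : E) (A : Finset V) : Prop where
  left : a e ∈ A
  right : b e ∈ A
  nbhd : NbhdIn a b e A Aᶜ
  card : Aᶜ.card = A.card

namespace CyclicFive

variable {a b : E → V} (G : CyclicFive a b)
include G

theorem sum_erase_signed (e : E) (A N : Finset V) :
    ∑ f ∈ univ.erase e, (signed A N (a f) + signed A N (b f)) =
      3 * (N.card - A.card) - (signed A N (a e) + signed A N (b e)) := by
  rw [← G.sum_signed, ← Finset.add_sum_erase univ _ (mem_univ e)]; ring

theorem inner_unique {e : E} {A : Finset V} (h : IsBip a b e A) {f g : E}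
    (hf : a f ∉ A ∧ b f ∉ A) (hg : a g ∉ A ∧ b g ∉ A) : f = g := by
  by_contra hfg
  have hd : Disjoint A Aᶜ := disjoint_compl_right
  have hfe : f ≠ e := by rintro rfl; exact hf.1 h.left
  have hge : g ≠ e := by rintro rfl; exact hg.1 h.left
  have h1 := G.sum_erase_signed e A Aᶜ
  have h2 : ∑ k ∈ ({f, g} : Finset E), (signed A Aᶜ (a k) + signed A Aᶜ (b k)) ≤
      ∑ k ∈ univ.erase e, (signed A Aᶜ (a k) + signed A Aᶜ (b k)) :=
    Finset.sum_le_sum_of_subset_of_nonneg (by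
      intro k hk
      simp only [mem_insert, mem_singleton] at hk
      rcases hk with rfl | rfl <;> simp [hfe, hge])
      fun k hk _ => h.nbhd.signed_nonneg hd (ne_of_mem_erase hk)
  rw [h1, Finset.sum_pair hfg, h.card] at h2
  simp [signed, hf, hg, h.left, h.right] at h2

theorem bip_unique {e : E} {A B : Finset V} (hA : IsBip a b e A) (hB : IsBip a b e B) :
    A = B := by
  let C : Finset V := univ.filter fun v => ¬(v ∈ A ↔ v ∈ B)
  have hin : ∀ {A : Finset V}, IsBip a b e A →
      (univ.filter fun f => a f ∉ A ∧ b f ∉ A).card ≤ 1 := by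
    intro A hA
    rw [Finset.card_le_one]
    intro f hf g hg
    simp only [mem_filter, mem_univ, true_and] at hf hg
    exact G.inner_unique hA hf hg
  have hsub : cut a b C ⊆ (univ.filter fun f => a f ∉ A ∧ b f ∉ A) ∪
      (univ.filter fun f => a f ∉ B ∧ b f ∉ B) := by
    intro f hf
    rw [mem_cut] at hf
    simp only [C, mem_union, mem_filter, mem_univ, true_and] at hf ⊢
    have hfe : f ≠ e := by
      rintro rfl
      apply hf
      simp [hA.left, hA.right, hB.left, hB.right]
    have h1 := hA.nbhd f hfe
    have h2 := hB.nbhd f hfe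
    simp only [mem_compl] at h1 h2
    tauto
  have hc : (cut a b C).card ≤ 2 :=
    (Finset.card_le_card hsub).trans ((Finset.card_union_le _ _).trans
      (add_le_add (hin hA) (hin hB)))
  have hC : C = ∅ := by
    by_contra hne
    have := G.three_le_cut (Finset.nonempty_iff_ne_empty.2 hne) (fun h => by
      have h1 : a e ∈ C := h ▸ mem_univ _
      simp [C, hA.left, hB.left] at h1)
    omega
  ext v
  by_contra h
  have : v ∈ C := by simpa [C] using h
  simp [hC] at this

/-- A positive fractional perfect matching avoiding `e`, when there is a near-bipartition. -/
theorem exists_weights_of_bip {e : E} {A : Finset V} (hA : IsBip a b e A) :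
    ∃ x : E → ℝ, x e = 0 ∧ (∀ f, 0 ≤ x f) ∧
      (∀ f, f ≠ e → ¬(a f ∉ A ∧ b f ∉ A) → 1 / 5 ≤ x f) ∧
      ∀ v, ∑ f ∈ cut a b {v}, x f = 1 := by
  let w : E → ℕ := fun f => if f = e ∨ a f ∉ A ∧ b f ∉ A then 0 else 4
  have hwe : w e = 0 := by simp [w]
  have hw4 : ∀ f, w f ≤ 4 := by intro f; simp only [w]; split_ifs <;> norm_num
  obtain ⟨x, h1, h2, h3⟩ := exists_weights_of_hall G.ne e w hwe
    (G.sum_star_le w fun f => (hw4 f).trans (by norm_num)) (by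
      intro B N hd hN
      have h1 := G.sum_weight_le hd hN w hwe 4 hw4
      have h7 : 0 ≤ ∑ f ∈ univ.erase e, (signed B N (a f) + signed B N (b f)) :=
        Finset.sum_nonneg fun f hf => hN.signed_nonneg hd (ne_of_mem_erase hf)
      rw [G.sum_erase_signed] at h7
      rcases G.nbhd_excess hd hN with h2 | ⟨hu, hv, h2 | ⟨h2, h3⟩⟩
      · rcases signed_cases hd (a e) with ⟨-, -, h5⟩ | ⟨-, -, h5⟩ | ⟨-, -, h5⟩ <;>
        rcases signed_cases hd (b e) with ⟨-, -, h6⟩ | ⟨-, -, h6⟩ | ⟨-, -, h6⟩ <;>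
        rw [h5, h6] at h1 h2 h7 <;> push_cast at h1 <;> linarith
      · have h5 : signed B N (a e) = -1 := by
          have := signed_cases hd (a e); tauto
        have h6 : signed B N (b e) = -1 := by
          have := signed_cases hd (b e); tauto
        rw [h5, h6, h2] at h1
        rw [h2]
        push_cast at h1 ⊢
        linarith
      · subst h3
        have : B = A := G.bip_unique ⟨hu, hv, hN, h2⟩ hA
        subst this
        rw [h2, sub_self, mul_zero]
        refine le_of_eq (Finset.sum_eq_zero fun f _ => ?_)
        by_cases hf : f = e ∨ a f ∉ B ∧ b f ∉ B
        · simp [w, hf]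
        · push Not at hf
          have h4 := hN f hf.1
          have h5 := hf.2
          simp only [mem_compl] at h4
          by_cases h6 : a f ∈ B
          · simp [signed, h6, h4.1 h6]
          · simp [signed, h6, h5 h6])
  refine ⟨x, h1, fun f => ?_, fun f hf hf' => ?_, h3⟩
  · by_cases hf : f = e
    · rw [hf, h1]
    · exact le_trans (by positivity) (h2 f hf)
  · refine le_trans ?_ (h2 f hf)
    have : w f = 4 := by simp only [w]; rw [if_neg]; tauto
    rw [this]; norm_num

theorem succ_card_le {e : E} (hno : ∀ A, ¬IsBip a b e A) {A N : Finset V} (hd : Disjoint A N)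
    (hN : NbhdIn a b e A N) (hu : a e ∈ A) (hv : b e ∈ A) : A.card + 1 ≤ N.card := by
  rcases G.nbhd_excess hd hN with h | ⟨-, -, h | ⟨h, h'⟩⟩
  · have h5 : signed A N (a e) = -1 := by
      have := signed_cases hd (a e); tauto
    have h6 : signed A N (b e) = -1 := by
      have := signed_cases hd (b e); tauto
    rw [h5, h6] at h
    omega
  · omega
  · subst h'
    exact absurd ⟨hu, hv, hN, h⟩ (hno A)

/-- A positive fractional perfect matching avoiding `e`, when no vertex set is nearly tight for
Hall's condition. -/
theorem exists_weights_of_expanding {e : E} (hno : ∀ A, ¬IsBip a b e A)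
    (hno' : ∀ A N, Disjoint A N → NbhdIn a b e A N → a e ∈ A → b e ∈ A →
      N.card ≠ A.card + 1) :
    ∃ x : E → ℝ, x e = 0 ∧ (∀ f, f ≠ e → 1 / 4 ≤ x f) ∧ ∀ v, ∑ f ∈ cut a b {v}, x f = 1 := by
  let w : E → ℕ := fun f => if f = e then 0 else 5
  have hwe : w e = 0 := by simp [w]
  have hw5 : ∀ f, w f ≤ 5 := by intro f; simp only [w]; split_ifs <;> norm_num
  obtain ⟨x, h1, h2, h3⟩ := exists_weights_of_hall G.ne e w hwe
    (G.sum_star_le w hw5) (by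
      intro B N hd hN
      have h1 := G.sum_weight_le hd hN w hwe 5 hw5
      rcases G.nbhd_excess hd hN with h2 | ⟨hu, hv, h2 | ⟨h2, h3⟩⟩
      · push_cast at h1; linarith
      · exact absurd h2 (hno' B N hd hN hu hv)
      · subst h3
        exact absurd ⟨hu, hv, hN, h2⟩ (hno B))
  refine ⟨x, h1, fun f hf => ?_, h3⟩
  refine le_trans ?_ (h2 f hf)
  have : w f = 5 := by simp only [w]; rw [if_neg hf]
  rw [this]; norm_num

theorem subset_union_of_maximal {e : E} (hno : ∀ A, ¬IsBip a b e A) {A N : Finset V}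
    (hd : Disjoint A N) (hN : NbhdIn a b e A N) (hu : a e ∈ A) (hv : b e ∈ A)
    (hc : N.card = A.card + 1)
    (hmax : ∀ A' N', Disjoint A' N' → NbhdIn a b e A' N' → a e ∈ A' → b e ∈ A' →
      N'.card = A'.card + 1 → A'.card ≤ A.card)
    {A₁ N₁ : Finset V} (hd₁ : Disjoint A₁ N₁) (hN₁ : NbhdIn a b e A₁ N₁) (hu₁ : a e ∈ A₁)
    (hv₁ : b e ∈ A₁) (hc₁ : N₁.card = A₁.card + 1) : N₁ ⊆ A ∪ N := by
  have hAN : ∀ v, v ∈ A → v ∉ N := fun v hv => Finset.disjoint_left.1 hd hv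
  have hAN₁ : ∀ v, v ∈ A₁ → v ∉ N₁ := fun v hv => Finset.disjoint_left.1 hd₁ hv
  have g1 := G.succ_card_le hno (A := A₁ \ N) (N := N₁ \ A)
    (Finset.disjoint_left.2 fun v => by have := hAN₁ v; simp only [mem_sdiff]; tauto)
    (fun f hf => by have := hN f hf; have := hN₁ f hf; simp only [mem_sdiff]; tauto)
    (mem_sdiff.2 ⟨hu₁, hAN _ hu⟩) (mem_sdiff.2 ⟨hv₁, hAN _ hv⟩)
  have g2 := G.succ_card_le hno (A := A \ N₁) (N := N \ A₁)
    (Finset.disjoint_left.2 fun v => by have := hAN v; simp only [mem_sdiff]; tauto)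
    (fun f hf => by have := hN f hf; have := hN₁ f hf; simp only [mem_sdiff]; tauto)
    (mem_sdiff.2 ⟨hu, hAN₁ _ hu₁⟩) (mem_sdiff.2 ⟨hv, hAN₁ _ hv₁⟩)
  have g3 := G.succ_card_le hno (A := A ∩ A₁) (N := N ∩ N₁)
    (Finset.disjoint_left.2 fun v => by have := hAN v; simp only [mem_inter]; tauto)
    (fun f hf => by have := hN f hf; have := hN₁ f hf; simp only [mem_inter]; tauto)
    (mem_inter.2 ⟨hu, hu₁⟩) (mem_inter.2 ⟨hv, hv₁⟩)
  have hd4 : Disjoint (A ∪ A₁ \ N) (N ∪ N₁ \ A) :=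
    Finset.disjoint_left.2 fun v => by
      have := hAN v; have := hAN₁ v; simp only [mem_sdiff, mem_union]; tauto
  have hN4 : NbhdIn a b e (A ∪ A₁ \ N) (N ∪ N₁ \ A) := fun f hf => by
    have := hN f hf; have := hN₁ f hf; simp only [mem_sdiff, mem_union]; tauto
  have hu4 := mem_union_left (A₁ \ N) hu
  have hv4 := mem_union_left (A₁ \ N) hv
  have g4 := G.succ_card_le hno hd4 hN4 hu4 hv4
  have c1 := Finset.card_sdiff_add_card_inter A₁ N
  have c2 := Finset.card_sdiff_add_card_inter N₁ A
  have c3 := Finset.card_sdiff_add_card_inter A N₁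
  have c4 := Finset.card_sdiff_add_card_inter N A₁
  rw [Finset.inter_comm A N₁] at c3
  rw [Finset.inter_comm N A₁] at c4
  have c5 := Finset.card_union_add_card_inter A (A₁ \ N)
  have c6 := Finset.card_union_add_card_inter N (N₁ \ A)
  have e5 : A ∩ (A₁ \ N) = A ∩ A₁ := by
    ext v; have := hAN v; simp only [mem_sdiff, mem_inter]; tauto
  have e6 : N ∩ (N₁ \ A) = N ∩ N₁ := by
    ext v; have := hAN v; simp only [mem_sdiff, mem_inter]; tauto
  rw [e5] at c5
  rw [e6] at c6
  have h5 := hmax _ _ hd4 hN4 hu4 hv4 (by omega)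
  have h6 : N ∪ N₁ \ A = N :=
    (Finset.eq_of_subset_of_card_le Finset.subset_union_left (by omega)).symm
  intro v hv
  by_cases hvA : v ∈ A
  · exact mem_union_left _ hvA
  · refine mem_union_right _ ?_
    rw [← h6]
    exact mem_union_right _ (mem_sdiff.2 ⟨hv, hvA⟩)

/-- A positive fractional perfect matching avoiding `e`, when a maximal vertex set misses Hall's
condition by one. -/
theorem exists_weights_of_maximal {e : E} (hno : ∀ A, ¬IsBip a b e A) {A N : Finset V}
    (hd : Disjoint A N) (hN : NbhdIn a b e A N) (hu : a e ∈ A) (hv : b e ∈ A)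
    (hc : N.card = A.card + 1)
    (hmax : ∀ A' N', Disjoint A' N' → NbhdIn a b e A' N' → a e ∈ A' → b e ∈ A' →
      N'.card = A'.card + 1 → A'.card ≤ A.card) :
    ∃ x : E → ℝ, x e = 0 ∧ (∀ f, f ≠ e → 1 / 5 ≤ x f) ∧
      (∀ f, a f ∉ A ∪ N → b f ∉ A ∪ N → 1 / 4 ≤ x f) ∧
      ∀ v, ∑ f ∈ cut a b {v}, x f = 1 := by
  let w : E → ℕ := fun f => if f = e then 0 else if a f ∉ A ∪ N ∧ b f ∉ A ∪ N then 5 else 4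
  have hwe : w e = 0 := by simp [w]
  have hw5 : ∀ f, w f ≤ 5 := by intro f; simp only [w]; split_ifs <;> norm_num
  obtain ⟨x, h1, h2, h3⟩ := exists_weights_of_hall G.ne e w hwe
    (G.sum_star_le w hw5) (by
      intro A₁ N₁ hd₁ hN₁
      have h1 := G.sum_weight_le hd₁ hN₁ w hwe 5 hw5
      rcases G.nbhd_excess hd₁ hN₁ with h2 | ⟨hu₁, hv₁, h2 | ⟨h2, h3⟩⟩
      · push_cast at h1; linarith
      · have hsub := G.subset_union_of_maximal hno hd hN hu hv hc hmax hd₁ hN₁ hu₁ hv₁ h2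
        have h5 : signed A₁ N₁ (a e) = -1 := by
          have := signed_cases hd₁ (a e); tauto
        have h6 : signed A₁ N₁ (b e) = -1 := by
          have := signed_cases hd₁ (b e); tauto
        have h4 := G.sum_erase_signed e A₁ N₁
        rw [h5, h6, h2] at h4
        rw [← Finset.add_sum_erase univ _ (mem_univ e), hwe, h2]
        have h7 : ∑ f ∈ univ.erase e, (w f : ℤ) * (signed A₁ N₁ (a f) + signed A₁ N₁ (b f)) ≤
            ∑ f ∈ univ.erase e, 4 * (signed A₁ N₁ (a f) + signed A₁ N₁ (b f)) := by
          refine Finset.sum_le_sum fun f hf => ?_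
          have hfe := ne_of_mem_erase hf
          by_cases hin : a f ∉ A ∪ N ∧ b f ∉ A ∪ N
          · have ha : a f ∉ N₁ := fun h => hin.1 (hsub h)
            have hb : b f ∉ N₁ := fun h => hin.2 (hsub h)
            have h8 := hN₁ f hfe
            have ha' : a f ∉ A₁ := fun h => hb (h8.1 h)
            have hb' : b f ∉ A₁ := fun h => ha (h8.2 h)
            simp [signed, ha, hb, ha', hb']
          · have : w f = 4 := by simp only [w]; rw [if_neg hfe, if_neg hin]
            rw [this]; norm_num
        rw [← Finset.mul_sum, h4] at h7
        push_cast at h7 ⊢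
        linarith
      · subst h3
        exact absurd ⟨hu₁, hv₁, hN₁, h2⟩ (hno A₁))
  refine ⟨x, h1, fun f hf => ?_, fun f ha hb => ?_, h3⟩
  · refine le_trans ?_ (h2 f hf)
    have : 4 ≤ w f := by simp only [w]; rw [if_neg hf]; split_ifs <;> norm_num
    have h4 : (4 : ℝ) ≤ w f := by exact_mod_cast this
    linarith
  · have hf : f ≠ e := by rintro rfl; exact ha (mem_union_left _ hu)
    refine le_trans ?_ (h2 f hf)
    have : w f = 5 := by simp only [w]; rw [if_neg hf, if_pos ⟨ha, hb⟩]
    rw [this]; norm_num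

/-- The vertices outside a maximal pair: an odd set with five edges leaving it, and no edge has
both its ends on the larger side of the pair. -/
theorem rest_of_maximal {e : E} (hno : ∀ A, ¬IsBip a b e A) {A N : Finset V}
    (hd : Disjoint A N) (hN : NbhdIn a b e A N) (hu : a e ∈ A) (hv : b e ∈ A)
    (hc : N.card = A.card + 1) :
    Odd (A ∪ N)ᶜ.card ∧ (cut a b (A ∪ N)ᶜ).card = 5 ∧ ∀ f, ¬(a f ∈ N ∧ b f ∈ N) := by
  have hAN : ∀ v, v ∈ A → v ∉ N := fun v hv => Finset.disjoint_left.1 hd hv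
  have hcard : (A ∪ N).card = 2 * A.card + 1 := by
    rw [Finset.card_union_of_disjoint hd]; omega
  have hodd : Odd (A ∪ N)ᶜ.card := by rw [G.odd_compl, hcard]; exact ⟨_, rfl⟩
  have h5 : signed A N (a e) = -1 := by
    have := signed_cases hd (a e); tauto
  have h6 : signed A N (b e) = -1 := by
    have := signed_cases hd (b e); tauto
  have h4 := G.sum_erase_signed e A N
  rw [h5, h6, hc] at h4
  have hI : ∑ f ∈ univ.erase e, (signed A N (a f) + signed A N (b f)) =
      (cut a b (A ∪ N)).card + 2 * (univ.filter fun f => a f ∈ N ∧ b f ∈ N).card := by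
    have hone : ∀ (P : E → Prop) [DecidablePred P], ¬P e → ((univ.filter P).card : ℤ) =
        ∑ f ∈ univ.erase e, if P f then 1 else 0 := by
      intro P _ hP
      rw [Finset.sum_boole]
      congr 2
      ext f
      simp only [mem_filter, mem_univ, true_and, mem_erase, ne_eq, and_true]
      constructor
      · intro h; exact ⟨by rintro rfl; exact hP h, h⟩
      · exact fun h => h.2
    rw [cut, hone, hone, Finset.mul_sum, ← Finset.sum_add_distrib]
    · refine Finset.sum_congr rfl fun f hf => ?_
      have h1 := hN f (ne_of_mem_erase hf)
      rcases signed_cases hd (a f) with ⟨h3, h4, h5⟩ | ⟨h3, h4, h5⟩ | ⟨h3, h4, h5⟩ <;>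
        rcases signed_cases hd (b f) with ⟨h6, h7, h8⟩ | ⟨h6, h7, h8⟩ | ⟨h6, h7, h8⟩ <;>
        rw [h5, h8] <;> simp [h3, h4, h6, h7] at h1 ⊢
    · exact fun h => hAN _ hu h.1
    · simp [hu, hv]
  have hno3 : (A ∪ N)ᶜ.card ≠ 1 := by
    intro h1
    obtain ⟨r, hr⟩ := Finset.card_eq_one.1 h1
    have hrA : r ∉ A ∪ N := by rw [← mem_compl, hr]; exact mem_singleton_self r
    have hcov : ∀ v, v = r ∨ v ∈ A ∨ v ∈ N := by
      intro v
      by_contra h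
      have : v ∈ (A ∪ N)ᶜ := by rw [mem_compl, mem_union]; tauto
      rw [hr, mem_singleton] at this
      tauto
    rw [mem_union] at hrA
    have hcompl : (insert r A)ᶜ = N := by
      ext v
      have := hcov v
      have := hAN v
      rw [mem_compl, mem_insert]
      constructor
      · tauto
      · intro h h'
        rcases h' with rfl | h' <;> tauto
    refine hno (insert r A) ⟨mem_insert_of_mem hu, mem_insert_of_mem hv, ?_, ?_⟩
    · rw [hcompl]
      intro f hf
      have h2 := hN f hf
      have h3 := hcov (a f)
      have h4 := hcov (b f)
      have h5 := G.ne f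
      simp only [mem_insert]
      constructor
      · rintro (h6 | h6)
        · rcases h4 with h7 | h7 | h7
          · exact absurd (h6.trans h7.symm) h5
          · have := h2.2 h7; rw [h6] at this; tauto
          · exact h7
        · exact h2.1 h6
      · rintro (h6 | h6)
        · rcases h3 with h7 | h7 | h7
          · exact absurd (h7.trans h6.symm) h5
          · have := h2.1 h7; rw [h6] at this; tauto
          · exact h7
        · exact h2.2 h6
    · rw [hcompl, Finset.card_insert_of_notMem (by tauto), hc]
  have hno1 : (A ∪ N)ᶜᶜ.card ≠ 1 := by
    rw [compl_compl, hcard]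
    have := Finset.card_pos.2 ⟨_, hu⟩
    omega
  have h7 : 5 ≤ (cut a b (A ∪ N)ᶜ).card := by
    rcases G.odd_cases hodd with h | h | h
    · exact absurd h hno3
    · exact absurd h hno1
    · exact h
  rw [hI] at h4
  rw [cut_compl] at h7 ⊢
  push_cast at h4
  refine ⟨hodd, by omega, fun f hf => ?_⟩
  have h8 : (univ.filter fun f => a f ∈ N ∧ b f ∈ N).card = 0 := by omega
  rw [Finset.card_eq_zero] at h8
  have : f ∈ univ.filter fun f => a f ∈ N ∧ b f ∈ N := by simpa using hf
  simp [h8] at this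

end CyclicFive

/-- The signed indicator function of `S`: positive on `N`, negative off `N`. -/
def color (S N : Finset V) (v : V) : ℝ := if v ∈ S then (if v ∈ N then 1 else -1) else 0

theorem sum_color (S N : Finset V) :
    ∑ v, color S N v = ((S ∩ N).card : ℝ) - (S \ N).card := by
  have : ∀ v, color S N v = (if v ∈ S ∩ N then 1 else 0) - (if v ∈ S \ N then 1 else 0) := by
    intro v
    by_cases h1 : v ∈ S <;> by_cases h2 : v ∈ N <;> simp [color, h1, h2]
  simp_rw [this, Finset.sum_sub_distrib, Finset.sum_ite_mem, Finset.univ_inter, Finset.sum_const,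
    nsmul_eq_mul, mul_one]

theorem sum_cut_color {a b : E → V} (hab : ∀ f, a f ≠ b f) (S N : Finset V) (x : E → ℝ) (c : ℝ)
    (hx : ∀ v, ∑ f ∈ cut a b {v}, x f = c)
    (hin : ∀ f, x f ≠ 0 → a f ∈ S → b f ∈ S → ¬(a f ∈ N ↔ b f ∈ N)) :
    ∑ f ∈ cut a b S, x f * (color S N (a f) + color S N (b f)) =
      c * (((S ∩ N).card : ℝ) - (S \ N).card) := by
  have h := sum_mul_star (R := ℝ) a b x (color S N) (fun f hf => absurd hf (hab f))
  simp_rw [hx, ← Finset.sum_mul, sum_color] at h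
  rw [mul_comm, h]
  refine Finset.sum_subset (Finset.subset_univ _) fun f _ hf => ?_
  by_cases h0 : x f = 0
  · rw [h0, zero_mul]
  · rw [mem_cut] at hf
    have := hin f h0
    by_cases h1 : a f ∈ S <;> by_cases h2 : b f ∈ S <;> by_cases h3 : a f ∈ N <;>
      by_cases h4 : b f ∈ N <;> simp_all [color]

theorem color_of_mem_cut {a b : E → V} {S N : Finset V} {f : E} (hf : f ∈ cut a b S) :
    color S N (a f) + color S N (b f) = 1 ∨ color S N (a f) + color S N (b f) = -1 := by
  rw [mem_cut] at hf
  by_cases h1 : a f ∈ S <;> by_cases h2 : b f ∈ S <;> by_cases h3 : a f ∈ N <;>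
    by_cases h4 : b f ∈ N <;> simp_all [color]

theorem abs_color_card {S : Finset V} (hS : Odd S.card) (N : Finset V) :
    ((S ∩ N).card : ℝ) - (S \ N).card = 1 ∨ ((S ∩ N).card : ℝ) - (S \ N).card = -1 ∨
      1 < |((S ∩ N).card : ℝ) - (S \ N).card| := by
  have h := Finset.card_sdiff_add_card_inter S N
  have h1 : ((S ∩ N).card : ℤ) - (S \ N).card = 1 ∨ ((S ∩ N).card : ℤ) - (S \ N).card = -1 ∨
      1 < |((S ∩ N).card : ℤ) - (S \ N).card| := by
    rw [Nat.odd_iff] at hS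
    rw [lt_abs]
    omega
  rcases h1 with h1 | h1 | h1
  · left; exact_mod_cast h1
  · right; left; exact_mod_cast h1
  · right; right; exact_mod_cast h1

/-- In an odd set whose inner edges are bichromatic, the value of the cut is at least one, and if it
is one then the cut is rigid. -/
theorem odd_cut_of_bichromatic {a b : E → V} (hab : ∀ f, a f ≠ b f) {S : Finset V}
    (hS : Odd S.card) (N : Finset V) {x : E → ℝ} (hnn : ∀ f, 0 ≤ x f)
    (hx : ∀ v, ∑ f ∈ cut a b {v}, x f = 1)
    (hin : ∀ f, x f ≠ 0 → a f ∈ S → b f ∈ S → ¬(a f ∈ N ↔ b f ∈ N)) :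
    1 ≤ ∑ f ∈ cut a b S, x f ∧
      (∑ f ∈ cut a b S, x f = 1 → ∀ y : E → ℝ, (∀ v, ∑ f ∈ cut a b {v}, y f = 0) →
        (∀ f, x f = 0 → y f = 0) → ∑ f ∈ cut a b S, y f = 0) := by
  have h1 := sum_cut_color hab S N x 1 hx hin
  rw [one_mul] at h1
  have h2 : |∑ f ∈ cut a b S, x f * (color S N (a f) + color S N (b f))| ≤
      ∑ f ∈ cut a b S, x f := by
    refine (Finset.abs_sum_le_sum_abs _ _).trans (Finset.sum_le_sum fun f hf => ?_)
    rcases color_of_mem_cut (N := N) hf with h | h <;> rw [h] <;> simp [abs_of_nonneg (hnn f)]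
  have key : ∀ s : ℝ, s = 1 ∨ s = -1 →
      ∑ f ∈ cut a b S, x f * (color S N (a f) + color S N (b f)) = s →
      ∑ f ∈ cut a b S, x f = 1 → ∀ y : E → ℝ, (∀ v, ∑ f ∈ cut a b {v}, y f = 0) →
        (∀ f, x f = 0 → y f = 0) → ∑ f ∈ cut a b S, y f = 0 := by
    intro s hs hsum hone y hy hsupp
    have h3 := sum_cut_color hab S N y 0 hy fun f hf => hin f fun h => hf (hsupp f h)
    rw [zero_mul] at h3
    have h4 : ∑ f ∈ cut a b S, x f * (1 - s * (color S N (a f) + color S N (b f))) = 0 := by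
      have : ∀ f, x f * (1 - s * (color S N (a f) + color S N (b f))) =
          x f - s * (x f * (color S N (a f) + color S N (b f))) := fun f => by ring
      simp_rw [this, Finset.sum_sub_distrib, ← Finset.mul_sum, hsum, hone]
      rcases hs with rfl | rfl <;> norm_num
    rw [Finset.sum_eq_zero_iff_of_nonneg] at h4
    · have h5 : ∑ f ∈ cut a b S, y f =
          s * ∑ f ∈ cut a b S, y f * (color S N (a f) + color S N (b f)) := by
        rw [Finset.mul_sum]
        refine Finset.sum_congr rfl fun f hf => ?_
        rcases mul_eq_zero.1 (h4 f hf) with h | h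
        · rw [hsupp f h]; ring
        · linear_combination y f * h
      rw [h5, h3, mul_zero]
    · intro f hf
      refine mul_nonneg (hnn f) ?_
      rcases hs with rfl | rfl <;> rcases color_of_mem_cut (N := N) hf with h | h <;> rw [h] <;>
        norm_num
  rcases abs_color_card hS N with h | h | h
  · rw [h1, h] at h2
    exact ⟨by simpa using h2, key 1 (Or.inl rfl) (h1.trans h)⟩
  · rw [h1, h] at h2
    exact ⟨by simpa using h2, key (-1) (Or.inr rfl) (h1.trans h)⟩
  · rw [h1] at h2
    exact ⟨by linarith, fun h' => by linarith⟩

namespace CyclicFive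

variable {a b : E → V} (G : CyclicFive a b)
include G

theorem card_le_of_bip {e : E} {A : Finset V} (hA : IsBip a b e A) :
    Fintype.card V ≤ 2 * (univ.filter fun M => IsPM a b M ∧ e ∉ M).card + 2 := by
  obtain ⟨x, hxe, hnn, hpos, hstar⟩ := G.exists_weights_of_bip hA
  have hd : Disjoint A Aᶜ := disjoint_compl_right
  have hinner : ∀ f, a f ∉ A ∧ b f ∉ A → signed A Aᶜ (a f) + signed A Aᶜ (b f) = 2 := by
    intro f hf; simp [signed, hf]
  have hbal : ∀ (y : E → ℝ) (c : ℝ), y e = 0 → (∀ v, ∑ f ∈ cut a b {v}, y f = c) →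
      ∑ f ∈ univ.erase e, y f * ((signed A Aᶜ (a f) + signed A Aᶜ (b f) : ℤ) : ℝ) = 0 := by
    intro y c hye hy
    have h := sum_mul_star (R := ℝ) a b y (fun v => (signed A Aᶜ v : ℝ))
      (fun f hf => absurd hf (G.ne f))
    rw [sum_signed_mul] at h
    simp_rw [hy, Finset.sum_const, hA.card, sub_self] at h
    rw [← Finset.add_sum_erase univ _ (mem_univ e), hye, zero_mul, zero_add] at h
    push_cast
    exact h.symm
  have hcol : ∀ f, f ≠ e → ¬(a f ∉ A ∧ b f ∉ A) → ¬(a f ∈ A ↔ b f ∈ A) := by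
    intro f hf hn
    have := hA.nbhd f hf
    simp only [mem_compl] at this
    tauto
  have hx0 : ∀ f, a f ∉ A ∧ b f ∉ A → x f = 0 := by
    intro f hf
    have hfe : f ≠ e := by rintro rfl; exact hf.1 hA.left
    have h := hbal x 1 hxe hstar
    rw [Finset.sum_eq_zero_iff_of_nonneg] at h
    · have := h f (mem_erase.2 ⟨hfe, mem_univ f⟩)
      rw [hinner f hf] at this
      push_cast at this
      linarith
    · intro k hk
      exact mul_nonneg (hnn k) (by exact_mod_cast hA.nbhd.signed_nonneg hd (ne_of_mem_erase hk))
  have hin : ∀ S : Finset V, ∀ f, x f ≠ 0 → a f ∈ S → b f ∈ S → ¬(a f ∈ A ↔ b f ∈ A) := by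
    intro S f hf _ _
    exact hcol f (by rintro rfl; exact hf hxe) fun h => hf (hx0 f h)
  refine card_le_of_rigid G.ne G.cubic e (x₀ := x)
    ⟨hnn, fun f hf => absurd hf (G.ne f), hstar,
      fun S hS => (odd_cut_of_bichromatic G.ne hS A hnn hstar (hin S)).1⟩ hxe ∅ ?_
  intro y hye hy _
  have hsupp : ∀ f, x f = 0 → y f = 0 := by
    intro f hf
    by_cases hfe : f = e
    · rw [hfe, hye]
    by_cases hi : a f ∉ A ∧ b f ∉ A
    · have h := hbal y 0 hye hy
      rw [Finset.sum_eq_single f] at h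
      · rw [hinner f hi] at h
        push_cast at h
        linarith
      · intro k hk hkf
        have h1 := hcol k (ne_of_mem_erase hk) fun h => hkf (G.inner_unique hA h hi)
        have : signed A Aᶜ (a k) + signed A Aᶜ (b k) = 0 := by
          by_cases h2 : a k ∈ A <;> by_cases h3 : b k ∈ A <;> simp [signed, h2, h3] at h1 ⊢
        rw [this]; simp
      · intro h; exact absurd (mem_erase.2 ⟨hfe, mem_univ f⟩) h
    · have := hpos f hfe hi
      rw [hf] at this
      norm_num at this
  exact ⟨hsupp, fun S hS hS1 _ =>
    (odd_cut_of_bichromatic G.ne hS A hnn hstar (hin S)).2 hS1 y hy hsupp⟩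

end CyclicFive

theorem sum_cut_of_card_one (a b : E → V) {S : Finset V} (hS : S.card = 1 ∨ Sᶜ.card = 1)
    {y : E → ℝ} {c : ℝ} (hy : ∀ v, ∑ f ∈ cut a b {v}, y f = c) : ∑ f ∈ cut a b S, y f = c := by
  rcases hS with hS | hS
  · obtain ⟨v, rfl⟩ := Finset.card_eq_one.1 hS
    exact hy v
  · obtain ⟨v, hv⟩ := Finset.card_eq_one.1 hS
    rw [← cut_compl, hv, hy]

/-- The edges between `S \ R` and `R \ S`. -/
def cross (a b : E → V) (S R : Finset V) : Finset E :=
  univ.filter fun f => a f ∈ S \ R ∧ b f ∈ R \ S ∨ a f ∈ R \ S ∧ b f ∈ S \ R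

theorem sum_cut_uncross (a b : E → V) (S R : Finset V) (x : E → ℝ) :
    ∑ f ∈ cut a b S, x f + ∑ f ∈ cut a b R, x f =
      ∑ f ∈ cut a b (S ∩ R), x f + ∑ f ∈ cut a b (S ∪ R), x f + 2 * ∑ f ∈ cross a b S R, x f := by
  simp only [sum_cut_eq, cross, Finset.sum_filter]
  rw [Finset.mul_sum, ← Finset.sum_add_distrib, ← Finset.sum_add_distrib, ← Finset.sum_add_distrib]
  refine Finset.sum_congr rfl fun f _ => ?_
  by_cases h1 : a f ∈ S <;> by_cases h2 : b f ∈ S <;> by_cases h3 : a f ∈ R <;>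
    by_cases h4 : b f ∈ R <;> simp [h1, h2, h3, h4] <;> ring

theorem odd_inter_or (R : Finset V) (hR : Odd R.card) (S : Finset V) :
    Odd (S ∩ R).card ∨ Odd (Sᶜ ∩ R).card := by
  have h : (S ∩ R).card + (Sᶜ ∩ R).card = R.card := by
    rw [← Finset.card_union_of_disjoint]
    · congr 1; ext v; by_cases h : v ∈ S <;> simp [h]
    · exact Finset.disjoint_left.2 fun v h1 h2 =>
        (mem_compl.1 (mem_inter.1 h2).1) (mem_inter.1 h1).1
  rw [← h, Nat.odd_add] at hR
  by_cases h1 : Odd (S ∩ R).card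
  · exact Or.inl h1
  · right
    rw [← Nat.not_even_iff_odd]
    exact fun h2 => h1 (hR.2 h2)

theorem odd_union_of_odd_inter {S R : Finset V} (hS : Odd S.card) (hR : Odd R.card)
    (h : Odd (S ∩ R).card) : Odd (S ∪ R).card := by
  have := Finset.card_union_add_card_inter S R
  rw [Nat.odd_iff] at *
  omega

namespace CyclicFive

variable {a b : E → V} (G : CyclicFive a b)
include G

theorem card_le_of_maximal {e : E} (hno : ∀ A, ¬IsBip a b e A) {A N : Finset V}
    (hd : Disjoint A N) (hN : NbhdIn a b e A N) (hu : a e ∈ A) (hv : b e ∈ A)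
    (hc : N.card = A.card + 1)
    (hmax : ∀ A' N', Disjoint A' N' → NbhdIn a b e A' N' → a e ∈ A' → b e ∈ A' →
      N'.card = A'.card + 1 → A'.card ≤ A.card) :
    Fintype.card V ≤ 2 * (univ.filter fun M => IsPM a b M ∧ e ∉ M).card + 2 := by
  have hAN : ∀ v, v ∈ A → v ∉ N := fun v hv => Finset.disjoint_left.1 hd hv
  obtain ⟨x, hxe, h5, h4, hstar⟩ := G.exists_weights_of_maximal hno hd hN hu hv hc hmax
  obtain ⟨hRodd, hR5, hNN⟩ := G.rest_of_maximal hno hd hN hu hv hc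
  set R := (A ∪ N)ᶜ with hR
  have hnn : ∀ f, 0 ≤ x f := by
    intro f
    by_cases hf : f = e
    · rw [hf, hxe]
    · exact le_trans (by norm_num) (h5 f hf)
  have hsupp : ∀ y : E → ℝ, y e = 0 → ∀ f, x f = 0 → y f = 0 := by
    intro y hye f hf
    by_cases hfe : f = e
    · rw [hfe, hye]
    · have := h5 f hfe
      rw [hf] at this
      norm_num at this
  have hmemR : ∀ v, v ∈ R ↔ v ∉ A ∧ v ∉ N := by
    intro v; rw [hR, mem_compl, mem_union]; tauto
  have hcol : ∀ f, f ≠ e → a f ∉ R → b f ∉ R → ¬(a f ∈ N ↔ b f ∈ N) := by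
    intro f hf h1 h2
    have := hN f hf
    have := hNN f
    rw [hmemR] at h1 h2
    tauto
  have hcutR : ∀ (y : E → ℝ) (c : ℝ), y e = 0 → (∀ v, ∑ f ∈ cut a b {v}, y f = c) →
      ∑ f ∈ cut a b R, y f = c := by
    intro y c hye hy
    have h := sum_cut_color G.ne (A ∪ N) N y c hy (fun f hf h1 h2 =>
      hcol f (by rintro rfl; exact hf hye) (by rw [hR, mem_compl, not_not]; exact h1)
      (by rw [hR, mem_compl, not_not]; exact h2))
    have e1 : (A ∪ N) ∩ N = N := by ext v; simp
    have e2 : (A ∪ N) \ N = A := by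
      ext v; have := hAN v; rw [mem_sdiff, mem_union]; tauto
    rw [e1, e2, hc] at h
    push_cast at h
    rw [hR, cut_compl]
    rw [add_sub_cancel_left, mul_one] at h
    rw [← h]
    refine Finset.sum_congr rfl fun f hf => ?_
    by_cases h0 : y f = 0
    · rw [h0, zero_mul]
    · have hfe : f ≠ e := by rintro rfl; exact h0 hye
      have h1 := hN f hfe
      rw [mem_cut] at hf
      have : color (A ∪ N) N (a f) + color (A ∪ N) N (b f) = 1 := by
        by_cases h2 : a f ∈ A ∪ N
        · have h3 : b f ∉ A ∪ N := fun h3 => hf (by tauto)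
          have h4 : a f ∈ N := by
            rw [mem_union] at h2 h3
            tauto
          rw [color, color, if_pos h2, if_pos h4, if_neg h3, add_zero]
        · have h3 : b f ∈ A ∪ N := by tauto
          have h4 : b f ∈ N := by
            rw [mem_union] at h2 h3
            tauto
          rw [color, color, if_pos h3, if_pos h4, if_neg h2, zero_add]
      rw [this, mul_one]
  have key : ∀ S : Finset V, Odd S.card → Odd (S ∩ R).card → 1 ≤ ∑ f ∈ cut a b S, x f ∧
      (∑ f ∈ cut a b S, x f = 1 → ∀ y : E → ℝ, y e = 0 → (∀ v, ∑ f ∈ cut a b {v}, y f = 0) →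
        ∑ f ∈ cut a b S, y f = 0) := by
    intro S hS hSR
    have hunc := sum_cut_uncross a b S R x
    have hQ : Odd (S ∪ R)ᶜ.card := G.odd_compl.2 (odd_union_of_odd_inter hS hRodd hSR)
    have hbip := odd_cut_of_bichromatic G.ne hQ N hnn hstar (fun f hf h1 h2 => by
      rw [mem_compl, mem_union] at h1 h2
      exact hcol f (by rintro rfl; exact hf hxe) (by tauto) (by tauto))
    simp only [cut_compl] at hbip
    have hcr : 0 ≤ ∑ f ∈ cross a b S R, x f := Finset.sum_nonneg fun f _ => hnn f
    have hge : ∀ f ∈ cut a b (S ∩ R), 1 / 5 ≤ x f := by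
      intro f hf
      refine h5 f ?_
      rintro rfl
      have h1 : a f ∉ R := fun h => ((hmemR _).1 h).1 hu
      have h2 : b f ∉ R := fun h => ((hmemR _).1 h).1 hv
      simp [mem_cut, h1, h2] at hf
    have hT : 1 ≤ ∑ f ∈ cut a b (S ∩ R), x f ∧
        (∑ f ∈ cut a b (S ∩ R), x f = 1 → ∀ y : E → ℝ, y e = 0 →
        (∀ v, ∑ f ∈ cut a b {v}, y f = 0) → ∑ f ∈ cut a b (S ∩ R), y f = 0) := by
      have hsm : (∀ (y : E → ℝ) (c : ℝ), (∀ v, ∑ f ∈ cut a b {v}, y f = c) →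
            ∑ f ∈ cut a b (S ∩ R), y f = c) ∨
          5 ≤ (cut a b (S ∩ R)).card := by
        rcases G.odd_cases hSR with h | h | h
        · exact Or.inl fun y c => sum_cut_of_card_one a b (Or.inl h)
        · exact Or.inl fun y c => sum_cut_of_card_one a b (Or.inr h)
        · exact Or.inr h
      rcases hsm with h | h
      · exact ⟨(h x 1 hstar).ge, fun _ y _ hy => h y 0 hy⟩
      have h6 : (5 : ℝ) ≤ (cut a b (S ∩ R)).card := by exact_mod_cast h
      have h7 : 0 ≤ ∑ f ∈ cut a b (S ∩ R), (x f - 1 / 5) :=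
        Finset.sum_nonneg fun f hf => sub_nonneg.2 (hge f hf)
      have h8 := h7
      rw [Finset.sum_sub_distrib, Finset.sum_const, nsmul_eq_mul] at h8
      refine ⟨by linarith, fun h9 y hye hy => ?_⟩
      have h10 : ∑ f ∈ cut a b (S ∩ R), (x f - 1 / 5) = 0 := by
        refine le_antisymm ?_ h7
        rw [Finset.sum_sub_distrib, Finset.sum_const, nsmul_eq_mul]
        linarith
      rw [Finset.sum_eq_zero_iff_of_nonneg fun f hf => sub_nonneg.2 (hge f hf)] at h10
      have hsub : cut a b (S ∩ R) ⊆ cut a b R := by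
        intro f hf
        have h11 := h10 f hf
        have h12 := h4 f
        by_contra hfR
        have hboth : a f ∈ R ∧ b f ∈ R := by
          rw [mem_cut] at hf hfR
          rw [mem_inter, mem_inter] at hf
          tauto
        have := h4 f (by simpa [hR] using hboth.1) (by simpa [hR] using hboth.2)
        linarith
      rw [Finset.eq_of_subset_of_card_le hsub (by omega)]
      exact hcutR y 0 hye hy
    rw [hcutR x 1 hxe hstar] at hunc
    refine ⟨by linarith [hT.1, hbip.1], fun hS1 y hye hy => ?_⟩
    have huncy := sum_cut_uncross a b S R y
    have hcr0 : ∑ f ∈ cross a b S R, x f = 0 := by linarith [hT.1, hbip.1]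
    rw [Finset.sum_eq_zero_iff_of_nonneg fun f _ => hnn f] at hcr0
    rw [hcutR y 0 hye hy, hT.2 (by linarith [hT.1, hbip.1]) y hye hy,
      hbip.2 (by linarith [hT.1, hbip.1]) y hy (hsupp y hye),
      Finset.sum_eq_zero fun f hf => hsupp y hye f (hcr0 f hf)] at huncy
    linarith
  have key' : ∀ S : Finset V, Odd S.card → 1 ≤ ∑ f ∈ cut a b S, x f ∧
      (∑ f ∈ cut a b S, x f = 1 → ∀ y : E → ℝ, y e = 0 → (∀ v, ∑ f ∈ cut a b {v}, y f = 0) →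
        ∑ f ∈ cut a b S, y f = 0) := by
    intro S hS
    rcases odd_inter_or R hRodd S with h | h
    · exact key S hS h
    · have := key Sᶜ (G.odd_compl.2 hS) h
      rwa [cut_compl] at this
  exact card_le_of_rigid G.ne G.cubic e (x₀ := x)
    ⟨hnn, fun f hf => absurd hf (G.ne f), hstar, fun S hS => (key' S hS).1⟩ hxe ∅
    fun y hye hy _ => ⟨hsupp y hye, fun S hS hS1 _ => (key' S hS).2 hS1 y hye hy⟩

end CyclicFive

/-- The end in `S` of an edge leaving `S`. -/
def tip (a b : E → V) (S : Finset V) (f : E) : V := if a f ∈ S then a f else b f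

theorem tip_mem {a b : E → V} {S : Finset V} {f : E} (hf : f ∈ cut a b S) : tip a b S f ∈ S := by
  rw [mem_cut] at hf
  by_cases h : a f ∈ S
  · rwa [tip, if_pos h]
  · rw [tip, if_neg h]; tauto

theorem tip_eq (a b : E → V) (S : Finset V) (f : E) :
    tip a b S f = a f ∨ tip a b S f = b f := by
  rw [tip]; split_ifs <;> simp

/-- The end outside `S` of an edge leaving `S`. -/
theorem tip_cases {a b : E → V} {S : Finset V} {f : E} (hf : f ∈ cut a b S) :
    a f = tip a b S f ∧ b f ∉ S ∧ b f = tip a b Sᶜ f ∨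
      b f = tip a b S f ∧ a f ∉ S ∧ a f = tip a b Sᶜ f := by
  rw [mem_cut] at hf
  by_cases h : a f ∈ S
  · have h2 : b f ∉ S := by tauto
    simp [tip, h, h2]
  · have h2 : b f ∈ S := by tauto
    simp [tip, h]

namespace CyclicFive

variable {a b : E → V} (G : CyclicFive a b)
include G

theorem mem_star {f : E} {v : V} : f ∈ cut a b {v} ↔ a f = v ∨ b f = v := by
  have := G.ne f
  rw [mem_cut_singleton]
  constructor
  · tauto
  · rintro (rfl | rfl) h
    · exact this (h.1 rfl).symm
    · exact this (h.2 rfl)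

theorem mem_star_tip (S : Finset V) (f : E) : f ∈ cut a b {tip a b S f} := by
  rw [G.mem_star]
  rcases tip_eq a b S f with h | h <;> simp [h]

/-- There are no parallel edges. -/
theorem eq_of_mem_stars {p q : V} (hpq : p ≠ q) {f g : E} (hf : f ∈ cut a b {p} ∩ cut a b {q})
    (hg : g ∈ cut a b {p} ∩ cut a b {q}) : f = g := by
  by_contra hfg
  have h1 : cut a b {p, q} ⊆ (cut a b {p} ∪ cut a b {q}) \ {f, g} := by
    intro h hh
    rw [mem_inter, G.mem_star, G.mem_star] at hf hg
    have h0 := G.ne h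
    rw [mem_cut, mem_insert, mem_singleton, mem_insert, mem_singleton] at hh
    rw [mem_sdiff, mem_union, G.mem_star, G.mem_star, mem_insert, mem_singleton]
    refine ⟨by tauto, ?_⟩
    rintro (rfl | rfl)
    · rcases hf with ⟨h2 | h2, h3 | h3⟩
      · exact hpq (h2.symm.trans h3)
      · exact hh (by tauto)
      · exact hh (by tauto)
      · exact hpq (h2.symm.trans h3)
    · rcases hg with ⟨h2 | h2, h3 | h3⟩
      · exact hpq (h2.symm.trans h3)
      · exact hh (by tauto)
      · exact hh (by tauto)
      · exact hpq (h2.symm.trans h3)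
  have h2 := Finset.card_le_card h1
  have h3 : ({f, g} : Finset E) ⊆ cut a b {p} ∩ cut a b {q} := by
    intro h hh
    rw [mem_insert, mem_singleton] at hh
    rcases hh with rfl | rfl <;> assumption
  have h4 := Finset.card_le_card h3
  have h5 := Finset.card_union_add_card_inter (cut a b {p}) (cut a b {q})
  rw [Finset.card_sdiff_of_subset (h3.trans (Finset.inter_subset_left.trans
    Finset.subset_union_left))] at h2
  rw [Finset.card_pair hfg] at h2 h4
  rw [G.cubic, G.cubic] at h5
  have h6 := G.three_le_cut (S := {p, q}) ⟨p, by simp⟩ (fun h => by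
    have h7 := G.four_le
    rw [← Finset.card_univ, ← h, Finset.card_pair hpq] at h7
    omega)
  omega

end CyclicFive

/-- A fractional perfect matching avoiding `e`, with value at least a quarter elsewhere. -/
structure Quarter (a b : E → V) (e : E) (x : E → ℝ) : Prop where
  graph : CyclicFive a b
  zero : x e = 0
  quarter : ∀ f, f ≠ e → 1 / 4 ≤ x f
  star : ∀ v, ∑ f ∈ cut a b {v}, x f = 1

/-- A nontrivial odd set whose cut has value one. -/
structure Tight (a b : E → V) (x : E → ℝ) (S : Finset V) : Prop where
  odd : Odd S.card
  sum_eq : ∑ f ∈ cut a b S, x f = 1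
  card_ne : S.card ≠ 1
  card_compl_ne : Sᶜ.card ≠ 1

namespace Quarter

variable {a b : E → V} {e : E} {x : E → ℝ} (Q : Quarter a b e x)
include Q

theorem nonneg (f : E) : 0 ≤ x f := by
  by_cases hf : f = e
  · rw [hf, Q.zero]
  · exact le_trans (by norm_num) (Q.quarter f hf)

theorem eq_of_zero {f : E} (hf : x f = 0) : f = e := by
  by_contra h
  have := Q.quarter f h
  rw [hf] at this
  norm_num at this

theorem card_erase_le (C : Finset E) : ((C.erase e).card : ℝ) / 4 ≤ ∑ f ∈ C, x f := by
  have h1 : ∑ f ∈ C.erase e, x f ≤ ∑ f ∈ C, x f :=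
    Finset.sum_le_sum_of_subset_of_nonneg (Finset.erase_subset _ _) fun f _ _ => Q.nonneg f
  have h2 := Finset.card_nsmul_le_sum (C.erase e) x (1 / 4)
    fun f hf => Q.quarter f (ne_of_mem_erase hf)
  rw [nsmul_eq_mul] at h2
  linarith

theorem feasible : Feasible a b x where
  nonneg := Q.nonneg
  loop f hf := absurd hf (Q.graph.ne f)
  star := Q.star
  odd S hS := by
    rcases Q.graph.odd_cases hS with h | h | h
    · exact (sum_cut_of_card_one a b (Or.inl h) Q.star).ge
    · exact (sum_cut_of_card_one a b (Or.inr h) Q.star).ge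
    · have h1 := Q.card_erase_le (cut a b S)
      have h2 := Finset.pred_card_le_card_erase (s := cut a b S) (a := e)
      have h3 : 4 ≤ ((cut a b S).erase e).card := by omega
      have h4 : (4 : ℝ) ≤ ((cut a b S).erase e).card := by exact_mod_cast h3
      linarith

theorem tight_compl {S : Finset V} (T : Tight a b x S) : Tight a b x Sᶜ where
  odd := Q.graph.odd_compl.2 T.odd
  sum_eq := by rw [cut_compl]; exact T.sum_eq
  card_ne := T.card_compl_ne
  card_compl_ne := by rw [compl_compl]; exact T.card_ne

theorem three_le {S : Finset V} (T : Tight a b x S) : 3 ≤ S.card := by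
  have h1 := T.odd
  have h2 := T.card_ne
  rw [Nat.odd_iff] at h1
  omega

theorem mem_and_card {S : Finset V} (T : Tight a b x S) :
    e ∈ cut a b S ∧ (cut a b S).card = 5 := by
  have h1 := Q.card_erase_le (cut a b S)
  rw [T.sum_eq] at h1
  have h2 : ((cut a b S).erase e).card ≤ 4 := by
    have : (((cut a b S).erase e).card : ℝ) ≤ 4 := by linarith
    exact_mod_cast this
  have h3 : 5 ≤ (cut a b S).card := by
    rcases Q.graph.odd_cases T.odd with h | h | h
    · exact absurd h T.card_ne
    · exact absurd h T.card_compl_ne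
    · exact h
  have h4 : e ∈ cut a b S := by
    by_contra h
    rw [Finset.erase_eq_of_notMem h] at h2
    omega
  rw [Finset.card_erase_of_mem h4] at h2
  exact ⟨h4, by omega⟩

theorem eq_quarter {S : Finset V} (T : Tight a b x S) {f : E} (hf : f ∈ cut a b S)
    (hfe : f ≠ e) : x f = 1 / 4 := by
  obtain ⟨h1, h2⟩ := Q.mem_and_card T
  have h3 := Finset.add_sum_erase (cut a b S) x h1
  have h4 : f ∈ (cut a b S).erase e := mem_erase.2 ⟨hfe, hf⟩
  rw [Q.zero, zero_add, T.sum_eq, ← Finset.add_sum_erase _ x h4] at h3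
  have h5 := Finset.card_nsmul_le_sum (((cut a b S).erase e).erase f) x (1 / 4)
    fun g hg => Q.quarter g (ne_of_mem_erase (mem_of_mem_erase hg))
  rw [Finset.card_erase_of_mem h4, Finset.card_erase_of_mem h1, h2, nsmul_eq_mul] at h5
  have := Q.quarter f hfe
  norm_num at h5
  linarith

/-- The edges at a vertex, in terms of two of them. -/
theorem third_edge {v : V} {f g : E} (hf : f ∈ cut a b {v}) (hg : g ∈ cut a b {v})
    (hfg : f ≠ g) : ∃ h, h ∈ cut a b {v} ∧ h ≠ f ∧ h ≠ g ∧ cut a b {v} = {f, g, h} ∧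
      x f + x g + x h = 1 := by
  have h1 : (((cut a b {v}).erase f).erase g).card = 1 := by
    rw [Finset.card_erase_of_mem (mem_erase.2 ⟨hfg.symm, hg⟩), Finset.card_erase_of_mem hf,
      Q.graph.cubic]
  obtain ⟨h, hh⟩ := Finset.card_eq_one.1 h1
  have h2 : h ∈ ((cut a b {v}).erase f).erase g := by rw [hh]; exact mem_singleton_self h
  have h3 : h ≠ f := ne_of_mem_erase (mem_of_mem_erase h2)
  have h4 : h ≠ g := ne_of_mem_erase h2
  refine ⟨h, mem_of_mem_erase (mem_of_mem_erase h2), h3, h4, ?_, ?_⟩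
  · rw [← Finset.insert_erase hf, ← Finset.insert_erase (mem_erase.2 ⟨hfg.symm, hg⟩), hh]
  · rw [← Q.star v, ← Finset.add_sum_erase _ x hf,
      ← Finset.add_sum_erase _ x (mem_erase.2 ⟨hfg.symm, hg⟩ : g ∈ (cut a b {v}).erase f), hh,
      Finset.sum_singleton]
    ring

/-- An edge of value three quarters is adjacent to `e` only at a common vertex with no other small
edge. -/
theorem lt_three_quarters {f : E} {p q : V} (hp : f ∈ cut a b {p}) (hq : f ∈ cut a b {q})
    (hpq : p ≠ q) (hep : e ∈ cut a b {p}) (hfe : f ≠ e) : x f < 3 / 4 := by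
  have heq : e ∉ cut a b {q} := fun h =>
    hfe (Q.graph.eq_of_mem_stars hpq (mem_inter.2 ⟨hp, hq⟩) (mem_inter.2 ⟨hep, h⟩))
  have h1 : ∃ g ∈ cut a b {q}, g ≠ f := by
    by_contra h
    push Not at h
    have : (cut a b {q}).card ≤ 1 :=
      Finset.card_le_one.2 fun c hc d hd => (h c hc).trans (h d hd).symm
    rw [Q.graph.cubic] at this
    omega
  obtain ⟨g, hg, hgf⟩ := h1
  obtain ⟨h, hh, -, -, -, hsum⟩ := Q.third_edge hq hg hgf.symm
  have h2 := Q.quarter g (fun h => heq (h ▸ hg))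
  have h3 := Q.quarter h (fun h' => heq (h' ▸ hh))
  linarith

theorem tip_ne {S : Finset V} (T : Tight a b x S) {f : E} (hf : f ∈ cut a b S) (hfe : f ≠ e) :
    tip a b S f ≠ tip a b S e := by
  intro heq
  have h1 := Q.graph.mem_star_tip S e
  have h2 : f ∈ cut a b {tip a b S e} := heq ▸ Q.graph.mem_star_tip S f
  obtain ⟨h, hh, hhe, hhf, -, hsum⟩ := Q.third_edge h1 h2 hfe.symm
  rw [Q.zero, Q.eq_quarter T hf hfe] at hsum
  obtain ⟨q, hq, hqne⟩ : ∃ q, h ∈ cut a b {q} ∧ tip a b S e ≠ q := by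
    rw [Q.graph.mem_star] at hh
    rcases hh with hh | hh
    · exact ⟨b h, Q.graph.mem_star.2 (Or.inr rfl), by rw [← hh]; exact Q.graph.ne h⟩
    · exact ⟨a h, Q.graph.mem_star.2 (Or.inl rfl), by rw [← hh]; exact (Q.graph.ne h).symm⟩
  have := Q.lt_three_quarters hh hq hqne h1 hhe
  linarith

end Quarter

theorem three_mul_card {a b : E → V} (G : CyclicFive a b) (S : Finset V) :
    3 * S.card = (cut a b S).card + 2 * (univ.filter fun f => a f ∈ S ∧ b f ∈ S).card := by
  have h := G.sum_ends (fun v => if v ∈ S then 1 else 0)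
  have h1 : ∀ f, ((if a f ∈ S then 1 else 0) + (if b f ∈ S then 1 else 0) : ℤ) =
      (if ¬(a f ∈ S ↔ b f ∈ S) then 1 else 0) + 2 * (if a f ∈ S ∧ b f ∈ S then 1 else 0) := by
    intro f
    by_cases h1 : a f ∈ S <;> by_cases h2 : b f ∈ S <;> simp [h1, h2]
  simp_rw [h1, Finset.sum_add_distrib, ← Finset.mul_sum, Finset.sum_boole] at h
  rw [Finset.filter_mem_eq_inter, Finset.univ_inter] at h
  rw [cut]
  norm_cast at h
  exact h.symm

namespace Quarter

variable {a b : E → V} {e : E} {x : E → ℝ} (Q : Quarter a b e x)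
include Q

/-- If two edges other than `e` leave a tight set at the same vertex, then the inner edges all have
an end in common with `e`. -/
theorem inner_of_tip_eq {S : Finset V} (T : Tight a b x S) {f g : E} (hf : f ∈ cut a b S)
    (hg : g ∈ cut a b S) (hfe : f ≠ e) (hge : g ≠ e) (hfg : f ≠ g)
    (heq : tip a b S f = tip a b S g) :
    ∀ k, a k ∈ S → b k ∈ S → k ∈ cut a b {tip a b S e} := by
  have hG := Q.graph
  obtain ⟨heS, h5⟩ := Q.mem_and_card T
  set s := tip a b S f with hs
  have hsS : s ∈ S := tip_mem hf
  have hgs : g ∈ cut a b {s} := by rw [heq]; exact hG.mem_star_tip S g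
  obtain ⟨h, -, -, -, hcs, -⟩ := Q.third_edge (hG.mem_star_tip S f) hgs hfg
  have h1 : cut a b (S.erase s) ⊆ insert h (((cut a b S).erase f).erase g) := by
    intro k hk
    rw [mem_insert, mem_erase, mem_erase]
    by_contra hcon
    push Not at hcon
    have hks : k ∉ cut a b {s} ∨ k = f ∨ k = g := by
      rw [hcs, mem_insert, mem_insert, mem_singleton]; tauto
    have hend : ∀ k, k ∈ cut a b S → k ∈ cut a b {s} → k ∉ cut a b (S.erase s) := by
      intro k hk hks hk'
      rw [hG.mem_star] at hks
      have := hG.ne k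
      rw [mem_cut] at hk hk'
      rw [mem_erase, mem_erase] at hk'
      rcases hks with hks | hks <;> rw [← hks] at hk' hsS
      · simp only [ne_eq, not_true_eq_false, false_and, false_iff, not_not] at hk'
        tauto
      · simp only [ne_eq, not_true_eq_false, false_and, iff_false, not_not] at hk'
        tauto
    rcases hks with hks | rfl | rfl
    · have hkS : k ∈ cut a b S := by
        rw [hG.mem_star] at hks
        push Not at hks
        rw [mem_cut, mem_erase, mem_erase] at hk
        rw [mem_cut]
        tauto
      by_cases hkg : k = g
      · exact hks (hkg ▸ hgs)
      · by_cases hkf : k = f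
        · exact hks (hkf ▸ hG.mem_star_tip S f)
        · exact hcon.2 hkg hkf hkS
    · exact hend k hf (hG.mem_star_tip S k) hk
    · exact hend k hg hgs hk
  have h2 := Finset.card_le_card h1
  have h3 := Finset.card_insert_le h (((cut a b S).erase f).erase g)
  rw [Finset.card_erase_of_mem (mem_erase.2 ⟨hfg.symm, hg⟩), Finset.card_erase_of_mem hf, h5] at h3
  have h3S := Q.three_le T
  have h4 := hG.subset_cut (Finset.erase_subset s S) (Q.three_le (Q.tight_compl T))
    (by rw [← Finset.card_pos, Finset.card_erase_of_mem hsS]; omega)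
  rw [Finset.card_erase_of_mem hsS] at h4
  have hS3 : S.card = 3 := by omega
  have h6 := three_mul_card hG S
  rw [hS3, h5] at h6
  have hI : (univ.filter fun f => a f ∈ S ∧ b f ∈ S).card = 2 := by omega
  set u := tip a b S e with hu
  have h7 : (cut a b {u}).erase e ⊆ univ.filter fun f => a f ∈ S ∧ b f ∈ S := by
    intro k hk
    have hke := ne_of_mem_erase hk
    have hku := mem_of_mem_erase hk
    have huS : u ∈ S := tip_mem heS
    by_contra hn
    have hkS : k ∈ cut a b S := by
      rw [hG.mem_star] at hku
      simp only [mem_filter, mem_univ, true_and] at hn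
      rw [mem_cut]
      rcases hku with h | h <;> rw [h] at hn ⊢ <;> tauto
    have h8 := Q.tip_ne T hkS hke
    rw [← hu] at h8
    rw [hG.mem_star] at hku
    rcases tip_cases hkS with ⟨h9, h10, -⟩ | ⟨h9, h10, -⟩ <;> rcases hku with h11 | h11
    · exact h8 (h9.symm.trans h11)
    · exact h10 (h11 ▸ huS)
    · exact h10 (h11 ▸ huS)
    · exact h8 (h9.symm.trans h11)
  have h8 := Finset.eq_of_subset_of_card_le h7 (by
    rw [hI, Finset.card_erase_of_mem (hG.mem_star_tip S e), hG.cubic])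
  intro k ha hb
  have : k ∈ (cut a b {u}).erase e := by rw [h8]; simp [ha, hb]
  exact mem_of_mem_erase this

/-- Uncrossing tight sets. -/
theorem tight_inter {S R : Finset V} (hS : Tight a b x S) (hR : Tight a b x R)
    (hodd : Odd (S ∩ R).card) :
    ∑ f ∈ cut a b (S ∩ R), x f = 1 ∧ ∀ f ∈ cross a b S R, f = e := by
  have h1 := sum_cut_uncross a b S R x
  rw [hS.sum_eq, hR.sum_eq] at h1
  have h2 := Q.feasible.odd _ hodd
  have h3 := Q.feasible.odd _ (odd_union_of_odd_inter hS.odd hR.odd hodd)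
  have h4 : 0 ≤ ∑ f ∈ cross a b S R, x f := Finset.sum_nonneg fun f _ => Q.nonneg f
  refine ⟨by linarith, ?_⟩
  have h5 : ∑ f ∈ cross a b S R, x f = 0 := by linarith
  rw [Finset.sum_eq_zero_iff_of_nonneg fun f _ => Q.nonneg f] at h5
  exact fun f hf => Q.eq_of_zero (h5 f hf)

end Quarter

/-- An odd set left by five edges, one of which is `e`, with distinct ends in the set. -/
structure Port (a b : E → V) (e : E) (S : Finset V) : Prop where
  graph : CyclicFive a b
  odd : Odd S.card
  three_le_compl : 3 ≤ Sᶜ.card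
  card_cut : (cut a b S).card = 5
  mem : e ∈ cut a b S
  inj : ∀ f ∈ cut a b S, ∀ g ∈ cut a b S, tip a b S f = tip a b S g → f = g

/-- Inside `S`, every edge with an end in `A` has its other end in `B`. -/
structure Closed (a b : E → V) (S A B : Finset V) : Prop where
  left : A ⊆ S
  right : B ⊆ S
  disj : Disjoint A B
  nbhd : ∀ f, a f ∈ S → b f ∈ S → (a f ∈ A → b f ∈ B) ∧ (b f ∈ A → a f ∈ B)

/-- The edges leaving `S` from the subset `B`. -/
def exits (a b : E → V) (S B : Finset V) : Finset E := (cut a b S).filter fun f => tip a b S f ∈ B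

/-- The edges with both ends in `B`. -/
def inner (a b : E → V) (B : Finset V) : Finset E := univ.filter fun f => a f ∈ B ∧ b f ∈ B

theorem mem_exits {a b : E → V} {S B : Finset V} {f : E} :
    f ∈ exits a b S B ↔ f ∈ cut a b S ∧ tip a b S f ∈ B := by simp [exits]

/-- Every inner edge of `S` has exactly one end in some set containing the ends in `S` of all edges
other than `e` that leave `S`. -/
def Colored (a b : E → V) (e : E) (S : Finset V) : Prop :=
  ∃ B : Finset V, (∀ f, a f ∈ S → b f ∈ S → ¬(a f ∈ B ↔ b f ∈ B)) ∧
    ∀ f ∈ cut a b S, f ≠ e → tip a b S f ∈ B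

/-- The set `S` is coloured up to the edge `k`, which joins the ends of `l` and `l'`. -/
structure Linked (a b : E → V) (e : E) (S : Finset V) (l l' k : E) (B : Finset V) : Prop where
  mem : l ∈ cut a b S
  mem' : l' ∈ cut a b S
  ne_e : l ≠ e
  ne_e' : l' ≠ e
  ne : l ≠ l'
  star : k ∈ cut a b {tip a b S l}
  star' : k ∈ cut a b {tip a b S l'}
  bichromatic : ∀ f, a f ∈ S → b f ∈ S → f ≠ k → ¬(a f ∈ B ↔ b f ∈ B)
  tip_mem : ∀ f ∈ cut a b S, f ≠ e → f ≠ l → f ≠ l' → tip a b S f ∈ B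
  tip_notMem : tip a b S l ∉ B
  tip_notMem' : tip a b S l' ∉ B
  tip_e : tip a b S e ∉ B

theorem Closed.bichromatic {a b : E → V} {S A B : Finset V} (h : Closed a b S A B)
    (hi : (inner a b B).card = 0) {f : E} (ha : a f ∈ S) (hb : b f ∈ S)
    (hf : a f ∈ A ∪ B ∨ b f ∈ A ∪ B) : ¬(a f ∈ B ↔ b f ∈ B) := by
  have h1 : ¬(a f ∈ B ∧ b f ∈ B) := by
    intro h1
    have : f ∈ inner a b B := by simpa [inner] using h1
    rw [Finset.card_eq_zero] at hi
    simp [hi] at this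
  have h2 := h.nbhd f ha hb
  have h3 : a f ∈ A → a f ∉ B := fun h4 => Finset.disjoint_left.1 h.disj h4
  have h4 : b f ∈ A → b f ∉ B := fun h4 => Finset.disjoint_left.1 h.disj h4
  rw [mem_union, mem_union] at hf
  tauto

namespace Port

variable {a b : E → V} {e : E} {S : Finset V} (P : Port a b e S)
include P

theorem card_cut_rest {A B : Finset V} (h : Closed a b S A B) :
    ((cut a b (S \ (A ∪ B))).card : ℤ) =
      5 + 3 * (B.card - A.card) - 2 * (exits a b S B).card - 2 * (inner a b B).card := by
  have h1 : ((cut a b S).card : ℤ) = 5 := by rw [P.card_cut]; rfl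
  rw [← h1, ← P.graph.sum_signed, card_cut_eq_sum, card_cut_eq_sum]
  have h2 : ((exits a b S B).card : ℤ) =
      ∑ f, if ¬(a f ∈ S ↔ b f ∈ S) ∧ tip a b S f ∈ B then 1 else 0 := by
    rw [Finset.sum_boole, exits, cut, Finset.filter_filter]
  have h3 : ((inner a b B).card : ℤ) = ∑ f, if a f ∈ B ∧ b f ∈ B then 1 else 0 := by
    rw [Finset.sum_boole, inner]
  rw [h2, h3, Finset.mul_sum, Finset.mul_sum, ← Finset.sum_add_distrib, ← Finset.sum_sub_distrib,
    ← Finset.sum_sub_distrib]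
  refine Finset.sum_congr rfl fun f _ => ?_
  have hn := h.nbhd f
  have ha1 := @h.left (a f)
  have ha2 := @h.right (a f)
  have hb1 := @h.left (b f)
  have hb2 := @h.right (b f)
  rcases signed_cases h.disj (a f) with ⟨c1, c2, c3⟩ | ⟨c1, c2, c3⟩ | ⟨c1, c2, c3⟩ <;>
    rcases signed_cases h.disj (b f) with ⟨c4, c5, c6⟩ | ⟨c4, c5, c6⟩ | ⟨c4, c5, c6⟩ <;>
    rw [c3, c6] <;>
    simp only [c1, c2, c4, c5, mem_sdiff, mem_union, forall_const, false_imp_iff, imp_false,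
      true_and, and_true, implies_true, not_false_eq_true]
      at hn ha1 ha2 hb1 hb2 ⊢ <;>
    by_cases h6 : a f ∈ S <;> by_cases h7 : b f ∈ S <;> simp [tip, *] at hn ⊢

theorem card_rest {A B : Finset V} (h : Closed a b S A B) :
    (S \ (A ∪ B)).card + A.card + B.card = S.card := by
  have h1 := Finset.card_sdiff_add_card_eq_card (Finset.union_subset h.left h.right)
  rw [Finset.card_union_of_disjoint h.disj] at h1
  omega

theorem rest_le (D : Finset V) (hD : D ⊆ S) :
    D = ∅ ∨ 1 ≤ D.card ∧ (D.card + 2 ≤ (cut a b D).card ∨ 5 ≤ (cut a b D).card) := by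
  rcases Finset.eq_empty_or_nonempty D with h | h
  · exact Or.inl h
  · exact Or.inr ⟨h.card_pos, P.graph.subset_cut hD P.three_le_compl h⟩

theorem cut_empty : (cut a b (∅ : Finset V)).card = 0 := by
  rw [Finset.card_eq_zero]; ext f; simp [mem_cut]

theorem rest_cases {A B : Finset V} (h : Closed a b S A B) (h2 : 2 ≤ (exits a b S B).card) :
    A.card + 1 ≤ B.card ∧ (B.card = A.card + 1 →
      S \ (A ∪ B) = ∅ ∧ (exits a b S B).card + (inner a b B).card = 4 ∨
      (S \ (A ∪ B)).card = 2 ∧ (cut a b (S \ (A ∪ B))).card = 4 ∧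
        (exits a b S B).card = 2 ∧ (inner a b B).card = 0) := by
  have h3 := P.card_cut_rest h
  have h4 := P.card_rest h
  have h5 := P.odd
  rw [Nat.odd_iff] at h5
  rcases P.rest_le _ (Finset.sdiff_subset (s := S) (t := A ∪ B)) with h6 | ⟨h6, h7⟩
  · rw [h6] at h3 h4 ⊢
    rw [P.cut_empty] at h3
    rw [Finset.card_empty] at h4
    refine ⟨by omega, fun h8 => Or.inl ⟨rfl, by omega⟩⟩
  · refine ⟨by omega, fun h8 => Or.inr (by omega)⟩

theorem exists_linked {l l' : E} (hl : l ∈ cut a b S) (hl' : l' ∈ cut a b S) (hle : l ≠ e)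
    (hle' : l' ≠ e) (hne : l ≠ l') {B C : Finset V} (hC : C.card = 2)
    (hCcut : (cut a b C).card = 4) (htl : tip a b S l ∈ C) (htl' : tip a b S l' ∈ C)
    (hbi : ∀ f, a f ∈ S → b f ∈ S → ¬(a f ∈ C ∧ b f ∈ C) → ¬(a f ∈ B ↔ b f ∈ B))
    (htip : ∀ f ∈ cut a b S, f ≠ e → f ≠ l → f ≠ l' → tip a b S f ∈ B)
    (h1 : tip a b S l ∉ B) (h2 : tip a b S l' ∉ B) (h3 : tip a b S e ∉ B) :
    ∃ k, Linked a b e S l l' k B := by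
  have h4 := three_mul_card P.graph C
  rw [hC, hCcut] at h4
  have h5 : (univ.filter fun f => a f ∈ C ∧ b f ∈ C).card = 1 := by omega
  obtain ⟨k, hk⟩ := Finset.card_eq_one.1 h5
  have hkC : a k ∈ C ∧ b k ∈ C := by
    have : k ∈ univ.filter fun f => a f ∈ C ∧ b f ∈ C := by rw [hk]; exact mem_singleton_self k
    simpa using this
  have htne : tip a b S l ≠ tip a b S l' := fun h => hne (P.inj l hl l' hl' h)
  have hCeq : C = {tip a b S l, tip a b S l'} := by
    symm
    apply Finset.eq_of_subset_of_card_le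
    · intro v hv
      rw [mem_insert, mem_singleton] at hv
      rcases hv with rfl | rfl <;> assumption
    · rw [hC, Finset.card_pair htne]
  have hkne := P.graph.ne k
  rw [hCeq, mem_insert, mem_singleton, mem_insert, mem_singleton] at hkC
  refine ⟨k, hl, hl', hle, hle', hne, ?_, ?_, fun f ha hb hfk => hbi f ha hb ?_, htip, h1, h2, h3⟩
  · rw [P.graph.mem_star]
    rcases hkC with ⟨h6 | h6, h7 | h7⟩ <;> first | tauto | exact absurd (h6.trans h7.symm) hkne
  · rw [P.graph.mem_star]
    rcases hkC with ⟨h6 | h6, h7 | h7⟩ <;> first | tauto | exact absurd (h6.trans h7.symm) hkne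
  · intro h
    have : f ∈ univ.filter fun f => a f ∈ C ∧ b f ∈ C := by simpa using h
    rw [hk, mem_singleton] at this
    exact hfk this

/-- The edges leaving `S`, except for `e` and two others. -/
theorem card_erase_three {l l' : E} (hl : l ∈ cut a b S) (hl' : l' ∈ cut a b S) (hle : l ≠ e)
    (hle' : l' ≠ e) (hne : l ≠ l') : ((((cut a b S).erase e).erase l).erase l').card = 2 := by
  rw [Finset.card_erase_of_mem, Finset.card_erase_of_mem, Finset.card_erase_of_mem P.mem,
    P.card_cut]
  · exact mem_erase.2 ⟨hle, hl⟩
  · exact mem_erase.2 ⟨hne.symm, mem_erase.2 ⟨hle', hl'⟩⟩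

theorem erase_subset_exits {l l' : E} {B : Finset V}
    (htip : ∀ f ∈ cut a b S, f ≠ e → f ≠ l → f ≠ l' → tip a b S f ∈ B) :
    (((cut a b S).erase e).erase l).erase l' ⊆ exits a b S B := by
  intro f hf
  rw [mem_erase, mem_erase, mem_erase] at hf
  exact mem_exits.2 ⟨hf.2.2.2, htip f hf.2.2.2 hf.2.2.1 hf.2.1 hf.1⟩

theorem colored_or_linked {l l' : E} (hl : l ∈ cut a b S) (hl' : l' ∈ cut a b S) (hle : l ≠ e)
    (hle' : l' ≠ e) (hne : l ≠ l') {A B : Finset V} (h : Closed a b S A B)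
    (htip : ∀ f ∈ cut a b S, f ≠ e → f ≠ l → f ≠ l' → tip a b S f ∈ B)
    (h1 : tip a b S l ∉ A) (h2 : tip a b S l' ∉ A) (hc : B.card = A.card + 1) :
    Colored a b e S ∨ ∃ k, Linked a b e S l l' k B := by
  have h3 := P.card_erase_three hl hl' hle hle' hne
  have h4 := P.erase_subset_exits htip
  have h5 := Finset.card_le_card h4
  rcases (P.rest_cases h (by omega)).2 hc with ⟨h6, h7⟩ | ⟨h6, h7, h8, h9⟩
  · left
    rw [Finset.sdiff_eq_empty_iff_subset] at h6
    have hB : ∀ f ∈ cut a b S, f ≠ e → tip a b S f ∈ B := by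
      intro f hf hfe
      by_cases h10 : f = l
      · have := h6 (tip_mem hf)
        rw [h10, mem_union] at this
        rw [h10]; tauto
      by_cases h11 : f = l'
      · have := h6 (tip_mem hf)
        rw [h11, mem_union] at this
        rw [h11]; tauto
      exact htip f hf hfe h10 h11
    have h10 : (cut a b S).erase e ⊆ exits a b S B := by
      intro f hf
      rw [mem_erase] at hf
      exact mem_exits.2 ⟨hf.2, hB f hf.2 hf.1⟩
    have h11 := Finset.card_le_card h10
    rw [Finset.card_erase_of_mem P.mem, P.card_cut] at h11
    exact ⟨B, fun f ha hb => h.bichromatic (by omega) ha hb (Or.inl (h6 ha)), hB⟩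
  · right
    have h10 := Finset.eq_of_subset_of_card_le h4 (by omega)
    have h11 : ∀ f ∈ cut a b S, f = e ∨ f = l ∨ f = l' → tip a b S f ∉ B := by
      intro f hf hf' hB
      have : f ∈ exits a b S B := mem_exits.2 ⟨hf, hB⟩
      rw [← h10, mem_erase, mem_erase, mem_erase] at this
      tauto
    have hl1 := h11 l hl (by tauto)
    have hl2 := h11 l' hl' (by tauto)
    refine P.exists_linked hl hl' hle hle' hne h6 h7 ?_ ?_ ?_ htip hl1 hl2 (h11 e P.mem (by tauto))
    · rw [mem_sdiff, mem_union]; exact ⟨tip_mem hl, by tauto⟩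
    · rw [mem_sdiff, mem_union]; exact ⟨tip_mem hl', by tauto⟩
    · intro f ha hb hf
      refine h.bichromatic h9 ha hb ?_
      rw [mem_sdiff, mem_sdiff] at hf
      tauto

end Port

/-- A closed pair obstructing a matching of `S` that misses exactly the ends of the edges other than
`e` and `l` that leave `S`. -/
structure Cert (a b : E → V) (e : E) (S : Finset V) (l : E) (A B : Finset V) : Prop where
  closed : Closed a b S A B
  tip_mem : ∀ f ∈ cut a b S, f ≠ e → f ≠ l → tip a b S f ∈ B
  card_le : B.card ≤ A.card + 2

theorem card_uncross {A B A' B' : Finset V} (hd : Disjoint A B) (hd' : Disjoint A' B') :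
    ((B ∪ B') \ (A ∪ A')).card + (B ∩ B').card + A.card + A'.card =
      ((A ∪ A') \ (B ∪ B')).card + (A ∩ A').card + B.card + B'.card := by
  have h1 : ∀ X : Finset V, X.card = ∑ v, if v ∈ X then 1 else 0 := by
    intro X
    rw [Finset.sum_boole, Finset.filter_mem_eq_inter, Finset.univ_inter, Nat.cast_id]
  rw [h1 (_ \ _), h1 (_ ∩ _), h1 A, h1 A', h1 (_ \ _), h1 (_ ∩ _), h1 B, h1 B',
    ← Finset.sum_add_distrib, ← Finset.sum_add_distrib, ← Finset.sum_add_distrib,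
    ← Finset.sum_add_distrib, ← Finset.sum_add_distrib, ← Finset.sum_add_distrib]
  refine Finset.sum_congr rfl fun v _ => ?_
  have h2 : v ∈ A → v ∉ B := fun h => Finset.disjoint_left.1 hd h
  have h3 : v ∈ A' → v ∉ B' := fun h => Finset.disjoint_left.1 hd' h
  by_cases c1 : v ∈ A <;> by_cases c2 : v ∈ A' <;> by_cases c3 : v ∈ B <;>
    by_cases c4 : v ∈ B' <;> simp [c1, c2, c3, c4] at h2 h3 ⊢

theorem Closed.inter {a b : E → V} {S A B A' B' : Finset V} (h : Closed a b S A B)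
    (h' : Closed a b S A' B') : Closed a b S (A ∩ A') (B ∩ B') where
  left := Finset.inter_subset_left.trans h.left
  right := Finset.inter_subset_left.trans h.right
  disj := h.disj.mono Finset.inter_subset_left Finset.inter_subset_left
  nbhd := by
    intro f ha hb
    have h1 := h.nbhd f ha hb
    have h2 := h'.nbhd f ha hb
    simp only [mem_inter]
    tauto

theorem Closed.union {a b : E → V} {S A B A' B' : Finset V} (h : Closed a b S A B)
    (h' : Closed a b S A' B') :
    Closed a b S ((A ∪ A') \ (B ∪ B')) ((B ∪ B') \ (A ∪ A')) where
  left := Finset.sdiff_subset.trans (Finset.union_subset h.left h'.left)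
  right := Finset.sdiff_subset.trans (Finset.union_subset h.right h'.right)
  disj := Finset.disjoint_left.2 fun v hv hv' => (mem_sdiff.1 hv).2 (mem_sdiff.1 hv').1
  nbhd := by
    intro f ha hb
    have h1 := h.nbhd f ha hb
    have h2 := h'.nbhd f ha hb
    have h3 : ∀ v, v ∈ A → v ∉ B := fun v hv => Finset.disjoint_left.1 h.disj hv
    have h4 : ∀ v, v ∈ A' → v ∉ B' := fun v hv => Finset.disjoint_left.1 h'.disj hv
    have h5 : ∀ p q, (p ∈ A → q ∈ B) → (q ∈ A → p ∈ B) → (p ∈ A' → q ∈ B') →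
        (q ∈ A' → p ∈ B') → p ∈ (A ∪ A') \ (B ∪ B') → q ∈ (B ∪ B') \ (A ∪ A') := by
      intro p q h5 h6 h7 h8 h9
      rw [mem_sdiff, mem_union, mem_union] at h9 ⊢
      refine ⟨h9.1.imp h5 h7, ?_⟩
      rintro (h10 | h10)
      · exact h9.2 (Or.inl (h6 h10))
      · exact h9.2 (Or.inr (h8 h10))
    exact ⟨h5 _ _ h1.1 h1.2 h2.1 h2.2, h5 _ _ h1.2 h1.1 h2.2 h2.1⟩

namespace Port

variable {a b : E → V} {e : E} {S : Finset V} (P : Port a b e S)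
include P

theorem card_erase_erase {l : E} (hl : l ∈ cut a b S) (hle : l ≠ e) :
    (((cut a b S).erase e).erase l).card = 3 := by
  rw [Finset.card_erase_of_mem (mem_erase.2 ⟨hle, hl⟩), Finset.card_erase_of_mem P.mem, P.card_cut]

theorem cert_facts {l : E} (hl : l ∈ cut a b S) (hle : l ≠ e) {A B : Finset V}
    (h : Cert a b e S l A B) (hc : B.card = A.card + 2)
    (hno : ∀ A' B', Cert a b e S l A' B' → B'.card ≠ A'.card + 1) :
    tip a b S e ∉ B ∧ tip a b S l ∉ B ∧ (inner a b B).card = 0 ∧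
      (cut a b (S \ (A ∪ B))).card = 5 ∧ Odd (S \ (A ∪ B)).card := by
  have h1 := P.card_cut_rest h.closed
  have h2 := P.card_rest h.closed
  have hodd := P.odd
  rw [Nat.odd_iff] at hodd
  have hsub : ((cut a b S).erase e).erase l ⊆ exits a b S B := by
    intro f hf
    rw [mem_erase, mem_erase] at hf
    exact mem_exits.2 ⟨hf.2.2, h.tip_mem f hf.2.2 hf.2.1 hf.1⟩
  have h3 := Finset.card_le_card hsub
  rw [P.card_erase_erase hl hle] at h3
  rcases P.rest_le _ (Finset.sdiff_subset (s := S) (t := A ∪ B)) with h4 | ⟨h4, h5⟩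
  · rw [h4, card_empty] at h2
    omega
  by_cases h6 : (S \ (A ∪ B)).card = 1 ∧ (cut a b (S \ (A ∪ B))).card = 3
  · exfalso
    obtain ⟨r, hr⟩ := Finset.card_eq_one.1 h6.1
    have hr1 : ∀ v, v ∈ S → v ∉ A → v ∉ B → v = r := by
      intro v hv hA hB
      rw [← mem_singleton, ← hr, mem_sdiff, mem_union]
      tauto
    have hr2 : r ∈ S \ (A ∪ B) := by rw [hr]; exact mem_singleton_self r
    rw [mem_sdiff, mem_union] at hr2
    have hdis : ∀ v, v ∈ A → v ∉ B := fun v hv => Finset.disjoint_left.1 h.closed.disj hv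
    refine hno (insert r A) B ⟨⟨?_, h.closed.right, ?_, ?_⟩, h.tip_mem, ?_⟩ ?_
    · exact Finset.insert_subset hr2.1 h.closed.left
    · rw [Finset.disjoint_insert_left]
      exact ⟨by tauto, h.closed.disj⟩
    · intro f ha hb
      have h7 := h.closed.nbhd f ha hb
      have h8 := P.graph.ne f
      have h9 := hr1 _ ha
      have h10 := hr1 _ hb
      rw [mem_insert, mem_insert]
      constructor
      · rintro (h11 | h11)
        · by_contra h12
          have : b f ∉ A := fun h13 => hr2.2 (Or.inr (by rw [← h11]; exact h7.2 h13))
          exact h8 (h11.trans (h10 this h12).symm)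
        · exact h7.1 h11
      · rintro (h11 | h11)
        · by_contra h12
          have : a f ∉ A := fun h13 => hr2.2 (Or.inr (by rw [← h11]; exact h7.1 h13))
          exact h8 ((h9 this h12).trans h11.symm)
        · exact h7.2 h11
    · rw [Finset.card_insert_of_notMem (by tauto)]; omega
    · rw [Finset.card_insert_of_notMem (by tauto)]; omega
  · have h7 : (exits a b S B).card = 3 := by omega
    have h8 := Finset.eq_of_subset_of_card_le hsub (by rw [P.card_erase_erase hl hle]; omega)
    refine ⟨?_, ?_, by omega, by omega, by rw [Nat.odd_iff]; omega⟩
    · intro h9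
      have : e ∈ exits a b S B := mem_exits.2 ⟨P.mem, h9⟩
      rw [← h8] at this
      simp at this
    · intro h9
      have : l ∈ exits a b S B := mem_exits.2 ⟨hl, h9⟩
      rw [← h8] at this
      simp at this

theorem rest_inter_nonempty {l : E} {A B A' B' : Finset V}
    (h : Cert a b e S l A B) (hc : B.card = A.card + 2)
    (hno : ∀ A' B', Cert a b e S l A' B' → B'.card ≠ A'.card + 1)
    (hcut : (cut a b (S \ (A ∪ B))).card = 5) (hodd : Odd (S \ (A ∪ B)).card)
    (h' : Closed a b S A' B') (hi : (inner a b B').card = 0) :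
    ((S \ (A ∪ B)) \ (A' ∪ B')).Nonempty := by
  rw [Finset.nonempty_iff_ne_empty, Ne, Finset.sdiff_eq_empty_iff_subset]
  intro hsub
  set D := S \ (A ∪ B) with hD
  have hmD : ∀ v, v ∈ D ↔ v ∈ S ∧ v ∉ A ∧ v ∉ B := by
    intro v; rw [hD, mem_sdiff, mem_union, not_or]
  have hmD' : ∀ v, v ∈ D → v ∈ A' ∨ v ∈ B' := fun v hv => mem_union.1 (hsub hv)
  have hdis : ∀ v, v ∈ A → v ∉ B := fun v hv => Finset.disjoint_left.1 h.closed.disj hv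
  have hdis' : ∀ v, v ∈ A' → v ∉ B' := fun v hv => Finset.disjoint_left.1 h'.disj hv
  have hbi : ∀ f, a f ∈ S → b f ∈ S → (a f ∈ D ∨ b f ∈ D) → ¬(a f ∈ B' ↔ b f ∈ B') := by
    intro f ha hb hf
    refine h'.bichromatic hi ha hb ?_
    rcases hf with hf | hf
    · exact Or.inl (hsub hf)
    · exact Or.inr (hsub hf)
  have key := sum_cut_color P.graph.ne D B' (fun _ => (1 : ℝ)) 3
    (fun v => by rw [Finset.sum_const, P.graph.cubic]; norm_num)
    (fun f _ ha hb => hbi f ((hmD _).1 ha).1 ((hmD _).1 hb).1 (Or.inl ha))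
  have hbound : |∑ f ∈ cut a b D, (1 : ℝ) * (color D B' (a f) + color D B' (b f))| ≤ 5 := by
    have : (5 : ℝ) = ∑ f ∈ cut a b D, (1 : ℝ) := by simp [hcut]
    rw [this]
    refine (Finset.abs_sum_le_sum_abs _ _).trans (Finset.sum_le_sum fun f hf => ?_)
    have h1 := (mem_cut).1 hf
    unfold color
    by_cases c1 : a f ∈ D <;> by_cases c2 : b f ∈ D <;> simp [c1, c2] at h1 ⊢ <;> split_ifs <;>
      simp
  rw [key] at hbound
  rw [abs_le] at hbound
  have hcard : (D ∩ B').card + (D \ B').card = D.card := Finset.card_inter_add_card_sdiff _ _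
  have hlt : (D ∩ B').card < (D \ B').card + 2 ∧ (D \ B').card < (D ∩ B').card + 2 := by
    constructor
    · have h1 : ((D ∩ B').card : ℝ) < ((D \ B').card + 2 : ℕ) := by push_cast; linarith
      exact_mod_cast h1
    · have h1 : ((D \ B').card : ℝ) < ((D ∩ B').card + 2 : ℕ) := by push_cast; linarith
      exact_mod_cast h1
  rw [Nat.odd_iff] at hodd
  have hdA : Disjoint A D := Finset.disjoint_left.2 fun v hv hv' => ((hmD v).1 hv').2.1 hv
  have hdB : Disjoint B D := Finset.disjoint_left.2 fun v hv hv' => ((hmD v).1 hv').2.2 hv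
  have hDS : D ⊆ S := Finset.sdiff_subset
  have main : ∀ P' Q : Finset V, P' ⊆ D → Q ⊆ D → Disjoint P' Q → P'.card = Q.card + 1 →
      (∀ f, a f ∈ S → b f ∈ S → (a f ∈ P' → b f ∈ D → b f ∈ Q) ∧ (b f ∈ P' → a f ∈ D → a f ∈ Q)) →
      False := by
    intro P' Q hP hQ hPQ hcPQ hnb
    have e1 : (A ∪ P').card = A.card + P'.card :=
      Finset.card_union_of_disjoint (hdA.mono_right hP)
    have e2 : (B ∪ Q).card = B.card + Q.card := Finset.card_union_of_disjoint (hdB.mono_right hQ)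
    refine hno (A ∪ P') (B ∪ Q) ⟨⟨?_, ?_, ?_, ?_⟩, ?_, ?_⟩ ?_
    · exact Finset.union_subset h.closed.left (hP.trans hDS)
    · exact Finset.union_subset h.closed.right (hQ.trans hDS)
    · rw [Finset.disjoint_union_left, Finset.disjoint_union_right, Finset.disjoint_union_right]
      exact ⟨⟨h.closed.disj, hdA.mono_right hQ⟩, (hdB.mono_right hP).symm, hPQ⟩
    · intro f ha hb
      have h1 := h.closed.nbhd f ha hb
      have h2 := hnb f ha hb
      have h3 : ∀ p q, p ∈ S → q ∈ S → (p ∈ A → q ∈ B) → (q ∈ A → p ∈ B) →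
          (p ∈ P' → q ∈ D → q ∈ Q) → p ∈ A ∪ P' → q ∈ B ∪ Q := by
        intro p q hp hq h3 h4 h5 h6
        rw [mem_union] at h6 ⊢
        rcases h6 with h6 | h6
        · exact Or.inl (h3 h6)
        · by_cases h7 : q ∈ B
          · exact Or.inl h7
          · exact Or.inr (h5 h6 ((hmD q).2 ⟨hq, fun h8 => ((hmD p).1 (hP h6)).2.2 (h4 h8), h7⟩))
      exact ⟨h3 _ _ ha hb h1.1 h1.2 h2.1, h3 _ _ hb ha h1.2 h1.1 h2.2⟩
    · intro f hf hfe hfl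
      exact mem_union_left _ (h.tip_mem f hf hfe hfl)
    · omega
    · omega
  have hnb : ∀ f, a f ∈ S → b f ∈ S →
      (a f ∈ D → b f ∈ D → ¬(a f ∈ B' ↔ b f ∈ B')) := fun f ha hb h1 _ => hbi f ha hb (Or.inl h1)
  have hdPQ : Disjoint (D ∩ B') (D \ B') :=
    Finset.disjoint_left.2 fun v hv hv' => (mem_sdiff.1 hv').2 (mem_inter.1 hv).2
  rcases lt_or_gt_of_ne (show (D ∩ B').card ≠ (D \ B').card by omega) with h1 | h1
  · refine main _ _ Finset.sdiff_subset Finset.inter_subset_left hdPQ.symm (by omega) ?_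
    intro f ha hb
    have h2 := hnb f ha hb
    simp only [mem_sdiff, mem_inter]
    tauto
  · refine main _ _ Finset.inter_subset_left Finset.sdiff_subset hdPQ (by omega) ?_
    intro f ha hb
    have h2 := hnb f ha hb
    simp only [mem_sdiff, mem_inter]
    tauto

end Port

theorem card_cut_union {a b : E → V} {C R : Finset V} (hCR : Disjoint C R)
    (hsep : ∀ f, (a f ∈ C → b f ∉ R) ∧ (b f ∈ C → a f ∉ R)) :
    (cut a b (C ∪ R)).card = (cut a b C).card + (cut a b R).card := by
  have h0 : ∀ f, (a f ∈ C → a f ∉ R) ∧ (b f ∈ C → b f ∉ R) := fun f =>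
    ⟨fun h => Finset.disjoint_left.1 hCR h, fun h => Finset.disjoint_left.1 hCR h⟩
  rw [← Finset.card_union_of_disjoint]
  · congr 1
    ext f
    have h1 := hsep f
    have h2 := h0 f
    rw [mem_union, mem_cut, mem_cut, mem_cut, mem_union, mem_union]
    by_cases a f ∈ C <;> by_cases b f ∈ C <;> simp_all
  · rw [Finset.disjoint_left]
    intro f
    have h1 := hsep f
    have h2 := h0 f
    rw [mem_cut, mem_cut]
    by_cases a f ∈ C <;> by_cases b f ∈ C <;> simp_all

namespace Port

variable {a b : E → V} {e : E} {S : Finset V} (P : Port a b e S)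
include P

theorem colored_or_linked_of_tips {l l' : E} (hl : l ∈ cut a b S) (hl' : l' ∈ cut a b S)
    (hle : l ≠ e) (hle' : l' ≠ e) (hne : l ≠ l') {B C R : Finset V}
    (hR : R.Nonempty) (hRS : R ⊆ S) (hCS : C ⊆ S) (hCR : Disjoint C R)
    (hsep : ∀ f, (a f ∈ C → b f ∉ R) ∧ (b f ∈ C → a f ∉ R))
    (hcut : ((cut a b (C ∪ R)).card : ℤ) =
      11 - 2 * (exits a b S B).card - 2 * (inner a b B).card)
    (hbi : (inner a b B).card = 0 →
      ∀ f, a f ∈ S → b f ∈ S → (a f ∉ C ∪ R ∨ b f ∉ C ∪ R) → ¬(a f ∈ B ↔ b f ∈ B))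
    (htip : ∀ f ∈ cut a b S, f ≠ e → f ≠ l → f ≠ l' → tip a b S f ∈ B)
    (hte : tip a b S e ∉ B)
    (h1 : tip a b S l ∈ C ∨ tip a b S l ∈ B) (h2 : tip a b S l' ∈ C ∨ tip a b S l' ∈ B) :
    Colored a b e S ∨ ∃ k, Linked a b e S l l' k B := by
  have hadd := card_cut_union hCR hsep
  have hRr := (P.rest_le R hRS).resolve_left hR.ne_empty
  have hone : R.card = 1 → ∀ f, ¬(a f ∈ R ∧ b f ∈ R) := by
    intro h3 f h4
    obtain ⟨r, rfl⟩ := Finset.card_eq_one.1 h3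
    rw [mem_singleton, mem_singleton] at h4
    exact P.graph.ne f (h4.1.trans h4.2.symm)
  have hbi' : (inner a b B).card = 0 → R.card = 1 →
      ∀ f, a f ∈ S → b f ∈ S → ¬(a f ∈ C ∧ b f ∈ C) → ¬(a f ∈ B ↔ b f ∈ B) := by
    intro h3 h4 f ha hb hf
    refine hbi h3 f ha hb ?_
    by_contra h5
    push Not at h5
    rw [mem_union, mem_union] at h5
    rcases h5 with ⟨h6 | h6, h7 | h7⟩
    · exact hf ⟨h6, h7⟩
    · exact (hsep f).1 h6 h7
    · exact (hsep f).2 h7 h6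
    · exact hone h4 f ⟨h6, h7⟩
  have h3 := P.card_erase_three hl hl' hle hle' hne
  have h4 := P.erase_subset_exits htip
  have hmem' : l' ∈ ((cut a b S).erase e).erase l :=
    mem_erase.2 ⟨hne.symm, mem_erase.2 ⟨hle', hl'⟩⟩
  have hmem : l ∈ (cut a b S).erase e := mem_erase.2 ⟨hle, hl⟩
  by_cases c1 : tip a b S l ∈ B
  · by_cases c2 : tip a b S l' ∈ B
    · left
      have hB : ∀ f ∈ cut a b S, f ≠ e → tip a b S f ∈ B := by
        intro f hf hfe
        by_cases h5 : f = l
        · rwa [h5]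
        by_cases h6 : f = l'
        · rwa [h6]
        exact htip f hf hfe h5 h6
      have h5 : (cut a b S).erase e ⊆ exits a b S B := by
        intro f hf
        rw [mem_erase] at hf
        exact mem_exits.2 ⟨hf.2, hB f hf.2 hf.1⟩
      have h6 := Finset.card_le_card h5
      rw [Finset.card_erase_of_mem P.mem, P.card_cut] at h6
      have h7 := P.rest_le C hCS
      have h8 : C = ∅ := by
        rcases h7 with h7 | h7
        · exact h7
        · omega
      refine ⟨B, fun f ha hb => hbi' (by omega) (by omega) f ha hb ?_, hB⟩
      rw [h8]; simp
    · exfalso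
      have h5 := h2.resolve_right c2
      have h6 : insert l ((((cut a b S).erase e).erase l).erase l') ⊆ exits a b S B :=
        Finset.insert_subset (mem_exits.2 ⟨hl, c1⟩) h4
      have h7 := Finset.card_le_card h6
      rw [Finset.card_insert_of_notMem (by simp), h3] at h7
      have h8 := (P.rest_le C hCS).resolve_left (Finset.Nonempty.ne_empty ⟨_, h5⟩)
      omega
  · by_cases c2 : tip a b S l' ∈ B
    · exfalso
      have h5 := h1.resolve_right c1
      have h6 : insert l' ((((cut a b S).erase e).erase l).erase l') ⊆ exits a b S B :=
        Finset.insert_subset (mem_exits.2 ⟨hl', c2⟩) h4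
      have h7 := Finset.card_le_card h6
      rw [Finset.card_insert_of_notMem (by simp), h3] at h7
      have h8 := (P.rest_le C hCS).resolve_left (Finset.Nonempty.ne_empty ⟨_, h5⟩)
      omega
    · right
      have h5 := h1.resolve_right c1
      have h6 := h2.resolve_right c2
      have h7 := Finset.card_le_card h4
      have h8 := (P.rest_le C hCS).resolve_left (Finset.Nonempty.ne_empty ⟨_, h5⟩)
      have h9 : 1 < C.card := Finset.one_lt_card.2
        ⟨_, h5, _, h6, fun h => hne (P.inj l hl l' hl' h)⟩
      exact P.exists_linked hl hl' hle hle' hne (by omega) (by omega) h5 h6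
        (hbi' (by omega) (by omega)) htip c1 c2 hte

theorem colored_or_linked_of_certs {l l' : E} (hl : l ∈ cut a b S) (hl' : l' ∈ cut a b S)
    (hle : l ≠ e) (hle' : l' ≠ e) (hne : l ≠ l') {A B A' B' : Finset V}
    (h : Cert a b e S l A B) (h' : Cert a b e S l' A' B')
    (hs : B.card = A.card + 2 → ∀ A₀ B₀, Cert a b e S l A₀ B₀ → B₀.card ≠ A₀.card + 1)
    (hs' : B'.card = A'.card + 2 → ∀ A₀ B₀, Cert a b e S l' A₀ B₀ → B₀.card ≠ A₀.card + 1) :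
    Colored a b e S ∨ ∃ k B₀, Linked a b e S l l' k B₀ := by
  have hdis : ∀ v, v ∈ A → v ∉ B := fun v hv => Finset.disjoint_left.1 h.closed.disj hv
  have hdis' : ∀ v, v ∈ A' → v ∉ B' := fun v hv => Finset.disjoint_left.1 h'.closed.disj hv
  have htl : tip a b S l ∈ B' := h'.tip_mem l hl hle hne
  have htl' : tip a b S l' ∈ B := h.tip_mem l' hl' hle' hne.symm
  have t1 : ∀ f ∈ cut a b S, f ≠ e → f ≠ l → f ≠ l' →
      tip a b S f ∈ (B ∪ B') \ (A ∪ A') := by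
    intro f hf h1 h2 h3
    have h4 := h.tip_mem f hf h1 h2
    have h5 := h'.tip_mem f hf h1 h3
    rw [mem_sdiff, mem_union, mem_union]
    exact ⟨Or.inl h4, fun h6 => h6.elim (fun h7 => hdis _ h7 h4) fun h7 => hdis' _ h7 h5⟩
  have t2 : ∀ f ∈ cut a b S, f ≠ e → f ≠ l → f ≠ l' → tip a b S f ∈ B ∩ B' := by
    intro f hf h1 h2 h3
    exact mem_inter.2 ⟨h.tip_mem f hf h1 h2, h'.tip_mem f hf h1 h3⟩
  have k1 := h.closed.union h'.closed
  have k2 := h.closed.inter h'.closed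
  have hcard := card_uncross h.closed.disj h'.closed.disj
  have h3 := P.card_erase_three hl hl' hle hle' hne
  have h4 := Finset.card_le_card (P.erase_subset_exits t1)
  have h5 := Finset.card_le_card (P.erase_subset_exits t2)
  have m1 := (P.rest_cases k1 (by omega)).1
  have m2 := (P.rest_cases k2 (by omega)).1
  by_cases c1 : ((B ∪ B') \ (A ∪ A')).card = ((A ∪ A') \ (B ∪ B')).card + 1
  · refine (P.colored_or_linked hl hl' hle hle' hne k1 t1 ?_ ?_ c1).imp_right
      fun ⟨k, hk⟩ => ⟨k, _, hk⟩
    · exact fun h6 => (mem_sdiff.1 h6).2 (mem_union_right _ htl)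
    · exact fun h6 => (mem_sdiff.1 h6).2 (mem_union_left _ htl')
  by_cases c2 : (B ∩ B').card = (A ∩ A').card + 1
  · refine (P.colored_or_linked hl hl' hle hle' hne k2 t2 ?_ ?_ c2).imp_right
      fun ⟨k, hk⟩ => ⟨k, _, hk⟩
    · exact fun h6 => hdis' _ (mem_inter.1 h6).2 htl
    · exact fun h6 => hdis _ (mem_inter.1 h6).1 htl'
  have h6 := h.card_le
  have h6' := h'.card_le
  have e1 : B.card = A.card + 2 := by omega
  have e1' : B'.card = A'.card + 2 := by omega
  obtain ⟨f1, f2, f3, f4, f5⟩ := P.cert_facts hl hle h e1 (hs e1)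
  obtain ⟨g1, g2, g3, g4, g5⟩ := P.cert_facts hl' hle' h' e1' (hs' e1')
  have hR := P.rest_inter_nonempty h e1 (hs e1) f4 f5 h'.closed g3
  have hDeq : S \ ((A ∪ A') \ (B ∪ B') ∪ (B ∪ B') \ (A ∪ A')) =
      ((A ∩ B') ∪ (A' ∩ B)) ∪ (S \ (A ∪ B)) \ (A' ∪ B') := by
    ext v
    have a1 := hdis v
    have a2 := hdis' v
    have a3 := @h.closed.left v
    have a4 := @h'.closed.left v
    simp only [mem_sdiff, mem_union, mem_inter]
    by_cases v ∈ A <;> by_cases v ∈ A' <;> by_cases v ∈ B <;> by_cases v ∈ B' <;> simp_all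
  have hcut := P.card_cut_rest k1
  rw [hDeq] at hcut
  refine (P.colored_or_linked_of_tips hl hl' hle hle' hne hR (Finset.sdiff_subset.trans
    Finset.sdiff_subset) (C := (A ∩ B') ∪ (A' ∩ B)) ?_ ?_ ?_ (by rw [hcut]; omega) ?_ t1 ?_ ?_
    ?_).imp_right fun ⟨k, hk⟩ => ⟨k, _, hk⟩
  · exact Finset.union_subset (Finset.inter_subset_left.trans h.closed.left)
      (Finset.inter_subset_left.trans h'.closed.left)
  · rw [Finset.disjoint_left]
    rintro v hv hv'
    rw [mem_sdiff, mem_sdiff, mem_union, mem_union] at hv'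
    rcases mem_union.1 hv with h7 | h7
    · exact hv'.1.2 (Or.inl (mem_inter.1 h7).1)
    · exact hv'.2 (Or.inl (mem_inter.1 h7).1)
  · intro f
    have hn : ∀ p q, (p ∈ S → q ∈ S → p ∈ A → q ∈ B) → (p ∈ S → q ∈ S → p ∈ A' → q ∈ B') →
        p ∈ (A ∩ B') ∪ (A' ∩ B) → q ∉ (S \ (A ∪ B)) \ (A' ∪ B') := by
      intro p q h7 h8 h9 h10
      simp only [mem_sdiff, mem_union, mem_inter, not_or] at h9 h10
      rcases h9 with h9 | h9
      · exact h10.1.2.2 (h7 (h.closed.left h9.1) h10.1.1 h9.1)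
      · exact h10.2.2 (h8 (h'.closed.left h9.1) h10.1.1 h9.1)
    exact ⟨hn _ _ (fun p q => (h.closed.nbhd f p q).1) fun p q => (h'.closed.nbhd f p q).1,
      hn _ _ (fun p q => (h.closed.nbhd f q p).2) fun p q => (h'.closed.nbhd f q p).2⟩
  · intro h7 f ha hb hf
    refine k1.bichromatic h7 ha hb ?_
    rw [← hDeq, mem_sdiff, mem_sdiff] at hf
    tauto
  · intro h7
    rw [mem_sdiff, mem_union] at h7
    tauto
  · have h7 : tip a b S l ∉ A' := fun h8 => hdis' _ h8 htl
    by_cases h8 : tip a b S l ∈ A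
    · exact Or.inl (mem_union_left _ (mem_inter.2 ⟨h8, htl⟩))
    · exact Or.inr (mem_sdiff.2 ⟨mem_union_right _ htl, fun h9 => (mem_union.1 h9).elim h8 h7⟩)
  · have h7 : tip a b S l' ∉ A := fun h8 => hdis _ h8 htl'
    by_cases h8 : tip a b S l' ∈ A'
    · exact Or.inl (mem_union_right _ (mem_inter.2 ⟨h8, htl'⟩))
    · exact Or.inr (mem_sdiff.2 ⟨mem_union_left _ htl', fun h9 => (mem_union.1 h9).elim h7 h8⟩)

/-- A certificate with the smallest possible excess. -/
theorem exists_optimal_cert {l : E} {A B : Finset V} (h : Cert a b e S l A B) :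
    ∃ A B, Cert a b e S l A B ∧ (B.card = A.card + 2 →
      ∀ A₀ B₀, Cert a b e S l A₀ B₀ → B₀.card ≠ A₀.card + 1) := by
  by_cases h1 : ∃ A₀ B₀, Cert a b e S l A₀ B₀ ∧ B₀.card = A₀.card + 1
  · obtain ⟨A₀, B₀, h2, h3⟩ := h1
    exact ⟨A₀, B₀, h2, fun h4 => by omega⟩
  · push Not at h1
    exact ⟨A, B, h, fun _ => h1⟩

end Port

/-- The vertices of `S` that are not ends of edges other than `e` and `l` leaving `S`. -/
def core (a b : E → V) (e : E) (S : Finset V) (l : E) : Finset V :=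
  S \ (((cut a b S).erase e).erase l).image (tip a b S)

namespace Port

variable {a b : E → V} {e : E} {S : Finset V} (P : Port a b e S)
include P

theorem card_core {l : E} (hl : l ∈ cut a b S) (hle : l ≠ e) :
    (((cut a b S).erase e).erase l |>.image (tip a b S)).card = 3 ∧
      (core a b e S l).card + 3 = S.card := by
  have h1 : (((cut a b S).erase e).erase l |>.image (tip a b S)).card = 3 := by
    rw [Finset.card_image_of_injOn, P.card_erase_erase hl hle]
    intro f hf g hg hfg
    rw [mem_coe, mem_erase, mem_erase] at hf hg
    exact P.inj f hf.2.2 g hg.2.2 hfg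
  have h2 : (((cut a b S).erase e).erase l).image (tip a b S) ⊆ S := by
    intro v hv
    obtain ⟨f, hf, rfl⟩ := mem_image.1 hv
    rw [mem_erase, mem_erase] at hf
    exact tip_mem hf.2.2
  have h3 := Finset.card_sdiff_add_card_eq_card h2
  exact ⟨h1, by rw [h1] at h3; exact h3⟩

theorem matching_or_cert {l : E} (hl : l ∈ cut a b S) (hle : l ≠ e) :
    (∃ M : Finset E, (∀ f ∈ M, a f ∈ core a b e S l ∧ b f ∈ core a b e S l) ∧
      ∀ v ∈ core a b e S l, (M ∩ cut a b {v}).card = 1) ∨ ∃ A B, Cert a b e S l A B := by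
  obtain ⟨hW, hU⟩ := P.card_core hl hle
  have hUS : core a b e S l ⊆ S := Finset.sdiff_subset
  rcases exists_matching_or_tutte_set a b (core a b e S l) (fun _ => True) with
    ⟨M, h1, h2⟩ | ⟨B₀, Ks, hB₀, hK, hpd, hnb, hlt, hpar⟩
  · exact Or.inl ⟨M, fun f hf => (h1 f hf).2.2, h2⟩
  right
  set W := (((cut a b S).erase e).erase l).image (tip a b S) with hWdef
  set U := core a b e S l with hUdef
  have hUW : ∀ v, v ∈ U ↔ v ∈ S ∧ v ∉ W := by intro v; rw [hUdef, core, mem_sdiff]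
  have hW_sub : W ⊆ S := by
    intro v hv
    obtain ⟨f, hf, rfl⟩ := mem_image.1 hv
    rw [mem_erase, mem_erase] at hf
    exact tip_mem hf.2.2
  have hBW : Disjoint B₀ W :=
    Finset.disjoint_left.2 fun v hv hv' => ((hUW v).1 (hB₀ hv)).2 hv'
  have hBcard : (B₀ ∪ W).card = B₀.card + 3 := by
    rw [Finset.card_union_of_disjoint hBW, hW]
  have hKU : ∀ K ∈ Ks, ∀ v ∈ K, v ∈ U ∧ v ∉ B₀ ∪ W := by
    intro K hK' v hv
    have h1 := mem_sdiff.1 ((hK K hK').2 hv)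
    refine ⟨h1.1, fun h2 => (mem_union.1 h2).elim h1.2 ((hUW v).1 h1.1).2⟩
  have htipW : ∀ f ∈ cut a b S, f ≠ e → f ≠ l → tip a b S f ∈ B₀ ∪ W := by
    intro f hf h1 h2
    exact mem_union_right _ (mem_image_of_mem _ (mem_erase.2 ⟨h2, mem_erase.2 ⟨h1, hf⟩⟩))
  have hexits : 3 ≤ (exits a b S (B₀ ∪ W)).card := by
    rw [← P.card_erase_erase hl hle]
    refine Finset.card_le_card fun f hf => ?_
    rw [mem_erase, mem_erase] at hf
    exact mem_exits.2 ⟨hf.2.2, htipW f hf.2.2 hf.2.1 hf.1⟩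
  have hother : ∀ K ∈ Ks, ∀ f, (a f ∈ K → b f ∉ K → b f ∉ U \ B₀ ∧ (b f ∈ B₀ ∪ W ∨ b f ∉ S)) ∧
      (b f ∈ K → a f ∉ K → a f ∉ U \ B₀ ∧ (a f ∈ B₀ ∪ W ∨ a f ∉ S)) := by
    intro K hK' f
    have h1 := hnb K hK' f trivial
    have aux : ∀ p q, (p ∈ U → q ∈ U → p ∈ K → q ∈ K ∪ B₀) → p ∈ K → q ∉ K →
        q ∉ U \ B₀ ∧ (q ∈ B₀ ∪ W ∨ q ∉ S) := by
      intro p q h2 h3 h4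
      by_cases h5 : q ∈ U
      · have h6 := (mem_union.1 (h2 (hKU K hK' p h3).1 h5 h3)).resolve_left h4
        exact ⟨fun h7 => (mem_sdiff.1 h7).2 h6, Or.inl (mem_union_left _ h6)⟩
      · refine ⟨fun h7 => h5 (mem_sdiff.1 h7).1, ?_⟩
        by_cases h6 : q ∈ S
        · refine Or.inl (mem_union_right _ ?_)
          by_contra h7
          exact h5 ((hUW q).2 ⟨h6, h7⟩)
        · exact Or.inr h6
    exact ⟨aux _ _ fun p q => (h1 p q).1, aux _ _ fun p q => (h1 q p).2⟩
  have hsum : (∑ K ∈ Ks, (cut a b K).card : ℤ) ≤ 3 * (B₀ ∪ W).card + 5 -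
      2 * (exits a b S (B₀ ∪ W)).card := by
    have h1 : (3 * (B₀ ∪ W).card : ℤ) =
        ∑ f, ((if a f ∈ B₀ ∪ W then 1 else 0) + (if b f ∈ B₀ ∪ W then 1 else 0)) := by
      rw [P.graph.sum_ends fun v => if v ∈ B₀ ∪ W then 1 else 0, Finset.sum_boole,
        Finset.filter_mem_eq_inter, Finset.univ_inter]
    have h2 : (5 : ℤ) = ∑ f, if f ∈ cut a b S then 1 else 0 := by
      rw [Finset.sum_boole, Finset.filter_mem_eq_inter, Finset.univ_inter, P.card_cut]; rfl
    have h3 : ((exits a b S (B₀ ∪ W)).card : ℤ) =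
        ∑ f, if f ∈ exits a b S (B₀ ∪ W) then 1 else 0 := by
      rw [Finset.sum_boole, Finset.filter_mem_eq_inter, Finset.univ_inter]
    have h4 : (∑ K ∈ Ks, (cut a b K).card : ℤ) =
        ∑ f, ((Ks.filter fun K => f ∈ cut a b K).card : ℤ) := by
      have h5 : ∀ K, ((cut a b K).card : ℤ) = ∑ f, if f ∈ cut a b K then 1 else 0 := by
        intro K
        rw [Finset.sum_boole, Finset.filter_mem_eq_inter, Finset.univ_inter]
      simp_rw [h5]
      rw [Finset.sum_comm]
      simp_rw [Finset.sum_boole]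
    rw [h1, h2, h3, h4, Finset.mul_sum, ← Finset.sum_add_distrib, ← Finset.sum_sub_distrib]
    refine Finset.sum_le_sum fun f _ => ?_
    rcases Finset.eq_empty_or_nonempty (Ks.filter fun K => f ∈ cut a b K) with h5 | ⟨K, h5⟩
    · rw [h5, Finset.card_empty]
      by_cases h6 : f ∈ exits a b S (B₀ ∪ W)
      · have h7 := mem_exits.1 h6
        have h8 : a f ∈ B₀ ∪ W ∨ b f ∈ B₀ ∪ W := by
          rcases tip_eq a b S f with h8 | h8
          · exact Or.inl (h8 ▸ h7.2)
          · exact Or.inr (h8 ▸ h7.2)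
        rw [if_pos h6, if_pos h7.1]
        rcases h8 with h8 | h8 <;> rw [if_pos h8] <;> split_ifs <;> simp
      · rw [if_neg h6]
        split_ifs <;> simp
    · obtain ⟨hK1, hK2⟩ := mem_filter.1 h5
      have hle : (Ks.filter fun K => f ∈ cut a b K).card ≤ 1 ∧ f ∉ exits a b S (B₀ ∪ W) ∧
          (a f ∈ B₀ ∪ W ∨ b f ∈ B₀ ∪ W ∨ f ∈ cut a b S) := by
        have aux : ∀ p q, p ∈ K → (q ∉ U \ B₀ ∧ (q ∈ B₀ ∪ W ∨ q ∉ S)) →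
            (∀ K', f ∈ cut a b K' → p ∈ K' ∨ q ∈ K') →
            (f ∈ cut a b S → p ∈ S → q ∉ S → tip a b S f = p) → (p ∈ S → q ∉ S → f ∈ cut a b S) →
            (f ∈ cut a b S → ¬ (p ∈ S ↔ q ∈ S)) →
            (Ks.filter fun K => f ∈ cut a b K).card ≤ 1 ∧ f ∉ exits a b S (B₀ ∪ W) ∧
              (q ∈ B₀ ∪ W ∨ f ∈ cut a b S) := by
          intro p q hp hq h6 h7 h8 h9
          have hpS := hUS (hKU K hK1 p hp).1
          refine ⟨?_, ?_, hq.2.imp_right fun h => h8 hpS h⟩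
          · rw [Finset.card_le_one_iff_subset_singleton]
            refine ⟨K, fun K' hK' => ?_⟩
            rw [mem_filter] at hK'
            rw [mem_singleton]
            by_contra hne
            have h10 := Finset.disjoint_left.1 (hpd hK'.1 hK1 hne)
            rcases h6 K' hK'.2 with h11 | h11
            · exact h10 h11 hp
            · exact hq.1 ((hK K' hK'.1).2 h11)
          · intro h10
            rw [mem_exits] at h10
            have h11 : q ∉ S := fun h12 => h9 h10.1 ⟨fun _ => h12, fun _ => hpS⟩
            rw [h7 h10.1 hpS h11] at h10
            exact (hKU K hK1 p hp).2 h10.2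
        have hcutor : ∀ K', f ∈ cut a b K' → a f ∈ K' ∨ b f ∈ K' := by
          intro K' h6
          rw [mem_cut] at h6
          by_contra h7
          push Not at h7
          exact h6 ⟨fun h => absurd h h7.1, fun h => absurd h h7.2⟩
        rcases hcutor K hK2 with h6 | h6
        · have h7 : b f ∉ K := fun h7 => mem_cut.1 hK2 ⟨fun _ => h7, fun _ => h6⟩
          have h8 := aux _ _ h6 ((hother K hK1 f).1 h6 h7) hcutor
            (fun _ h _ => by rw [tip, if_pos h])
            (fun h h' => mem_cut.2 fun h'' => h' (h''.1 h)) (fun h => mem_cut.1 h)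
          exact ⟨h8.1, h8.2.1, Or.inr h8.2.2⟩
        · have h7 : a f ∉ K := fun h7 => mem_cut.1 hK2 ⟨fun _ => h6, fun _ => h7⟩
          have h8 := aux _ _ h6 ((hother K hK1 f).2 h6 h7) (fun K' h => (hcutor K' h).symm)
            (fun _ _ h => by rw [tip, if_neg h])
            (fun h h' => mem_cut.2 fun h'' => h' (h''.2 h))
            (fun h h' => mem_cut.1 h ⟨h'.2, h'.1⟩)
          exact ⟨h8.1, h8.2.1, h8.2.2.imp_right Or.inr⟩
      obtain ⟨h6, h7, h8⟩ := hle
      rw [if_neg h7]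
      have h9 : ((Ks.filter fun K => f ∈ cut a b K).card : ℤ) ≤ 1 := by exact_mod_cast h6
      split_ifs <;> first | omega | tauto
  have hsmall : (∑ K ∈ Ks, (3 + if K.card = 1 then 0 else 2) : ℤ) ≤
      ∑ K ∈ Ks, ((cut a b K).card : ℤ) := by
    refine Finset.sum_le_sum fun K hK' => ?_
    have h1 := (hK K hK').1
    have h2 := (P.rest_le K fun v hv => hUS (hKU K hK' v hv).1).resolve_left
      (Finset.card_pos.1 h1.pos).ne_empty
    rw [Nat.odd_iff] at h1
    split_ifs <;> omega
  set A := univ.filter fun v : V => ({v} : Finset V) ∈ Ks with hA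
  have hmA : ∀ v, v ∈ A ↔ ({v} : Finset V) ∈ Ks := by intro v; simp [hA]
  have hAcard : A.card = (Ks.filter fun K => K.card = 1).card := by
    rw [← Finset.card_map ⟨fun v : V => ({v} : Finset V), Finset.singleton_injective⟩]
    congr 1
    ext K
    rw [mem_map, mem_filter]
    constructor
    · rintro ⟨v, hv, rfl⟩
      exact ⟨(hmA v).1 hv, Finset.card_singleton v⟩
    · rintro ⟨h1, h2⟩
      obtain ⟨v, rfl⟩ := Finset.card_eq_one.1 h2
      exact ⟨v, (hmA v).2 h1, rfl⟩
  have hsplit := Finset.card_filter_add_card_filter_not (s := Ks) (fun K => K.card = 1)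
  have hsm : (∑ K ∈ Ks, (3 + if K.card = 1 then 0 else 2) : ℤ) =
      3 * Ks.card + 2 * (Ks.filter fun K => ¬K.card = 1).card := by
    rw [Finset.sum_add_distrib, Finset.sum_const, nsmul_eq_mul, Finset.sum_ite,
      Finset.sum_const_zero, Finset.sum_const, nsmul_eq_mul]
    ring
  have hodd := P.odd
  have hKsB : Ks.card ≥ B₀.card + 2 := by
    rw [Nat.odd_iff] at hodd
    simp only [Nat.odd_iff] at hpar
    omega
  have hAU : ∀ v ∈ A, v ∈ U ∧ v ∉ B₀ ∪ W :=
    fun v hv => hKU _ ((hmA v).1 hv) v (mem_singleton_self v)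
  refine ⟨A, B₀ ∪ W, ⟨fun v hv => hUS (hAU v hv).1, Finset.union_subset (hB₀.trans hUS) hW_sub,
    Finset.disjoint_left.2 fun v hv => (hAU v hv).2, ?_⟩, htipW, by omega⟩
  intro f ha hb
  have hne := P.graph.ne f
  constructor
  · intro h1
    exact (((hother _ ((hmA _).1 h1) f).1 (mem_singleton_self _)
      (by rw [mem_singleton]; exact hne.symm)).2).resolve_right (not_not.2 hb)
  · intro h1
    exact (((hother _ ((hmA _).1 h1) f).2 (mem_singleton_self _)
      (by rw [mem_singleton]; exact hne)).2).resolve_right (not_not.2 ha)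

end Port

namespace Linked

variable {a b : E → V} {e : E} {S : Finset V} {l l' k : E} {B : Finset V}

theorem symm (h : Linked a b e S l l' k B) : Linked a b e S l' l k B :=
  ⟨h.mem', h.mem, h.ne_e', h.ne_e, h.ne.symm, h.star', h.star, h.bichromatic,
    fun f hf h1 h2 h3 => h.tip_mem f hf h1 h3 h2, h.tip_notMem', h.tip_notMem, h.tip_e⟩

end Linked

namespace Port

variable {a b : E → V} {e : E} {S : Finset V} (P : Port a b e S)
include P

theorem ends_of_linked {l l' k : E} {B : Finset V} (h : Linked a b e S l l' k B) :
    a k = tip a b S l ∧ b k = tip a b S l' ∨ a k = tip a b S l' ∧ b k = tip a b S l := by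
  have h1 : tip a b S l ≠ tip a b S l' := fun h1 => h.ne (P.inj l h.mem l' h.mem' h1)
  have h2 := P.graph.mem_star.1 h.star
  have h3 := P.graph.mem_star.1 h.star'
  rcases h2 with h2 | h2 <;> rcases h3 with h3 | h3
  · exact absurd (h2.symm.trans h3) h1
  · exact Or.inl ⟨h2, h3⟩
  · exact Or.inr ⟨h3, h2⟩
  · exact absurd (h2.symm.trans h3) h1

theorem eq_of_mem_stars_tip {l l' l'' k : E} (hl : l ∈ cut a b S) (hl' : l' ∈ cut a b S)
    (hl'' : l'' ∈ cut a b S) (h1 : k ∈ cut a b {tip a b S l}) (h2 : k ∈ cut a b {tip a b S l'})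
    (h3 : k ∈ cut a b {tip a b S l''}) : l = l' ∨ l = l'' ∨ l' = l'' := by
  rw [P.graph.mem_star] at h1 h2 h3
  by_contra h4
  push Not at h4
  have h5 := mt (P.inj l hl l' hl') h4.1
  have h6 := mt (P.inj l hl l'' hl'') h4.2.1
  have h7 := mt (P.inj l' hl' l'' hl'') h4.2.2
  rcases h1 with h1 | h1 <;> rcases h2 with h2 | h2 <;> rcases h3 with h3 | h3 <;>
    rw [h1] at * <;> simp_all

/-- The edges leaving `S` for which the corresponding matching of `S` is obstructed. -/
theorem card_obstructed_le (hC : ¬Colored a b e S) :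
    (((cut a b S).erase e).filter fun l => ∃ A B, Cert a b e S l A B).card ≤ 2 ∧
      ∀ l ∈ ((cut a b S).erase e).filter fun l => ∃ A B, Cert a b e S l A B,
      ∀ l' ∈ ((cut a b S).erase e).filter fun l => ∃ A B, Cert a b e S l A B, l ≠ l' →
        ∃ k B, Linked a b e S l l' k B := by
  have hlink : ∀ l ∈ ((cut a b S).erase e).filter fun l => ∃ A B, Cert a b e S l A B,
      ∀ l' ∈ ((cut a b S).erase e).filter fun l => ∃ A B, Cert a b e S l A B, l ≠ l' →
        ∃ k B, Linked a b e S l l' k B := by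
    intro l hl l' hl' hne
    rw [mem_filter, mem_erase] at hl hl'
    obtain ⟨⟨hle, hl⟩, A, B, h⟩ := hl
    obtain ⟨⟨hle', hl'⟩, A', B', h'⟩ := hl'
    obtain ⟨A, B, h, hs⟩ := P.exists_optimal_cert h
    obtain ⟨A', B', h', hs'⟩ := P.exists_optimal_cert h'
    exact (P.colored_or_linked_of_certs hl hl' hle hle' hne h h' hs hs').resolve_left hC
  refine ⟨?_, hlink⟩
  by_contra hcard
  rw [not_le, Finset.two_lt_card] at hcard
  obtain ⟨l₁, h₁, l₂, h₂, l₃, h₃, n₁₂, n₁₃, n₂₃⟩ := hcard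
  obtain ⟨k₁, B₁, g₁⟩ := hlink l₁ h₁ l₂ h₂ n₁₂
  obtain ⟨k₂, B₂, g₂⟩ := hlink l₁ h₁ l₃ h₃ n₁₃
  obtain ⟨k₃, B₃, g₃⟩ := hlink l₂ h₂ l₃ h₃ n₂₃
  have d₁ : k₁ ≠ k₂ := by
    rintro rfl
    have := P.eq_of_mem_stars_tip g₁.mem g₁.mem' g₂.mem' g₁.star g₁.star' g₂.star'
    tauto
  have d₂ : k₁ ≠ k₃ := by
    rintro rfl
    have := P.eq_of_mem_stars_tip g₁.mem g₁.mem' g₃.mem' g₁.star g₁.star' g₃.star'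
    tauto
  have d₃ : k₂ ≠ k₃ := by
    rintro rfl
    have := P.eq_of_mem_stars_tip g₁.mem g₁.mem' g₃.mem' g₂.star g₃.star g₃.star'
    tauto
  set T : Finset V := {tip a b S l₁, tip a b S l₂, tip a b S l₃} with hT
  have hTcard : T.card = 3 := by
    rw [hT, Finset.card_eq_three]
    exact ⟨_, _, _, fun h => n₁₂ (P.inj _ g₁.mem _ g₁.mem' h),
      fun h => n₁₃ (P.inj _ g₂.mem _ g₂.mem' h), fun h => n₂₃ (P.inj _ g₃.mem _ g₃.mem' h), rfl⟩
  have hTS : T ⊆ S := by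
    intro v hv
    rw [hT, mem_insert, mem_insert, mem_singleton] at hv
    rcases hv with rfl | rfl | rfl
    · exact tip_mem g₁.mem
    · exact tip_mem g₁.mem'
    · exact tip_mem g₂.mem'
  have h4 := P.graph.subset_cut hTS P.three_le_compl (Finset.card_pos.1 (by omega))
  have h5 := three_mul_card P.graph T
  have hin : ∀ l l' k B, Linked a b e S l l' k B → tip a b S l ∈ T → tip a b S l' ∈ T →
      k ∈ univ.filter fun f => a f ∈ T ∧ b f ∈ T := by
    intro l l' k B h h6 h7
    rw [mem_filter]
    rcases P.ends_of_linked h with ⟨h8, h9⟩ | ⟨h8, h9⟩ <;> rw [h8, h9] <;> simp [h6, h7]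
  have h6 : 2 < (univ.filter fun f => a f ∈ T ∧ b f ∈ T).card :=
    Finset.two_lt_card.2 ⟨k₁, hin _ _ _ _ g₁ (by simp [hT]) (by simp [hT]),
      k₂, hin _ _ _ _ g₂ (by simp [hT]) (by simp [hT]),
      k₃, hin _ _ _ _ g₃ (by simp [hT]) (by simp [hT]), d₁, d₂, d₃⟩
  omega

theorem glue {l : E} {M M' : Finset E}
    (hM : ∀ f ∈ M, a f ∈ core a b e S l ∧ b f ∈ core a b e S l)
    (hcov : ∀ v ∈ core a b e S l, (M ∩ cut a b {v}).card = 1)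
    (hM' : ∀ f ∈ M', a f ∉ S ∧ b f ∉ S) {v : V} (hv : v ∈ S) :
    ((M ∪ (M' ∪ ((cut a b S).erase e).erase l)) ∩ cut a b {v}).card = 1 := by
  have hM'v : ∀ f ∈ M', f ∉ cut a b {v} := by
    intro f hf h
    have h1 := hM' f hf
    rcases P.graph.mem_star.1 h with h2 | h2
    · exact h1.1 (h2 ▸ hv)
    · exact h1.2 (h2 ▸ hv)
  have hW : ∀ f ∈ ((cut a b S).erase e).erase l, f ∈ cut a b {v} → tip a b S f = v := by
    intro f hf h
    rw [mem_erase, mem_erase] at hf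
    rcases tip_cases hf.2.2 with ⟨h1, h2, -⟩ | ⟨h1, h2, -⟩ <;>
      rcases P.graph.mem_star.1 h with h3 | h3
    · exact h1.symm.trans h3
    · exact absurd (h3 ▸ hv) h2
    · exact absurd (h3 ▸ hv) h2
    · exact h1.symm.trans h3
  by_cases hc : v ∈ core a b e S l
  · rw [← hcov v hc]
    congr 1
    ext f
    simp only [mem_inter, mem_union]
    constructor
    · rintro ⟨h1 | h1 | h1, h2⟩
      · exact ⟨h1, h2⟩
      · exact absurd h2 (hM'v f h1)
      · refine absurd (mem_image.2 ⟨f, h1, hW f h1 h2⟩) ?_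
        rw [core, mem_sdiff] at hc
        exact hc.2
    · exact fun h => ⟨Or.inl h.1, h.2⟩
  · have h1 : v ∈ (((cut a b S).erase e).erase l).image (tip a b S) := by
      by_contra h1
      exact hc (mem_sdiff.2 ⟨hv, h1⟩)
    obtain ⟨g, hg, hgv⟩ := mem_image.1 h1
    rw [Finset.card_eq_one]
    refine ⟨g, ?_⟩
    ext f
    simp only [mem_inter, mem_union, mem_singleton]
    constructor
    · rintro ⟨h2 | h2 | h2, h3⟩
      · have h4 := hM f h2
        rcases P.graph.mem_star.1 h3 with h5 | h5
        · exact absurd (h5 ▸ h4.1) hc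
        · exact absurd (h5 ▸ h4.2) hc
      · exact absurd h3 (hM'v f h2)
      · have h4 := hW f h2 h3
        rw [mem_erase, mem_erase] at hg h2
        exact P.inj f h2.2.2 g hg.2.2 (h4.trans hgv.symm)
    · rintro rfl
      refine ⟨Or.inr (Or.inr hg), ?_⟩
      rw [← hgv]
      exact P.graph.mem_star_tip S f

theorem cert_or_cert (P' : Port a b e Sᶜ)
    (hpm : ∀ M, IsPM a b M → e ∉ M → (M ∩ cut a b S).card = 1) {l : E} (hl : l ∈ cut a b S)
    (hle : l ≠ e) : (∃ A B, Cert a b e S l A B) ∨ ∃ A B, Cert a b e Sᶜ l A B := by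
  rcases P.matching_or_cert hl hle with ⟨M, hM, hcov⟩ | h
  swap
  · exact Or.inl h
  rcases P'.matching_or_cert (by rwa [cut_compl]) hle with ⟨M', hM', hcov'⟩ | h
  swap
  · exact Or.inr h
  exfalso
  have hcore : ∀ (R : Finset V) v, v ∈ core a b e R l → v ∈ R := fun R v hv => (mem_sdiff.1 hv).1
  have hne : ∀ f ∈ M ∪ (M' ∪ ((cut a b S).erase e).erase l), f ≠ e := by
    rintro f hf rfl
    rw [mem_union, mem_union] at hf
    rcases hf with hf | hf | hf
    · have h1 := hM f hf
      exact mem_cut.1 P.mem ⟨fun _ => hcore _ _ h1.2, fun _ => hcore _ _ h1.1⟩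
    · have h1 := hM' f hf
      exact mem_cut.1 P'.mem ⟨fun _ => hcore _ _ h1.2, fun _ => hcore _ _ h1.1⟩
    · simp at hf
  have h1 := hpm (M ∪ (M' ∪ ((cut a b S).erase e).erase l)) ⟨fun f _ => P.graph.ne f, ?_⟩
    fun h => hne e h rfl
  · have h2 : ((cut a b S).erase e).erase l ⊆
        (M ∪ (M' ∪ ((cut a b S).erase e).erase l)) ∩ cut a b S := by
      intro f hf
      refine mem_inter.2 ⟨mem_union_right _ (mem_union_right _ hf), ?_⟩
      rw [mem_erase, mem_erase] at hf
      exact hf.2.2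
    have h3 := Finset.card_le_card h2
    rw [P.card_erase_erase hl hle] at h3
    omega
  · intro v
    by_cases hv : v ∈ S
    · refine P.glue hM hcov (fun f hf => ?_) hv
      have h2 := hM' f hf
      exact ⟨mem_compl.1 (hcore _ _ h2.1), mem_compl.1 (hcore _ _ h2.2)⟩
    · rw [Finset.union_left_comm]
      have h2 := P'.glue hM' hcov' (M' := M) (fun f hf => ?_) (mem_compl.2 hv)
      · rw [cut_compl] at h2
        exact h2
      · have h2 := hM f hf
        rw [mem_compl, mem_compl, not_not, not_not]
        exact ⟨hcore _ _ h2.1, hcore _ _ h2.2⟩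

end Port

/-- Every edge has exactly one end in `X`, except for the pairwise disjoint edges `e`, `k`, `k'`,
which have both ends in `X`. -/
structure NearBip (a b : E → V) (e : E) (X : Finset V) (k k' : E) : Prop where
  mem_e : a e ∈ X ∧ b e ∈ X
  mem : a k ∈ X ∧ b k ∈ X
  mem' : a k' ∈ X ∧ b k' ∈ X
  disj : ∀ v, ¬(e ∈ cut a b {v} ∧ k ∈ cut a b {v})
  disj' : ∀ v, ¬(e ∈ cut a b {v} ∧ k' ∈ cut a b {v})
  disj₂ : ∀ v, ¬(k ∈ cut a b {v} ∧ k' ∈ cut a b {v})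
  bichromatic : ∀ f, f ≠ e → f ≠ k → f ≠ k' → ¬(a f ∈ X ↔ b f ∈ X)

theorem Port.disjoint_e {a b : E → V} {e : E} {S : Finset V} (P : Port a b e S) {l l' k : E}
    {B : Finset V} (h : Linked a b e S l l' k B) (v : V) :
    ¬(e ∈ cut a b {v} ∧ k ∈ cut a b {v}) := by
  rintro ⟨h1, h2⟩
  have h3 : v = tip a b S l ∨ v = tip a b S l' := by
    rcases P.ends_of_linked h with ⟨h3, h4⟩ | ⟨h3, h4⟩ <;>
      rcases P.graph.mem_star.1 h2 with h5 | h5 <;> rw [← h5] <;> tauto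
  have hv : v ∈ S := by
    rcases h3 with rfl | rfl
    · exact tip_mem h.mem
    · exact tip_mem h.mem'
  have h4 : tip a b S e = v := by
    rcases tip_cases P.mem with ⟨h5, h6, -⟩ | ⟨h5, h6, -⟩ <;>
      rcases P.graph.mem_star.1 h1 with h7 | h7
    · exact h5.symm.trans h7
    · exact absurd (h7 ▸ hv) h6
    · exact absurd (h7 ▸ hv) h6
    · exact h5.symm.trans h7
  rcases h3 with h3 | h3
  · exact h.ne_e (P.inj _ h.mem _ P.mem (h3.symm.trans h4.symm))
  · exact h.ne_e' (P.inj _ h.mem' _ P.mem (h3.symm.trans h4.symm))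

theorem Port.nearBip {a b : E → V} {e : E} {S : Finset V} (P : Port a b e S)
    (P' : Port a b e Sᶜ) {l l' k : E} {B : Finset V} (h : Linked a b e S l l' k B)
    {m m' k' : E} {B' : Finset V} (h' : Linked a b e Sᶜ m m' k' B')
    (hd : m ≠ l ∧ m ≠ l' ∧ m' ≠ l ∧ m' ≠ l')
    (hall : ∀ f ∈ cut a b S, f = e ∨ f = l ∨ f = l' ∨ f = m ∨ f = m') :
    NearBip a b e ((S \ B) ∪ (Sᶜ \ B')) k k' := by
  have hX1 : ∀ v, v ∈ S → (v ∈ (S \ B) ∪ (Sᶜ \ B') ↔ v ∉ B) := by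
    intro v hv; simp [hv]
  have hX2 : ∀ v, v ∉ S → (v ∈ (S \ B) ∪ (Sᶜ \ B') ↔ v ∉ B') := by
    intro v hv; simp [hv]
  have hk : a k ∈ S ∧ b k ∈ S := by
    have h1 := tip_mem h.mem
    have h2 := tip_mem h.mem'
    rcases P.ends_of_linked h with ⟨h3, h4⟩ | ⟨h3, h4⟩ <;> rw [h3, h4] <;> tauto
  have hk' : a k' ∉ S ∧ b k' ∉ S := by
    have h1 := mem_compl.1 (tip_mem h'.mem)
    have h2 := mem_compl.1 (tip_mem h'.mem')
    rcases P'.ends_of_linked h' with ⟨h3, h4⟩ | ⟨h3, h4⟩ <;> rw [h3, h4] <;> tauto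
  refine ⟨?_, ?_, ?_, P.disjoint_e h, P'.disjoint_e h', ?_, ?_⟩
  · have h1 := (hX1 _ (tip_mem P.mem)).2 h.tip_e
    have h2 := (hX2 _ (mem_compl.1 (tip_mem P'.mem))).2 h'.tip_e
    rcases tip_cases P.mem with ⟨h3, -, h4⟩ | ⟨h3, -, h4⟩ <;> rw [h3, h4] <;>
      first | exact ⟨h1, h2⟩ | exact ⟨h2, h1⟩
  · rw [hX1 _ hk.1, hX1 _ hk.2]
    have h1 := h.tip_notMem
    have h2 := h.tip_notMem'
    rcases P.ends_of_linked h with ⟨h3, h4⟩ | ⟨h3, h4⟩ <;> rw [h3, h4] <;>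
      first | exact ⟨h1, h2⟩ | exact ⟨h2, h1⟩
  · rw [hX2 _ hk'.1, hX2 _ hk'.2]
    have h1 := h'.tip_notMem
    have h2 := h'.tip_notMem'
    rcases P'.ends_of_linked h' with ⟨h3, h4⟩ | ⟨h3, h4⟩ <;> rw [h3, h4] <;>
      first | exact ⟨h1, h2⟩ | exact ⟨h2, h1⟩
  · rintro v ⟨h1, h2⟩
    rcases P.graph.mem_star.1 h1 with rfl | rfl <;>
      rcases P.graph.mem_star.1 h2 with h3 | h3
    · exact hk'.1 (h3 ▸ hk.1)
    · exact hk'.2 (h3 ▸ hk.1)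
    · exact hk'.1 (h3 ▸ hk.2)
    · exact hk'.2 (h3 ▸ hk.2)
  · intro f hfe hfk hfk'
    have hcross : f ∈ cut a b S →
        ¬(tip a b S f ∈ (S \ B) ∪ (Sᶜ \ B') ↔ tip a b Sᶜ f ∈ (S \ B) ∪ (Sᶜ \ B')) := by
      intro hf
      have hf' : f ∈ cut a b Sᶜ := by rwa [cut_compl]
      rw [hX1 _ (tip_mem hf), hX2 _ (mem_compl.1 (tip_mem hf')), not_iff_not]
      rcases hall f hf with h1 | h1 | h1 | h1 | h1
      · exact absurd h1 hfe
      · have h2 := h'.tip_mem f hf' hfe (by rw [h1]; exact hd.1.symm)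
          (by rw [h1]; exact hd.2.2.1.symm)
        have h3 := h.tip_notMem
        rw [← h1] at h3
        tauto
      · have h2 := h'.tip_mem f hf' hfe (by rw [h1]; exact hd.2.1.symm)
          (by rw [h1]; exact hd.2.2.2.symm)
        have h3 := h.tip_notMem'
        rw [← h1] at h3
        tauto
      · have h2 := h.tip_mem f hf hfe (by rw [h1]; exact hd.1) (by rw [h1]; exact hd.2.1)
        have h3 := h'.tip_notMem
        rw [← h1] at h3
        tauto
      · have h2 := h.tip_mem f hf hfe (by rw [h1]; exact hd.2.2.1) (by rw [h1]; exact hd.2.2.2)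
        have h3 := h'.tip_notMem'
        rw [← h1] at h3
        tauto
    by_cases ha : a f ∈ S <;> by_cases hb : b f ∈ S
    · have h1 := h.bichromatic f ha hb hfk
      rw [hX1 _ ha, hX1 _ hb, not_iff_not]
      exact h1
    · have h1 := hcross (mem_cut.2 fun h1 => hb (h1.1 ha))
      rwa [tip, tip, if_pos ha, if_neg (by rw [mem_compl, not_not]; exact ha)] at h1
    · have h1 := hcross (mem_cut.2 fun h1 => ha (h1.2 hb))
      rw [tip, tip, if_neg ha, if_pos (mem_compl.2 ha)] at h1
      tauto
    · have h1 := h'.bichromatic f (mem_compl.2 ha) (mem_compl.2 hb) hfk'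
      rw [hX2 _ ha, hX2 _ hb, not_iff_not]
      exact h1

theorem Port.exists_nearBip {a b : E → V} {e : E} {S : Finset V} (P : Port a b e S)
    (P' : Port a b e Sᶜ) (hpm : ∀ M, IsPM a b M → e ∉ M → (M ∩ cut a b S).card = 1)
    (hC : ¬Colored a b e S) (hC' : ¬Colored a b e Sᶜ) :
    ∃ l l' k B m m' k' B' X, Linked a b e S l l' k B ∧ Linked a b e Sᶜ m m' k' B' ∧
      NearBip a b e X k k' := by
  obtain ⟨h1, h2⟩ := P.card_obstructed_le hC
  obtain ⟨h1', h2'⟩ := P'.card_obstructed_le hC'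
  rw [cut_compl] at h1' h2'
  set Q := ((cut a b S).erase e).filter fun l => ∃ A B, Cert a b e S l A B with hQ
  set Q' := ((cut a b S).erase e).filter fun l => ∃ A B, Cert a b e Sᶜ l A B with hQ'
  have hU : Q ∪ Q' = (cut a b S).erase e := by
    rw [hQ, hQ', ← Finset.filter_or]
    refine Finset.filter_true_of_mem fun l hl => ?_
    rw [mem_erase] at hl
    exact P.cert_or_cert P' hpm hl.2 hl.1
  have hUc : (Q ∪ Q').card = 4 := by
    rw [hU, Finset.card_erase_of_mem P.mem, P.card_cut]
  have h3 := Finset.card_union_add_card_inter Q Q'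
  obtain ⟨l, l', hne, hl⟩ := Finset.card_eq_two.1 (show Q.card = 2 by omega)
  obtain ⟨m, m', hne', hm⟩ := Finset.card_eq_two.1 (show Q'.card = 2 by omega)
  have hI : Q ∩ Q' = ∅ := by rw [← Finset.card_eq_zero]; omega
  have hd : ∀ f, f ∈ Q → f ∉ Q' := fun f hf hf' => by
    have : f ∈ Q ∩ Q' := mem_inter.2 ⟨hf, hf'⟩
    rw [hI] at this
    simp at this
  rw [hl] at hd h2
  rw [hm] at hd h2'
  obtain ⟨k, B, h⟩ := h2 l (by simp) l' (by simp) hne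
  obtain ⟨k', B', h'⟩ := h2' m (by simp) m' (by simp) hne'
  refine ⟨l, l', k, B, m, m', k', B', _, h, h', P.nearBip P' h h' ?_ ?_⟩
  · have h4 := hd l (by simp)
    have h5 := hd l' (by simp)
    simp only [mem_insert, mem_singleton, not_or] at h4 h5
    exact ⟨Ne.symm h4.1, Ne.symm h5.1, Ne.symm h4.2, Ne.symm h5.2⟩
  · intro f hf
    by_cases hfe : f = e
    · exact Or.inl hfe
    have h4 : f ∈ Q ∪ Q' := by rw [hU]; exact mem_erase.2 ⟨hfe, hf⟩
    rw [hl, hm] at h4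
    simp only [mem_union, mem_insert, mem_singleton] at h4
    tauto

theorem NearBip.unique {a b : E → V} {e : E} (G : CyclicFive a b) {X Y : Finset V} {k k' m m' : E}
    (h : NearBip a b e X k k') (h' : NearBip a b e Y m m') :
    k = m ∧ k' = m' ∨ k = m' ∧ k' = m := by
  have hself : ∀ f, f ∈ cut a b {a f} := fun f => G.mem_star.2 (Or.inl rfl)
  have hke : k ≠ e := fun h1 => h.disj (a e) ⟨hself e, by rw [h1]; exact hself e⟩
  have hke' : k' ≠ e := fun h1 => h.disj' (a e) ⟨hself e, by rw [h1]; exact hself e⟩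
  have hkk : k ≠ k' := fun h1 => h.disj₂ (a k) ⟨hself k, by rw [← h1]; exact hself k⟩
  have hme : m ≠ e := fun h1 => h'.disj (a e) ⟨hself e, by rw [h1]; exact hself e⟩
  have hme' : m' ≠ e := fun h1 => h'.disj' (a e) ⟨hself e, by rw [h1]; exact hself e⟩
  have hmm : m ≠ m' := fun h1 => h'.disj₂ (a m) ⟨hself m, by rw [← h1]; exact hself m⟩
  set C := (X \ Y) ∪ (Y \ X) with hC
  have hmC : ∀ v, v ∈ C ↔ ¬(v ∈ X ↔ v ∈ Y) := by
    intro v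
    rw [hC, mem_union, mem_sdiff, mem_sdiff]
    tauto
  have haC : a e ∈ Cᶜ := by
    rw [mem_compl, hmC, not_not]
    exact iff_of_true h.mem_e.1 h'.mem_e.1
  have hbC : b e ∈ Cᶜ := by
    rw [mem_compl, hmC, not_not]
    exact iff_of_true h.mem_e.2 h'.mem_e.2
  have hcut : ∀ f, f ∈ cut a b C ↔ ¬((a f ∈ X ↔ b f ∈ X) ↔ (a f ∈ Y ↔ b f ∈ Y)) := by
    intro f
    rw [mem_cut, hmC, hmC]
    tauto
  have hX : ∀ f, (a f ∈ X ↔ b f ∈ X) ↔ (f = e ∨ f = k ∨ f = k') := by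
    intro f
    constructor
    · intro h1
      by_contra h2
      push Not at h2
      exact h.bichromatic f h2.1 h2.2.1 h2.2.2 h1
    · rintro (rfl | rfl | rfl)
      · exact iff_of_true h.mem_e.1 h.mem_e.2
      · exact iff_of_true h.mem.1 h.mem.2
      · exact iff_of_true h.mem'.1 h.mem'.2
  have hY : ∀ f, (a f ∈ Y ↔ b f ∈ Y) ↔ (f = e ∨ f = m ∨ f = m') := by
    intro f
    constructor
    · intro h1
      by_contra h2
      push Not at h2
      exact h'.bichromatic f h2.1 h2.2.1 h2.2.2 h1
    · rintro (rfl | rfl | rfl)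
      · exact iff_of_true h'.mem_e.1 h'.mem_e.2
      · exact iff_of_true h'.mem.1 h'.mem.2
      · exact iff_of_true h'.mem'.1 h'.mem'.2
  have hcut' : ∀ f, f ∈ cut a b C ↔
      ¬((f = e ∨ f = k ∨ f = k') ↔ (f = e ∨ f = m ∨ f = m')) := by
    intro f; rw [hcut, hX, hY]
  have hfour : (cut a b C).card ≤ 4 := by
    refine (Finset.card_le_card (t := {k, k', m, m'}) fun f hf => ?_).trans Finset.card_le_four
    rw [hcut'] at hf
    simp only [mem_insert, mem_singleton]
    tauto
  have hsmall : (cut a b C).card ≤ 2 → k = m ∧ k' = m' ∨ k = m' ∧ k' = m := by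
    intro h1
    rcases Finset.eq_empty_or_nonempty C with h2 | h2
    · have h3 : ∀ f, f ∉ cut a b C := fun f => by rw [h2, mem_cut]; simp
      have h4 := h3 k
      have h5 := h3 k'
      rw [hcut', not_not] at h4 h5
      have h6 := h4.1 (by simp)
      have h7 := h5.1 (by simp)
      rcases h6 with h6 | h6 | h6
      · exact absurd h6 hke
      · rcases h7 with h7 | h7 | h7
        · exact absurd h7 hke'
        · exact absurd (h6.trans h7.symm) hkk
        · exact Or.inl ⟨h6, h7⟩
      · rcases h7 with h7 | h7 | h7
        · exact absurd h7 hke'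
        · exact Or.inr ⟨h6, h7⟩
        · exact absurd (h6.trans h7.symm) hkk
    · have h3 := G.three_le_cut h2 (fun h3 => by rw [h3] at haC; simp at haC)
      omega
  by_cases hc : k = m ∨ k = m' ∨ k' = m ∨ k' = m'
  · refine hsmall ?_
    have aux : ∀ p q, (∀ f ∈ cut a b C, f = p ∨ f = q) → (cut a b C).card ≤ 2 := by
      intro p q h1
      refine (Finset.card_le_card (t := {p, q}) fun f hf => ?_).trans Finset.card_le_two
      rw [mem_insert, mem_singleton]
      exact h1 f hf
    rcases hc with h1 | h1 | h1 | h1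
    · refine aux k' m' fun f hf => ?_
      rw [hcut', h1] at hf
      by_contra h2
      rw [not_or] at h2
      exact hf (by simp [h2])
    · refine aux k' m fun f hf => ?_
      rw [hcut', h1] at hf
      by_contra h2
      rw [not_or] at h2
      exact hf (by simp [h2])
    · refine aux k m' fun f hf => ?_
      rw [hcut', h1] at hf
      by_contra h2
      rw [not_or] at h2
      exact hf (by simp [h2])
    · refine aux k m fun f hf => ?_
      rw [hcut', h1] at hf
      by_contra h2
      rw [not_or] at h2
      exact hf (by simp [h2])
  exfalso
  push Not at hc
  obtain ⟨hc1, hc2, hc3, hc4⟩ := hc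
  have hend : ∀ f, ¬(a f ∈ Y ↔ b f ∈ Y) → a f ∈ X ∧ b f ∈ X →
      ∃ v w, f ∈ cut a b {v} ∧ f ∈ cut a b {w} ∧ v ∈ X ∧ v ∉ Y ∧ w ∈ X ∧ w ∈ Y := by
    intro f h1 h2
    by_cases h3 : a f ∈ Y
    · exact ⟨b f, a f, G.mem_star.2 (Or.inr rfl), hself f, h2.2, fun h4 => h1 (iff_of_true h3 h4),
        h2.1, h3⟩
    · refine ⟨a f, b f, hself f, G.mem_star.2 (Or.inr rfl), h2.1, h3, h2.2, ?_⟩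
      by_contra h4
      exact h1 (iff_of_false h3 h4)
  have hend' : ∃ v, v ∈ Y ∧ v ∉ X := by
    have h1 : ¬(a m ∈ X ↔ b m ∈ X) := by
      rw [hX]
      push Not
      exact ⟨hme, hc1.symm, hc3.symm⟩
    by_cases h2 : a m ∈ X
    · exact ⟨b m, h'.mem.2, fun h3 => h1 (iff_of_true h2 h3)⟩
    · exact ⟨a m, h'.mem.1, h2⟩
  have hkY : ¬(a k ∈ Y ↔ b k ∈ Y) := by
    rw [hY]; push Not; exact ⟨hke, hc1, hc2⟩
  have hkY' : ¬(a k' ∈ Y ↔ b k' ∈ Y) := by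
    rw [hY]; push Not; exact ⟨hke', hc3, hc4⟩
  obtain ⟨v₁, w₁, i1, i2, i3, i4, i5, i6⟩ := hend k hkY h.mem
  obtain ⟨v₂, w₂, j1, j2, j3, j4, j5, j6⟩ := hend k' hkY' h.mem'
  obtain ⟨v₃, o1, o2⟩ := hend'
  have n₁₂ : v₁ ≠ v₂ := fun h1 => h.disj₂ v₁ ⟨i1, h1 ▸ j1⟩
  have n₁₃ : v₁ ≠ v₃ := fun h1 => i4 (h1 ▸ o1)
  have n₂₃ : v₂ ≠ v₃ := fun h1 => j4 (h1 ▸ o1)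
  have hCc : 2 < C.card := Finset.two_lt_card.2 ⟨v₁, (hmC _).2 fun h1 => i4 (h1.1 i3),
    v₂, (hmC _).2 fun h1 => j4 (h1.1 j3), v₃, (hmC _).2 fun h1 => o2 (h1.2 o1), n₁₂, n₁₃, n₂₃⟩
  have hCc' : 2 < Cᶜ.card := by
    refine Finset.two_lt_card.2 ⟨_, haC, _, hbC, w₁, ?_, G.ne e, ?_, ?_⟩
    · rw [mem_compl, hmC, not_not]
      exact iff_of_true i5 i6
    · exact fun h1 => h.disj w₁ ⟨h1 ▸ hself e, i2⟩
    · exact fun h1 => h.disj w₁ ⟨h1 ▸ G.mem_star.2 (Or.inr rfl), i2⟩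
  have := G.cut_le C (Finset.card_pos.1 (by omega)) (Finset.card_pos.1 (by omega))
  omega

theorem sum_cut_of_colored {a b : E → V} {e : E} {S : Finset V} (hab : ∀ f, a f ≠ b f)
    (h : Colored a b e S) {y : E → ℝ} (hye : y e = 0)
    (hy : ∀ v, ∑ f ∈ cut a b {v}, y f = 0) : ∑ f ∈ cut a b S, y f = 0 := by
  obtain ⟨B, hB, htip⟩ := h
  have h1 := sum_cut_color hab S B y 0 hy fun f _ => hB f
  rw [zero_mul] at h1
  rw [← h1]
  refine Finset.sum_congr rfl fun f hf => ?_
  by_cases hfe : f = e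
  · rw [hfe, hye, zero_mul]
  · have h2 := htip f hf hfe
    have h3 := tip_mem hf
    rcases tip_cases hf with ⟨h4, h5, -⟩ | ⟨h4, h5, -⟩ <;> rw [color, color, h4] <;>
      simp [h2, h3, h5]

theorem Port.sum_cut_of_linked {a b : E → V} {e : E} {S : Finset V} (P : Port a b e S)
    {l l' k : E} {B : Finset V} (h : Linked a b e S l l' k B) {y : E → ℝ} (hye : y e = 0)
    (hy : ∀ v, ∑ f ∈ cut a b {v}, y f = 0) :
    ∑ f ∈ cut a b S, y f = 2 * (y l + y l' + y k) := by
  have h1 := sum_mul_star (R := ℝ) a b y (color S B) fun f hf => absurd hf (P.graph.ne f)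
  simp_rw [hy, mul_zero, Finset.sum_const_zero] at h1
  have hk : a k ∈ S ∧ b k ∈ S ∧ a k ∉ B ∧ b k ∉ B := by
    have h2 := tip_mem h.mem
    have h3 := tip_mem h.mem'
    have h4 := h.tip_notMem
    have h5 := h.tip_notMem'
    rcases P.ends_of_linked h with ⟨h6, h7⟩ | ⟨h6, h7⟩ <;> rw [h6, h7] <;> tauto
  have hkl : k ∉ cut a b S := fun h2 => mem_cut.1 h2 (iff_of_true hk.1 hk.2.1)
  have hpt : ∀ f, y f * (color S B (a f) + color S B (b f)) =
      (if f ∈ cut a b S then y f else 0) - 2 * ((if f = l then y f else 0) +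
        (if f = l' then y f else 0) + (if f = k then y f else 0)) := by
    intro f
    by_cases hf : f ∈ cut a b S
    · have hfk : f ≠ k := fun h2 => hkl (h2 ▸ hf)
      have hcol : color S B (a f) + color S B (b f) = if tip a b S f ∈ B then 1 else -1 := by
        have h3 := tip_mem hf
        rcases tip_cases hf with ⟨h4, h5, -⟩ | ⟨h4, h5, -⟩ <;> rw [color, color, h4] <;>
          simp [h3, h5]
      rw [hcol, if_pos hf, if_neg hfk]
      by_cases h2 : f = e
      · rw [h2, hye]; simp
      by_cases h3 : f = l
      · subst h3
        rw [if_neg h.tip_notMem, if_pos rfl, if_neg h.ne]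
        ring
      by_cases h4 : f = l'
      · subst h4
        rw [if_neg h.tip_notMem', if_pos rfl, if_neg h.ne.symm]
        ring
      rw [if_pos (h.tip_mem f hf h2 h3 h4), if_neg h3, if_neg h4]
      ring
    · have h2 : f ≠ l := fun h2 => hf (h2 ▸ h.mem)
      have h3 : f ≠ l' := fun h3 => hf (h3 ▸ h.mem')
      rw [if_neg hf, if_neg h2, if_neg h3]
      by_cases h4 : f = k
      · subst h4
        rw [if_pos rfl, color, color, if_pos hk.1, if_pos hk.2.1, if_neg hk.2.2.1,
          if_neg hk.2.2.2]
        ring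
      rw [if_neg h4]
      have h5 : color S B (a f) + color S B (b f) = 0 := by
        rw [mem_cut, not_not] at hf
        by_cases h6 : a f ∈ S
        · have h7 := h.bichromatic f h6 (hf.1 h6) h4
          rw [color, color, if_pos h6, if_pos (hf.1 h6)]
          by_cases h8 : a f ∈ B
          · rw [if_pos h8, if_neg fun h9 => h7 (iff_of_true h8 h9)]; ring
          · have h9 : b f ∈ B := by
              by_contra h9
              exact h7 (iff_of_false h8 h9)
            rw [if_neg h8, if_pos h9]; ring
        · rw [color, color, if_neg h6, if_neg fun h7 => h6 (hf.2 h7), add_zero]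
      rw [h5]; ring
  have h2 : ∑ f, y f * (color S B (a f) + color S B (b f)) = 0 := by
    exact h1.symm
  simp_rw [hpt] at h2
  rw [Finset.sum_sub_distrib, ← Finset.mul_sum, Finset.sum_add_distrib, Finset.sum_add_distrib,
    Finset.sum_ite_eq' univ l, Finset.sum_ite_eq' univ l', Finset.sum_ite_eq' univ k,
    if_pos (mem_univ _), if_pos (mem_univ _), if_pos (mem_univ _), ← Finset.sum_filter,
    Finset.filter_mem_eq_inter, Finset.univ_inter] at h2
  linarith

namespace Quarter

variable {a b : E → V} {e : E} {x : E → ℝ} (Q : Quarter a b e x)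
include Q

theorem port {S : Finset V} (T : Tight a b x S) (hC : ¬Colored a b e S) : Port a b e S where
  graph := Q.graph
  odd := T.odd
  three_le_compl := Q.three_le (Q.tight_compl T)
  card_cut := (Q.mem_and_card T).2
  mem := (Q.mem_and_card T).1
  inj := by
    have key : ∀ f ∈ cut a b S, ∀ g ∈ cut a b S, f ≠ e → g ≠ e →
        tip a b S f = tip a b S g → f = g := by
      intro f hf g hg hfe hge heq
      by_contra hfg
      have h1 := Q.inner_of_tip_eq T hf hg hfe hge hfg heq
      refine hC ⟨S.erase (tip a b S e), fun k ha hb => ?_, fun k hk hke =>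
        mem_erase.2 ⟨Q.tip_ne T hk hke, tip_mem hk⟩⟩
      have h2 := Q.graph.ne k
      rw [mem_erase, mem_erase]
      rcases Q.graph.mem_star.1 (h1 k ha hb) with h3 | h3
      · rw [← h3]; tauto
      · rw [← h3]; tauto
    intro f hf g hg heq
    by_cases hfe : f = e
    · by_cases hge : g = e
      · exact hfe.trans hge.symm
      · exact absurd (by rw [← heq, hfe]) (Q.tip_ne T hg hge)
    · by_cases hge : g = e
      · exact absurd (by rw [heq, hge]) (Q.tip_ne T hf hfe)
      · exact key f hf g hg hfe hge heq

/-- Linked tight sets sharing `k` either share both links or neither. -/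
theorem link_eq {S R : Finset V} (hS : Tight a b x S) (hR : Tight a b x R) (P : Port a b e S)
    {l l' m m' k : E} {B B' : Finset V} (h : Linked a b e S l l' k B)
    (h' : Linked a b e R m m' k B') (h1 : tip a b S l = tip a b R m)
    (h2 : tip a b S l' = tip a b R m') (hlm : l = m) : l' = m' := by
  by_contra hne
  have s1 := tip_mem h.mem
  have s2 := tip_mem h.mem'
  have r1 : tip a b S l ∈ R := h1 ▸ tip_mem h'.mem
  have r2 : tip a b S l' ∈ R := h2 ▸ tip_mem h'.mem'
  have htne : tip a b S l ≠ tip a b S l' := fun h3 => h.ne (P.inj l h.mem l' h.mem' h3)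
  have hle := h.ne_e
  by_cases hodd : Odd (S ∩ R).card
  · obtain ⟨h3, -⟩ := Q.tight_inter hS hR hodd
    have i1 : tip a b S l ∈ S ∩ R := mem_inter.2 ⟨s1, r1⟩
    have i2 : tip a b S l' ∈ S ∩ R := mem_inter.2 ⟨s2, r2⟩
    have hT : Tight a b x (S ∩ R) := by
      refine ⟨hodd, h3, fun h4 => ?_, fun h4 => ?_⟩
      · have := Finset.one_lt_card.2 ⟨_, i1, _, i2, htne⟩
        omega
      · have h5 := Q.three_le (Q.tight_compl hS)
        have h6 : Sᶜ.card ≤ (S ∩ R)ᶜ.card :=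
          Finset.card_le_card (Finset.compl_subset_compl.2 Finset.inter_subset_left)
        omega
    have aux : ∀ (X : Finset V) f, f ∈ cut a b X → S ∩ R ⊆ X → tip a b X f ∈ S ∩ R →
        f ∈ cut a b (S ∩ R) ∧ tip a b (S ∩ R) f = tip a b X f := by
      intro X f hf hX ht
      rcases tip_cases hf with ⟨h4, h5, -⟩ | ⟨h4, h5, -⟩
      · have h6 : a f ∈ S ∩ R := h4 ▸ ht
        have h7 : b f ∉ S ∩ R := fun h7 => h5 (hX h7)
        exact ⟨mem_cut.2 fun h8 => h7 (h8.1 h6), by rw [tip, if_pos h6]; exact h4⟩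
      · have h6 : b f ∈ S ∩ R := h4 ▸ ht
        have h7 : a f ∉ S ∩ R := fun h7 => h5 (hX h7)
        exact ⟨mem_cut.2 fun h8 => h7 (h8.2 h6), by rw [tip, if_neg h7]; exact h4⟩
    obtain ⟨c1, c2⟩ := aux S l' h.mem' Finset.inter_subset_left i2
    obtain ⟨c3, c4⟩ := aux R m' h'.mem' Finset.inter_subset_right (h2 ▸ i2)
    have h4 := Q.inner_of_tip_eq hT c1 c3 h.ne_e' h'.ne_e' hne (by rw [c2, c4, h2]) k
      (by rcases P.ends_of_linked h with ⟨h5, -⟩ | ⟨h5, -⟩ <;> rw [h5] <;> assumption)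
      (by rcases P.ends_of_linked h with ⟨-, h5⟩ | ⟨-, h5⟩ <;> rw [h5] <;> assumption)
    have h5 := (Q.mem_and_card hT).1
    refine P.disjoint_e h _ ⟨?_, h4⟩
    exact Q.graph.mem_star_tip _ e
  · have hodd' : Odd (S ∩ Rᶜ).card := by
      have h3 : (S ∩ R).card + (S \ R).card = S.card := Finset.card_inter_add_card_sdiff _ _
      have h4 : S ∩ Rᶜ = S \ R := by ext v; simp
      have h5 := hS.odd
      rw [h4]
      rw [Nat.odd_iff] at hodd h5 ⊢
      omega
    obtain ⟨-, h3⟩ := Q.tight_inter hS (Q.tight_compl hR) hodd'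
    refine hle (h3 l ?_)
    have hmem' := h'.mem
    rw [← hlm] at hmem' h1
    rw [cross, mem_filter]
    refine ⟨mem_univ _, ?_⟩
    have k1 := mem_cut.1 h.mem
    have k2 := mem_cut.1 hmem'
    rcases tip_eq a b S l with h5 | h5 <;> rw [h5] at s1 r1 <;>
      simp only [mem_sdiff, mem_compl] <;> tauto

theorem sum_cut_of_common_link {S R : Finset V} (hS : Tight a b x S) (hR : Tight a b x R)
    (P : Port a b e S) (P' : Port a b e R) {l l' m m' k : E} {B B' : Finset V}
    (h : Linked a b e S l l' k B) (h' : Linked a b e R m m' k B') {y : E → ℝ} (hye : y e = 0)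
    (hy : ∀ v, ∑ f ∈ cut a b {v}, y f = 0) (h0 : ∑ f ∈ cut a b S, y f = 0) :
    ∑ f ∈ cut a b R, y f = 0 := by
  have hk : ∀ {S : Finset V} {l l' : E} {B : Finset V}, Port a b e S →
      Linked a b e S l l' k B → k ∉ cut a b S := by
    intro S l l' B P h h1
    have h2 := tip_mem h.mem
    have h3 := tip_mem h.mem'
    refine mem_cut.1 h1 (iff_of_true ?_ ?_)
    · rcases P.ends_of_linked h with ⟨h5, -⟩ | ⟨h5, -⟩ <;> rw [h5] <;> assumption
    · rcases P.ends_of_linked h with ⟨-, h5⟩ | ⟨-, h5⟩ <;> rw [h5] <;> assumption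
  have hkS := hk P h
  have hkR := hk P' h'
  have star : ∀ p q, p ∈ cut a b S → q ∈ cut a b R → tip a b S p = tip a b R q → p ≠ q →
      k ∈ cut a b {tip a b S p} → y p + y q + y k = 0 := by
    intro p q hp hq h1 h2 h3
    obtain ⟨g, -, -, -, hg, -⟩ := Q.third_edge (Q.graph.mem_star_tip S p)
      (h1 ▸ Q.graph.mem_star_tip R q) h2
    have hkp : k ≠ p := fun h4 => hkS (h4 ▸ hp)
    have hkq : k ≠ q := fun h4 => hkR (h4 ▸ hq)
    have h4 := h3
    rw [hg, mem_insert, mem_insert, mem_singleton] at h4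
    have h5 : g = k := by tauto
    subst h5
    have h6 := hy (tip a b S p)
    rw [hg, Finset.sum_insert (by simp [h2, hkp.symm]), Finset.sum_insert (by simp [hkq.symm]),
      Finset.sum_singleton] at h6
    linarith
  have main : ∀ m m', Linked a b e R m m' k B' → tip a b S l = tip a b R m →
      tip a b S l' = tip a b R m' → ∑ f ∈ cut a b R, y f = 0 := by
    intro m m' h' h1 h2
    have h3 := P.sum_cut_of_linked h hye hy
    have h4 := P'.sum_cut_of_linked h' hye hy
    rw [h0] at h3
    rw [h4]
    by_cases h5 : l = m
    · have h6 := Q.link_eq hS hR P h h' h1 h2 h5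
      rw [← h5, ← h6]
      linarith
    · have h6 : l' ≠ m' := fun h6 => h5 (Q.link_eq hS hR P h.symm h'.symm h2 h1 h6)
      have h7 := star l m h.mem h'.mem h1 h5 h.star
      have h8 := star l' m' h.mem' h'.mem' h2 h6 h.star'
      linarith
  rcases P.ends_of_linked h with ⟨h1, h2⟩ | ⟨h1, h2⟩ <;>
    rcases P'.ends_of_linked h' with ⟨h3, h4⟩ | ⟨h3, h4⟩
  · exact main m m' h' (h1.symm.trans h3) (h2.symm.trans h4)
  · exact main m' m h'.symm (h1.symm.trans h3) (h2.symm.trans h4)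
  · exact main m' m h'.symm (h2.symm.trans h4) (h1.symm.trans h3)
  · exact main m m' h' (h2.symm.trans h4) (h1.symm.trans h3)

theorem card_le : Fintype.card V ≤ 2 * (univ.filter fun M => IsPM a b M ∧ e ∉ M).card + 2 := by
  set Bad : Finset V → Prop := fun S => Tight a b x S ∧
    (∀ M, IsPM a b M → e ∉ M → (M ∩ cut a b S).card = 1) ∧ ¬Colored a b e S ∧
    ¬Colored a b e Sᶜ with hBad
  obtain ⟨H, hH⟩ : ∃ H : Finset E, ∀ R, Bad R → ∃ S, Bad S ∧ H = cut a b S := by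
    by_cases h : ∃ S, Bad S
    · obtain ⟨S, hS⟩ := h
      exact ⟨cut a b S, fun _ _ => ⟨S, hS, rfl⟩⟩
    · exact ⟨∅, fun R hR => absurd ⟨R, hR⟩ h⟩
  refine card_le_of_rigid Q.graph.ne Q.graph.cubic e Q.feasible Q.zero H fun y hye hy hyH => ?_
  refine ⟨fun f hf => by rw [Q.eq_of_zero hf, hye], fun R hodd hsum hpm => ?_⟩
  by_cases h1 : R.card = 1 ∨ Rᶜ.card = 1
  · exact sum_cut_of_card_one a b h1 hy
  rw [not_or] at h1
  have hR : Tight a b x R := ⟨hodd, hsum, h1.1, h1.2⟩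
  by_cases hC : Colored a b e R
  · exact sum_cut_of_colored Q.graph.ne hC hye hy
  by_cases hC' : Colored a b e Rᶜ
  · rw [← cut_compl]
    exact sum_cut_of_colored Q.graph.ne hC' hye hy
  obtain ⟨S, ⟨hS, hpmS, hCS, hCS'⟩, rfl⟩ := hH R ⟨hR, hpm, hC, hC'⟩
  have hS' := Q.tight_compl hS
  have hR' := Q.tight_compl hR
  have P := Q.port hS hCS
  have P' := Q.port hS' hCS'
  have O := Q.port hR hC
  have O' := Q.port hR' hC'
  obtain ⟨l, l', k, B, -, -, k', -, X, g, -, gX⟩ := P.exists_nearBip P' hpmS hCS hCS'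
  obtain ⟨m, m', j, D, n, n', j', D', Y, i, i', iY⟩ := O.exists_nearBip O' hpm hC hC'
  rcases gX.unique Q.graph iY with ⟨rfl, -⟩ | ⟨rfl, -⟩
  · exact Q.sum_cut_of_common_link hS hR P O g i hye hy hyH
  · rw [← cut_compl]
    exact Q.sum_cut_of_common_link hS hR' P O' g i' hye hy hyH

end Quarter

theorem CyclicFive.card_le {a b : E → V} (G : CyclicFive a b) (e : E) :
    Fintype.card V ≤ 2 * (univ.filter fun M => IsPM a b M ∧ e ∉ M).card + 2 := by
  by_cases h1 : ∃ A, IsBip a b e A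
  · obtain ⟨A, hA⟩ := h1
    exact G.card_le_of_bip hA
  push Not at h1
  by_cases h2 : ∃ A : Finset V, ∃ N, Disjoint A N ∧ NbhdIn a b e A N ∧ a e ∈ A ∧ b e ∈ A ∧
      N.card = A.card + 1
  · obtain ⟨A, hA, hmax⟩ := Finset.exists_max_image (univ.filter fun A : Finset V =>
      ∃ N, Disjoint A N ∧ NbhdIn a b e A N ∧ a e ∈ A ∧ b e ∈ A ∧ N.card = A.card + 1) Finset.card
      (by obtain ⟨A, hA⟩ := h2; exact ⟨A, by simpa using hA⟩)
    rw [mem_filter] at hA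
    obtain ⟨-, N, hd, hN, hu, hv, hc⟩ := hA
    refine G.card_le_of_maximal h1 hd hN hu hv hc fun A' N' g1 g2 g3 g4 g5 => hmax A' ?_
    rw [mem_filter]
    exact ⟨mem_univ _, N', g1, g2, g3, g4, g5⟩
  · push Not at h2
    obtain ⟨x, hx1, hx2, hx3⟩ := G.exists_weights_of_expanding h1
      fun A N g1 g2 g3 g4 => h2 A N g1 g2 g3 g4
    exact Quarter.card_le ⟨G, hx1, hx2, hx3⟩

/-- The number of ends of the edge `f` equal to `v`. -/
def endCount (a b : E → V) (v : V) (f : E) : ℕ :=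
  (if a f = v then 1 else 0) + (if b f = v then 1 else 0)

theorem sum_endCount (a b : E → V) (S : Finset V) :
    ∑ v ∈ S, ∑ f, endCount a b v f = (cut a b S).card + 2 * (inner a b S).card := by
  rw [Finset.sum_comm, cut, inner, Finset.card_filter, Finset.card_filter, Finset.mul_sum,
    ← Finset.sum_add_distrib]
  refine Finset.sum_congr rfl fun f _ => ?_
  simp only [endCount, Finset.sum_add_distrib, Finset.sum_ite_eq]
  by_cases h1 : a f ∈ S <;> by_cases h2 : b f ∈ S <;> simp [h1, h2]

/-- A vertex set spanning at least as many edges as it has vertices contains a cycle. -/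
theorem exists_cycle_of_card_le (a b : E → V) (S : Finset V) (hS : S.Nonempty)
    (h : S.card ≤ (inner a b S).card) :
    ∃ F ⊆ inner a b S, F.Nonempty ∧ ∀ v, ∑ f ∈ F, endCount a b v f ≠ 1 := by
  induction S using Finset.strongInduction with
  | H S ih =>
    have hF : (inner a b S).Nonempty := by
      rw [← Finset.card_pos]; exact lt_of_lt_of_le (Finset.card_pos.2 hS) h
    by_cases hv : ∀ v, ∑ f ∈ inner a b S, endCount a b v f ≠ 1
    · exact ⟨_, subset_rfl, hF, hv⟩
    push Not at hv
    obtain ⟨v, hv⟩ := hv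
    have hex : ∃ f ∈ inner a b S, endCount a b v f ≠ 0 := by
      by_contra hcon
      push Not at hcon
      rw [Finset.sum_eq_zero hcon] at hv
      exact zero_ne_one hv
    obtain ⟨f, hf, hfv⟩ := hex
    have hf' := (mem_filter.1 hf).2
    have hvS : v ∈ S := by
      by_cases h1 : a f = v
      · exact h1 ▸ hf'.1
      · by_cases h2 : b f = v
        · exact h2 ▸ hf'.2
        · simp [endCount, h1, h2] at hfv
    have hsub : inner a b S ⊆ inner a b (S.erase v) ∪
        (inner a b S).filter fun g => endCount a b v g ≠ 0 := by
      intro g hg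
      have hg' := (mem_filter.1 hg).2
      by_cases hgv : endCount a b v g = 0
      · refine mem_union_left _ (mem_filter.2 ⟨mem_univ _, ?_⟩)
        have h1 : a g ≠ v := by intro h1; simp [endCount, h1] at hgv
        have h2 : b g ≠ v := by intro h2; simp [endCount, h2] at hgv
        exact ⟨mem_erase.2 ⟨h1, hg'.1⟩, mem_erase.2 ⟨h2, hg'.2⟩⟩
      · exact mem_union_right _ (mem_filter.2 ⟨hg, hgv⟩)
    have hle : ((inner a b S).filter fun g => endCount a b v g ≠ 0).card ≤ 1 := by
      rw [← hv, Finset.card_filter]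
      refine Finset.sum_le_sum fun g _ => ?_
      split_ifs with h1
      · exact Nat.one_le_iff_ne_zero.2 h1
      · exact Nat.zero_le _
    have hcard := (Finset.card_le_card hsub).trans (Finset.card_union_le _ _)
    have herase := Finset.card_erase_add_one hvS
    have hne : (S.erase v).Nonempty := by
      by_contra hcon
      rw [Finset.not_nonempty_iff_eq_empty] at hcon
      have hall : ∀ w ∈ S, w = v := fun w hw => by
        by_contra h1
        have h2 : w ∈ S.erase v := mem_erase.2 ⟨h1, hw⟩
        simp [hcon] at h2
      have h2 : endCount a b v f = 2 := by simp [endCount, hall _ hf'.1, hall _ hf'.2]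
      have h3 := Finset.single_le_sum (f := endCount a b v) (fun _ _ => Nat.zero_le _) hf
      omega
    obtain ⟨F, hF1, hF2, hF3⟩ := ih _ (Finset.erase_ssubset hvS) hne (by omega)
    refine ⟨F, hF1.trans fun g hg => ?_, hF2, hF3⟩
    have hg' := (mem_filter.1 hg).2
    exact mem_filter.2 ⟨mem_univ _, mem_of_mem_erase hg'.1, mem_of_mem_erase hg'.2⟩

end ArcGraph

namespace Multigraph

open Finset ArcGraph

theorem inc_eq_endCount {G : Multigraph} {a b : G.E → G.V} (hab : ∀ f, G.ends f = s(a f, b f))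
    (v : G.V) (f : G.E) : G.inc v f = endCount a b v f := by
  have h1 : G.ends f = Sym2.diag v ↔ a f = v ∧ b f = v := by
    rw [hab, Sym2.diag, Sym2.eq_iff]; tauto
  have h2 : v ∈ G.ends f ↔ a f = v ∨ b f = v := by
    rw [hab, Sym2.mem_iff, eq_comm, @eq_comm _ v]
  simp only [inc, endCount, h1, h2]
  by_cases h3 : a f = v <;> by_cases h4 : b f = v <;> simp [h3, h4]

theorem cutEdges_eq_cut {G : Multigraph} {a b : G.E → G.V} (hab : ∀ f, G.ends f = s(a f, b f))
    (S : Finset G.V) : G.cutEdges S = cut a b S := by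
  ext f
  simp only [cutEdges, Set.mem_ofPred_eq, hab, Sym2.eq_iff, mem_coe, mem_cut]
  constructor
  · rintro ⟨u, v, ⟨rfl, rfl⟩ | ⟨rfl, rfl⟩, h1, h2⟩ <;> simp [h1, h2]
  · intro h
    by_cases h1 : a f ∈ S
    · exact ⟨a f, b f, by simp, h1, fun h2 => h (by simp [h1, h2])⟩
    · exact ⟨b f, a f, by simp, by_contra fun h2 => h (by simp [h1, h2]), h1⟩

theorem hasCycleWithin_of_card_le {G : Multigraph} {a b : G.E → G.V}
    (hab : ∀ f, G.ends f = s(a f, b f)) {S : Finset G.V} (hS : S.Nonempty)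
    (h : S.card ≤ (ArcGraph.inner a b S).card) : G.HasCycleWithin S := by
  obtain ⟨F, h1, h2, h3⟩ := exists_cycle_of_card_le a b S hS h
  refine ⟨F, h2, fun f hf v hv => ?_, fun v => ?_⟩
  · have h4 := (mem_filter.1 (h1 hf)).2
    rw [hab, Sym2.mem_iff] at hv
    rcases hv with rfl | rfl
    exacts [h4.1, h4.2]
  · simp_rw [inc_eq_endCount hab]; exact h3 v

theorem IsCubic.three_mul_card {G : Multigraph} (hcubic : G.IsCubic) {a b : G.E → G.V}
    (hab : ∀ f, G.ends f = s(a f, b f)) (S : Finset G.V) :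
    3 * S.card = (cut a b S).card + 2 * (ArcGraph.inner a b S).card := by
  rw [← sum_endCount, mul_comm, ← smul_eq_mul, ← Finset.sum_const]
  refine Finset.sum_congr rfl fun v _ => ?_
  simp_rw [← inc_eq_endCount hab]
  exact (hcubic v).symm

theorem IsCubic.cyclicFive {G : Multigraph} (hcubic : G.IsCubic)
    (h5 : G.CyclicallyEdgeConnected 5) (h4 : 4 ≤ Fintype.card G.V) {a b : G.E → G.V}
    (hab : ∀ f, G.ends f = s(a f, b f)) : CyclicFive a b := by
  have hcut : ∀ S : Finset G.V, S.Nonempty → Sᶜ.Nonempty →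
      S.card + 2 ≤ (cut a b S).card ∨ Sᶜ.card + 2 ≤ (cut a b S).card ∨
        5 ≤ (cut a b S).card := by
    intro S hS hS'
    have e1 := hcubic.three_mul_card hab S
    have e2 := hcubic.three_mul_card hab Sᶜ
    rw [cut_compl] at e2
    by_cases h1 : S.card ≤ (ArcGraph.inner a b S).card
    · by_cases h2 : Sᶜ.card ≤ (ArcGraph.inner a b Sᶜ).card
      · have h3 := h5 S ⟨hasCycleWithin_of_card_le hab hS h1, by
          simpa using hasCycleWithin_of_card_le hab hS' h2⟩
        rw [cutEdges_eq_cut hab, Set.ncard_coe_finset] at h3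
        exact Or.inr (Or.inr h3)
      · right; left; omega
    · left; omega
  have hstar : ∀ v, (cut a b {v}).card = 3 ∧ (ArcGraph.inner a b {v}).card = 0 := by
    intro v
    have e1 := hcubic.three_mul_card hab {v}
    have e2 : ({v} : Finset G.V)ᶜ.card = Fintype.card G.V - 1 := by
      rw [card_compl, card_singleton]
    have e3 := hcut {v} (singleton_nonempty v) (by rw [← card_pos]; omega)
    rw [card_singleton] at e1 e3
    omega
  refine ⟨fun f hf => ?_, fun v => (hstar v).1, h4, hcut⟩
  have h1 := Finset.card_eq_zero.1 (hstar (a f)).2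
  have h2 : f ∈ ArcGraph.inner a b {a f} := by simp [ArcGraph.inner, ← hf]
  simp [h1] at h2

theorem card_le_pmCount_deleteEdges {G : Multigraph} {a b : G.E → G.V}
    (hab : ∀ f, G.ends f = s(a f, b f)) (hne : ∀ f, a f ≠ b f) (e : G.E) :
    (univ.filter fun M => IsPM a b M ∧ e ∉ M).card ≤ (G.deleteEdges {e}).pmCount := by
  have hmem : ∀ v f, f ∈ cut a b {v} ↔ v ∈ G.ends f := by
    intro v f
    rw [mem_cut_singleton, hab, Sym2.mem_iff]
    have := hne f
    constructor
    · intro h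
      by_cases h1 : a f = v
      · exact Or.inl h1.symm
      · by_contra h2
        push Not at h2
        exact h (by simp [h1, h2.2.symm])
    · rintro (rfl | rfl) h
      · exact this (h.1 rfl).symm
      · exact this (h.2 rfl)
  let φ : {M // M ∈ univ.filter fun M => IsPM a b M ∧ e ∉ M} →
      {M : Finset (G.deleteEdges {e}).E // (G.deleteEdges {e}).IsPerfectMatching M} := fun M =>
    ⟨univ.filter fun f => f.1 ∈ M.1, by
      obtain ⟨M, hM⟩ := M
      obtain ⟨-, hM, he⟩ := mem_filter.1 hM
      refine ⟨fun f _ => ?_, fun (v : G.V) => ?_⟩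
      · change ¬(G.ends f.1).IsDiag
        rw [hab]; exact hne f.1
      · obtain ⟨f, hf⟩ := Finset.card_eq_one.1 (hM.2 v)
        have hf' : ∀ g, g ∈ M ∧ v ∈ G.ends g ↔ g = f := fun g => by
          rw [← hmem v g, ← mem_inter, hf, mem_singleton]
        have hfM := (hf' f).2 rfl
        refine ⟨⟨f, fun h => he (Set.mem_singleton_iff.1 h ▸ hfM.1)⟩,
          ⟨mem_filter.2 ⟨mem_univ _, hfM.1⟩, hfM.2⟩, fun g hg => ?_⟩
        exact Subtype.ext ((hf' g.1).1 ⟨(mem_filter.1 hg.1).2, hg.2⟩)⟩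
  have hφ : Function.Injective φ := by
    intro M N h
    have he : ∀ M : {M // M ∈ univ.filter fun M => IsPM a b M ∧ e ∉ M}, e ∉ M.1 :=
      fun M => (mem_filter.1 M.2).2.2
    ext f
    by_cases hf : f = e
    · subst hf; simp [he]
    · have h1 := Finset.ext_iff.1 (congrArg Subtype.val h) ⟨f, by simpa using hf⟩
      exact ⟨fun h2 => (mem_filter.1 (h1.1 (mem_filter.2 ⟨mem_univ _, h2⟩))).2,
        fun h2 => (mem_filter.1 (h1.2 (mem_filter.2 ⟨mem_univ _, h2⟩))).2⟩
  have := Nat.card_le_card_of_injective φ hφ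
  rwa [Nat.card_eq_fintype_card, Fintype.card_coe] at this

end Multigraph

/-- Let `G` be a cyclically 5-edge-connected cubic graph of
order `n`. For every edge `e` of `G`, the graph `G - e` has at least `n/2 - 1`
perfect matchings. -/
theorem cyclically5ec_deleteEdge_many_perfect_matchings (G : Multigraph)
    (hcubic : G.IsCubic) (h5 : G.CyclicallyEdgeConnected 5) (e : G.E) :
    (Fintype.card G.V : ℝ) / 2 - 1 ≤ ((G.deleteEdges {e}).pmCount : ℝ) := by
  have hex : ∀ f, ∃ p : G.V × G.V, G.ends f = s(p.1, p.2) := fun f =>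
    Sym2.ind (f := fun z => ∃ p : G.V × G.V, z = s(p.1, p.2)) (fun x y => ⟨(x, y), rfl⟩) (G.ends f)
  choose p hp using hex
  have h : Fintype.card G.V ≤ 2 * (G.deleteEdges {e}).pmCount + 2 := by
    by_cases h4 : 4 ≤ Fintype.card G.V
    · have H := hcubic.cyclicFive h5 h4 hp
      have h1 := H.card_le e
      have h2 := Multigraph.card_le_pmCount_deleteEdges hp H.ne e
      omega
    · have h1 := hcubic.three_mul_card hp Finset.univ
      have h2 : ArcGraph.cut (fun f => (p f).1) (fun f => (p f).2) Finset.univ = ∅ := by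
        ext f; simp [ArcGraph.mem_cut]
      rw [h2, Finset.card_empty, Finset.card_univ] at h1
      omega
  have h' : (Fintype.card G.V : ℝ) ≤ 2 * ((G.deleteEdges {e}).pmCount : ℝ) + 2 := by
    exact_mod_cast h
  linarith
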